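/- Let A be a finite subset of Sym(n) (the symmetric group on n ≥ 1 letters). Then there exists a subset A₀ ⊆ A ∪ A⁻¹ with ⟨A₀⟩ = ⟨A⟩, |A₀| ≤ 4n, and A₀ = A₀⁻¹. -/

import Mathlib

open Equiv MulAction
open scoped Pointwise

section Length

variable {G G' : Type*} [Group G] [Group G']

/-- The length of the longest chain of subgroups below `K`. -/
noncomputable def subgroupLength (K : Subgroup G) : ℕ := (Order.height K).toNat

theorem subgroupLength_le_of_strictMonoOn (ρ : Subgroup G → ℕ) (K : Subgroup G)
    (h : StrictMonoOn ρ (Set.Iic K)) : subgroupLength K ≤ ρ K := by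
  have key : ∀ (m : ℕ) (H : Subgroup G), H ≤ K → ρ H = m → Order.height H ≤ (m : ℕ∞) := by
    intro m
    induction m using Nat.strong_induction_on with
    | _ m ih =>
      intro H hH hm
      rw [Order.height_le_coe_iff]
      intro y hy
      have hlt : ρ y < m := hm ▸ h (hy.le.trans hH) hH hy
      exact lt_of_le_of_lt (ih _ hlt y (hy.le.trans hH) rfl) (by exact_mod_cast hlt)
  exact ENat.toNat_le_of_le_natCast (key _ K le_rfl rfl)

theorem height_subgroup_ne_top [Finite G] (K : Subgroup G) : Order.height K ≠ ⊤ := by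
  have key : ∀ (m : ℕ) (H : Subgroup G), Nat.card H ≤ m → Order.height H ≤ (m : ℕ∞) := by
    intro m
    induction m with
    | zero => intro H hH; exact absurd hH (by have := Nat.card_pos (α := H); lia)
    | succ m ih =>
      intro H hH
      rw [Order.height_le_coe_iff]
      intro y hy
      have hlt : Nat.card y < Nat.card H := Set.Finite.card_lt_card (Set.toFinite _) hy
      exact lt_of_le_of_lt (ih y (by lia)) (by exact_mod_cast Nat.lt_succ_self m)
  exact ne_top_of_le_ne_top (ENat.natCast_ne_top _) (key _ K le_rfl)

theorem subgroupLength_strictMono [Finite G] : StrictMono (subgroupLength (G := G)) := by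
  intro H K hHK
  have h := Order.height_strictMono hHK (height_subgroup_ne_top H).lt_top
  rw [← ENat.natCast_toNat (height_subgroup_ne_top H),
    ← ENat.natCast_toNat (height_subgroup_ne_top K)] at h
  exact_mod_cast h

theorem subgroupLength_mono [Finite G] : Monotone (subgroupLength (G := G)) :=
  subgroupLength_strictMono.monotone

theorem subgroupLength_bot [Finite G] : subgroupLength (⊥ : Subgroup G) = 0 := by
  simp [subgroupLength]

theorem subgroupLength_le_succ [Finite G] {K : Subgroup G} {m : ℕ}
    (h : ∀ H < K, subgroupLength H ≤ m) : subgroupLength K ≤ m + 1 := by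
  have : Order.height K ≤ ((m + 1 : ℕ) : ℕ∞) := by
    rw [Order.height_le_coe_iff]
    intro y hy
    rw [← ENat.natCast_toNat (height_subgroup_ne_top y)]
    exact_mod_cast Nat.lt_succ_of_le (h y hy)
  exact ENat.toNat_le_of_le_natCast this

theorem card_dvd_card_ne_of_lt [Finite G] {H K : Subgroup G} (h : H < K) :
    Nat.card H ∣ Nat.card K ∧ Nat.card H < Nat.card K :=
  ⟨Subgroup.card_dvd_of_le h.le, Set.Finite.card_lt_card (Set.toFinite _) h⟩

theorem cardFactors_lt_of_dvd {a b : ℕ} (hb : b ≠ 0) (h : a ∣ b) (hlt : a < b) :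
    ArithmeticFunction.cardFactors a < ArithmeticFunction.cardFactors b := by
  obtain ⟨c, rfl⟩ := h
  have ha : a ≠ 0 := by rintro rfl; simp at hb
  have hc : c ≠ 0 := by rintro rfl; simp at hb
  rw [ArithmeticFunction.cardFactors_mul ha hc]
  have : ArithmeticFunction.cardFactors c ≠ 0 := by
    intro h0
    rw [ArithmeticFunction.cardFactors_eq_zero_iff_eq_zero_or_one] at h0
    rcases h0 with rfl | rfl <;> simp_all
  lia

theorem subgroupLength_le_cardFactors [Finite G] (K : Subgroup G) :
    subgroupLength K ≤ ArithmeticFunction.cardFactors (Nat.card K) := by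
  refine subgroupLength_le_of_strictMonoOn
    (fun H => ArithmeticFunction.cardFactors (Nat.card H)) K ?_
  intro H _ H' _ h
  obtain ⟨h1, h2⟩ := card_dvd_card_ne_of_lt h
  exact cardFactors_lt_of_dvd Nat.card_pos.ne' h1 h2

theorem subgroupLength_map_le [Finite G] (f : G →* G') (K : Subgroup G) :
    subgroupLength (K.map f) ≤ subgroupLength K := by
  have h := subgroupLength_le_of_strictMonoOn
    (fun H => subgroupLength (H.comap f ⊓ K)) (K.map f) ?_
  · refine h.trans (subgroupLength_mono inf_le_right)
  · intro H hH H' hH' hlt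
    refine subgroupLength_strictMono (lt_of_le_of_ne
      (inf_le_inf_right _ (Subgroup.comap_mono hlt.le)) ?_)
    intro heq
    refine hlt.not_ge ?_
    intro y hy
    obtain ⟨x, hx, rfl⟩ := hH' hy
    have : x ∈ H'.comap f ⊓ K := ⟨hy, hx⟩
    rw [← heq] at this
    exact this.1

theorem subgroupLength_le_ker_add_map [Finite G] [Finite G'] (f : G →* G') (K : Subgroup G) :
    subgroupLength K ≤ subgroupLength (K ⊓ f.ker) + subgroupLength (K.map f) := by
  refine subgroupLength_le_of_strictMonoOn
    (fun H => subgroupLength (H ⊓ f.ker) + subgroupLength (H.map f)) K ?_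
  intro H _ H' _ hlt
  have h1 : H ⊓ f.ker ≤ H' ⊓ f.ker := inf_le_inf_right _ hlt.le
  have h2 : H.map f ≤ H'.map f := Subgroup.map_mono hlt.le
  rcases h1.lt_or_eq with h | h
  · exact Nat.add_lt_add_of_lt_of_le (subgroupLength_strictMono h) (subgroupLength_mono h2)
  · refine Nat.add_lt_add_of_le_of_lt (subgroupLength_mono h1)
      (subgroupLength_strictMono (lt_of_le_of_ne h2 ?_))
    intro heq
    refine hlt.not_ge fun x hx => ?_
    have hfx : f x ∈ H.map f := heq ▸ Subgroup.mem_map_of_mem f hx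
    obtain ⟨y, hy, hyx⟩ := hfx
    have hk : x * y⁻¹ ∈ H' ⊓ f.ker := by
      refine ⟨H'.mul_mem hx (H'.inv_mem (hlt.le hy)), ?_⟩
      simp [hyx]
    rw [← h] at hk
    simpa using H.mul_mem hk.1 hy

theorem subgroupLength_top_subgroup [Finite G] (K : Subgroup G) :
    subgroupLength (⊤ : Subgroup K) = subgroupLength K := by
  apply le_antisymm
  · have h := subgroupLength_le_ker_add_map K.subtype ⊤
    rw [Subgroup.ker_subtype] at h
    simp only [inf_bot_eq, subgroupLength_bot, zero_add, ← MonoidHom.range_eq_map,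
      Subgroup.range_subtype] at h
    exact h
  · have h := subgroupLength_map_le K.subtype ⊤
    rwa [← MonoidHom.range_eq_map, Subgroup.range_subtype] at h

/-- A subgroup is no longer than the kernel and the codomain of a homomorphism together. -/
theorem subgroupLength_le_of_hom [Finite G] [Finite G'] (K : Subgroup G) (f : K →* G') :
    subgroupLength K ≤ subgroupLength (f.ker.map K.subtype) +
      subgroupLength (⊤ : Subgroup G') := by
  have h := subgroupLength_le_ker_add_map f ⊤
  rw [subgroupLength_top_subgroup, top_inf_eq] at h
  refine h.trans (Nat.add_le_add ?_ (subgroupLength_mono le_top))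
  have h2 := subgroupLength_le_ker_add_map K.subtype f.ker
  rw [Subgroup.ker_subtype, inf_bot_eq, subgroupLength_bot, zero_add] at h2
  exact h2

theorem exists_subset_closure_eq [Finite G] [DecidableEq G] (A : Finset G) :
    ∃ B ⊆ A, B.card ≤ subgroupLength (⊤ : Subgroup G) ∧
      Subgroup.closure (B : Set G) = Subgroup.closure (A : Set G) := by
  suffices h : ∃ B ⊆ A, B.card ≤ subgroupLength (Subgroup.closure (B : Set G)) ∧
      Subgroup.closure (B : Set G) = Subgroup.closure (A : Set G) by
    obtain ⟨B, h1, h2, h3⟩ := h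
    exact ⟨B, h1, h2.trans (subgroupLength_mono le_top), h3⟩
  induction A using Finset.induction_on with
  | empty => exact ⟨∅, by simp, by simp, rfl⟩
  | insert a A ha ih =>
    obtain ⟨B, h1, h2, h3⟩ := ih
    by_cases haB : a ∈ Subgroup.closure (A : Set G)
    · refine ⟨B, h1.trans (Finset.subset_insert _ _), h2, ?_⟩
      rw [h3]
      apply le_antisymm
      · exact Subgroup.closure_mono (by simp)
      · rw [Subgroup.closure_le]
        rw [Finset.coe_insert, Set.insert_subset_iff]
        exact ⟨haB, Subgroup.subset_closure⟩
    · refine ⟨insert a B, Finset.insert_subset_insert _ h1, ?_, ?_⟩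
      · refine (Finset.card_insert_le _ _).trans ?_
        refine Nat.succ_le_of_lt (lt_of_le_of_lt h2 (subgroupLength_strictMono ?_))
        refine lt_of_le_of_ne (Subgroup.closure_mono (by simp)) ?_
        intro heq
        apply haB
        rw [← h3, heq]
        exact Subgroup.subset_closure (by simp)
      · rw [Finset.coe_insert, Finset.coe_insert, Set.insert_eq, Set.insert_eq,
          Subgroup.closure_union, Subgroup.closure_union, h3]

end Length

section PermLength

/-- A permutation group preserving every fibre of `π` embeds in the product of the symmetric
groups on the fibres. -/
theorem subgroupLength_le_sum_fibres {α β : Type*} [Finite α] [Fintype β] [DecidableEq β]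
    (π : α → β) (K : Subgroup (Perm α)) (hK : ∀ g ∈ K, ∀ x, π (g x) = π x) :
    subgroupLength K ≤ ∑ b, subgroupLength (⊤ : Subgroup (Perm {x // π x = b})) := by
  suffices h : ∀ (s : Finset β) (K : Subgroup (Perm α)), (∀ g ∈ K, ∀ x, π (g x) = π x) →
      (∀ g ∈ K, ∀ x, π x ∉ s → g x = x) →
      subgroupLength K ≤ ∑ b ∈ s, subgroupLength (⊤ : Subgroup (Perm {x // π x = b})) from
    h Finset.univ K hK (by simp)
  intro s
  induction s using Finset.induction_on with
  | empty =>
    intro K _ hs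
    have : K = ⊥ := by
      rw [Subgroup.eq_bot_iff_forall]
      intro g hg
      ext x
      simpa using hs g hg x (by simp)
    simp [this, subgroupLength_bot]
  | insert b s hb ih =>
    intro K hK hs
    rw [Finset.sum_insert hb, add_comm]
    let f : K →* Perm {x // π x = b} :=
      { toFun := fun g => (g : Perm α).subtypePerm (fun x => by rw [hK g g.2 x])
        map_one' := by ext x; simp
        map_mul' := fun g h => rfl }
    refine (subgroupLength_le_of_hom K f).trans (Nat.add_le_add_right (ih _ ?_ ?_) _)
    · rintro _ ⟨g, -, rfl⟩ x
      exact hK g g.2 x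
    · rintro _ ⟨g, hg, rfl⟩ x hx
      by_cases hxb : π x = b
      · have : f g ⟨x, hxb⟩ = ⟨x, hxb⟩ := by rw [MonoidHom.mem_ker.1 hg]; rfl
        exact congrArg Subtype.val this
      · exact hs g g.2 x (by simp [hxb, hx])

end PermLength

section Reduction

theorem cardFactors_factorial_le {n : ℕ} (hn : n ≤ 26) :
    ArithmeticFunction.cardFactors n.factorial ≤ 2 * n - 3 := by
  have step (k : ℕ) : ArithmeticFunction.cardFactors (k + 1).factorial =
      (k + 1).primeFactorsList.length + ArithmeticFunction.cardFactors k.factorial := by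
    rw [Nat.factorial_succ, ArithmeticFunction.cardFactors_mul k.succ_ne_zero k.factorial_ne_zero,
      ArithmeticFunction.cardFactors_apply]
  have two : ArithmeticFunction.cardFactors 2 = 1 :=
    ArithmeticFunction.cardFactors_apply_prime Nat.prime_two
  interval_cases n <;> simp [step, two]

variable {α : Type} [Fintype α] [DecidableEq α]

omit [DecidableEq α] in
theorem subgroupLength_le_of_not_transitive {n : ℕ} (hn : 27 ≤ n)
    (ih : ∀ m < n, ∀ (β : Type) [Fintype β], Fintype.card β = m →
      subgroupLength (⊤ : Subgroup (Perm β)) ≤ 2 * m - 3)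
    (hα : Fintype.card α = n) (G : Subgroup (Perm α)) (hG : ¬ IsPretransitive G α) :
    subgroupLength G ≤ 2 * n - 5 := by
  classical
  have : Nonempty α := Fintype.card_pos_iff.1 (by lia)
  obtain ⟨x⟩ := this
  have hx : orbit G x ≠ Set.univ := by
    intro h
    exact hG ((isPretransitive_iff_orbit_eq_univ x).2 h)
  obtain ⟨y, hy⟩ := (Set.ne_univ_iff_exists_notMem _).1 hx
  let π : α → Bool := fun z => decide (z ∈ orbit G x)
  have h := subgroupLength_le_sum_fibres π G (by
    intro g hg z
    simp only [π]
    congr 1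
    exact propext (orbit_eq_iff.symm.trans (by
      rw [show g z = (⟨g, hg⟩ : G) • z from rfl, orbit_smul, orbit_eq_iff])))
  have hsum : Fintype.card {z // π z = true} + Fintype.card {z // π z = false} = n := by
    have := Fintype.card_subtype_compl (fun z => π z = true)
    have h2 := Fintype.card_subtype_le (fun z => π z = true)
    have h3 : Fintype.card {z // π z = false} = Fintype.card {z // ¬ π z = true} :=
      Fintype.card_congr (Equiv.subtypeEquivRight (by simp))
    rw [h3, this, hα]
    omega
  have h1 : 0 < Fintype.card {z // π z = true} :=
    Fintype.card_pos_iff.2 ⟨⟨x, by simp [π]⟩⟩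
  have h2 : 0 < Fintype.card {z // π z = false} :=
    Fintype.card_pos_iff.2 ⟨⟨y, by simpa [π] using hy⟩⟩
  rw [Fintype.sum_bool] at h
  have i1 := ih _ (by lia) {z // π z = true} rfl
  have i2 := ih _ (by lia) {z // π z = false} rfl
  lia

theorem subgroupLength_le_of_not_primitive {n : ℕ} (hn : 27 ≤ n)
    (ih : ∀ m < n, ∀ (β : Type) [Fintype β], Fintype.card β = m →
      subgroupLength (⊤ : Subgroup (Perm β)) ≤ 2 * m - 3)
    (hα : Fintype.card α = n) (G : Subgroup (Perm α)) [IsPretransitive G α]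
    (hG : ¬ IsPreprimitive G α) :
    subgroupLength G ≤ 2 * n - 5 := by
  classical
  obtain ⟨B, hB, hBs, hBu⟩ : ∃ B : Set α, IsBlock G B ∧ ¬ B.Subsingleton ∧ B ≠ Set.univ := by
    by_contra! hcon
    refine hG ⟨fun {B} hB => ?_⟩
    rcases B.subsingleton_or_nontrivial with h | h
    · exact Or.inl h
    · exact Or.inr (hcon B hB h)
  have hBn : B.Nonempty := by
    rw [Set.nonempty_iff_ne_empty]; rintro rfl; simp at hBs
  have hpart := (hB.isBlockSystem hBn).1.2
  have hcard := hB.ncard_block_mul_ncard_orbit_eq hBn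
  have hm : 2 ≤ B.ncard := by
    have := Set.one_lt_ncard_iff_nontrivial.2 (Set.not_subsingleton_iff.1 hBs)
    lia
  have hmn : B.ncard < n := by
    have := Set.ncard_lt_card hBu
    rwa [Nat.card_eq_fintype_card, hα] at this
  rw [Nat.card_eq_fintype_card, hα] at hcard
  have hk : 2 ≤ (orbit G B).ncard := by
    by_contra! h
    interval_cases h' : (orbit G B).ncard <;> lia
  have hkn : (orbit G B).ncard < n := by nlinarith
  have hex (x : α) : ∃ b : orbit G B, x ∈ b.1 := by
    obtain ⟨b, ⟨hb, hxb⟩, -⟩ := hpart x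
    exact ⟨⟨b, hb⟩, hxb⟩
  choose π hπ using hex
  have huniq (x : α) (b : orbit G B) (hb : x ∈ b.1) : π x = b := by
    obtain ⟨c, -, hc⟩ := hpart x
    exact Subtype.ext ((hc _ ⟨(π x).2, hπ x⟩).trans (hc _ ⟨b.2, hb⟩).symm)
  let f : G →* Perm (orbit G B) := toPermHom G (orbit G B)
  have h := subgroupLength_le_of_hom G f
  have hfib (b : orbit G B) : Fintype.card {x // π x = b} = B.ncard := by
    obtain ⟨_, g, rfl⟩ := b
    rw [← Set.ncard_smul_set g B, ← Nat.card_coe_set_eq, Nat.card_eq_fintype_card]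
    refine Fintype.card_congr (Equiv.subtypeEquivRight fun x => ⟨?_, ?_⟩)
    · intro hx
      have := hπ x
      rw [hx] at this
      exact this
    · intro hx
      exact huniq x _ hx
  have h1 := subgroupLength_le_sum_fibres π (f.ker.map G.subtype) (by
    rintro _ ⟨g, hg, rfl⟩ x
    apply huniq
    have h3 : g • (π x) = π x := by
      have := congrArg (fun σ : Perm (orbit G B) => σ (π x)) (MonoidHom.mem_ker.1 hg)
      exact this
    rw [← h3]
    exact Set.smul_mem_smul_set (hπ x))
  have h2 : ∑ b, subgroupLength (⊤ : Subgroup (Perm {x // π x = b})) ≤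
      (orbit G B).ncard * (2 * B.ncard - 3) := by
    rw [← Nat.card_coe_set_eq, Nat.card_eq_fintype_card, ← smul_eq_mul, ← Finset.card_univ]
    exact Finset.sum_le_card_nsmul _ _ _ fun b _ => ih _ hmn _ (hfib b)
  have h3 := ih _ hkn (orbit G B) (by rw [← Nat.card_coe_set_eq, Nat.card_eq_fintype_card])
  have h4 : (orbit G B).ncard * (2 * B.ncard - 3) + 3 * (orbit G B).ncard = 2 * n := by
    obtain ⟨m, hm'⟩ := Nat.exists_eq_add_of_le hm
    rw [← hcard, hm', show 2 * (2 + m) - 3 = 2 * m + 1 by lia]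
    ring
  lia

/-- Babai's bound for subgroup chains, granted the bound for primitive groups. -/
theorem subgroupLength_perm_le_of_primitive
    (hprim : ∀ (n : ℕ), 27 ≤ n → ∀ (α : Type) [Fintype α] [DecidableEq α],
      Fintype.card α = n → ∀ G : Subgroup (Perm α), IsPreprimitive G α →
        ¬ alternatingGroup α ≤ G → ArithmeticFunction.cardFactors (Nat.card G) ≤ 2 * n - 5)
    (n : ℕ) : ∀ (α : Type) [Fintype α], Fintype.card α = n →
      subgroupLength (⊤ : Subgroup (Perm α)) ≤ 2 * n - 3 := by
  classical
  induction n using Nat.strong_induction_on with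
  | _ n ih =>
    intro α _ hα
    rcases le_or_gt n 26 with hn | hn
    · refine (subgroupLength_le_cardFactors _).trans ?_
      rw [Subgroup.card_top, Nat.card_perm, Nat.card_eq_fintype_card, hα]
      exact cardFactors_factorial_le hn
    · have hng (G : Subgroup (Perm α)) (hG : ¬ alternatingGroup α ≤ G) :
          subgroupLength G ≤ 2 * n - 5 := by
        by_cases ht : IsPretransitive G α
        · by_cases hp : IsPreprimitive G α
          · exact (subgroupLength_le_cardFactors _).trans (hprim n hn α hα G hp hG)
          · exact subgroupLength_le_of_not_primitive hn ih hα G hp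
        · exact subgroupLength_le_of_not_transitive hn ih hα G ht
      have : Nontrivial α := Fintype.one_lt_card_iff_nontrivial.1 (by lia)
      have hidx (H : Subgroup (Perm α)) (h1 : alternatingGroup α ≤ H) (h2 : H ≠ ⊤) :
          H.index = 2 := by
        have h3 := Subgroup.index_dvd_of_le h1
        rw [alternatingGroup.index_eq_two] at h3
        rcases (Nat.dvd_prime Nat.prime_two).1 h3 with h | h
        · exact absurd (Subgroup.index_eq_one.1 h) h2
        · exact h
      have h1 : ∀ H < (⊤ : Subgroup (Perm α)), subgroupLength H ≤ (2 * n - 5) + 1 := by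
        intro H hH
        refine subgroupLength_le_succ fun K hK => hng K fun hA => ?_
        have hk := hidx K hA (hK.trans hH).ne
        have hh := hidx H (hA.trans hK.le) hH.ne
        exact (Subgroup.index_strictAnti hK).ne' (hk.trans hh.symm)
      have := subgroupLength_le_succ h1
      lia

end Reduction

section Order

theorem cardFactors_mul_log_le {N P : ℕ} :
    (ArithmeticFunction.cardFactors N : ℝ) * Real.log P ≤ Real.log N +
      ∑ p ∈ Nat.primesBelow P, (N.factorization p : ℝ) * (Real.log P - Real.log p) := by
  have h1 : (ArithmeticFunction.cardFactors N : ℝ) =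
      ∑ p ∈ N.primeFactors, (N.factorization p : ℝ) := by
    rw [ArithmeticFunction.cardFactors_eq_sum_factorization]
    simp [Finsupp.sum]
  have h2 : Real.log N = ∑ p ∈ N.primeFactors, (N.factorization p : ℝ) * Real.log p := by
    rw [Real.log_nat_eq_sum_factorization]
    simp [Finsupp.sum]
  have h3 : ∑ p ∈ Nat.primesBelow P, (N.factorization p : ℝ) * (Real.log P - Real.log p) =
      ∑ p ∈ (N.primeFactors).filter (· < P),
        (N.factorization p : ℝ) * (Real.log P - Real.log p) := by
    symm
    apply Finset.sum_subset
    · intro p hp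
      simp only [Finset.mem_filter, Nat.mem_primeFactors] at hp
      exact Nat.mem_primesBelow.2 ⟨hp.2, hp.1.1⟩
    · intro p hp hp'
      rw [Nat.mem_primesBelow] at hp
      have : p ∉ N.primeFactors := fun h => hp' (Finset.mem_filter.2 ⟨h, hp.1⟩)
      rw [← Nat.support_factorization, Finsupp.notMem_support_iff] at this
      simp [this]
  rw [h1, h2, h3, Finset.sum_filter, ← Finset.sum_add_distrib, Finset.sum_mul]
  refine Finset.sum_le_sum fun p hp => ?_
  split_ifs with h
  · linarith
  · have hp0 : p.Prime := Nat.prime_of_mem_primeFactors hp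
    rw [add_zero]
    refine mul_le_mul_of_nonneg_left ?_ (Nat.cast_nonneg _)
    rcases Nat.eq_zero_or_pos P with rfl | hP
    · simp only [Nat.cast_zero, Real.log_zero]
      exact Real.log_natCast_nonneg p
    · exact Real.log_le_log (by exact_mod_cast hP) (by exact_mod_cast not_lt.1 h)

theorem cardFactors_lt_of_factorization_le {N P M : ℕ} (c : ℕ → ℕ) (hN : N ≠ 0) (hP : 0 < P)
    (hc : ∀ p ∈ Nat.primesBelow P, N.factorization p ≤ c p)
    (h : N * P ^ (∑ p ∈ Nat.primesBelow P, c p) <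
      P ^ M * ∏ p ∈ Nat.primesBelow P, p ^ c p) :
    ArithmeticFunction.cardFactors N < M := by
  by_contra! hM
  have h1 := cardFactors_mul_log_le (N := N) (P := P)
  have hlogP : 0 ≤ Real.log P := Real.log_natCast_nonneg P
  have h2 : ∑ p ∈ Nat.primesBelow P, (N.factorization p : ℝ) * (Real.log P - Real.log p) ≤
      ∑ p ∈ Nat.primesBelow P, (c p : ℝ) * (Real.log P - Real.log p) := by
    refine Finset.sum_le_sum fun p hp => ?_
    have hp' := Nat.mem_primesBelow.1 hp
    refine mul_le_mul_of_nonneg_right (by exact_mod_cast hc p hp) (sub_nonneg.2 ?_)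
    exact Real.log_le_log (by exact_mod_cast hp'.2.pos) (by exact_mod_cast hp'.1.le)
  have h3 : (M : ℝ) * Real.log P ≤ ArithmeticFunction.cardFactors N * Real.log P :=
    mul_le_mul_of_nonneg_right (by exact_mod_cast hM) hlogP
  have h4 : Real.log ((N * P ^ (∑ p ∈ Nat.primesBelow P, c p) : ℕ) : ℝ) <
      Real.log ((P ^ M * ∏ p ∈ Nat.primesBelow P, p ^ c p : ℕ) : ℝ) :=
    Real.log_lt_log (by positivity) (by exact_mod_cast h)
  have hne : ∏ p ∈ Nat.primesBelow P, (p : ℝ) ^ c p ≠ 0 := by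
    refine Finset.prod_ne_zero_iff.2 fun p hp => pow_ne_zero _ ?_
    exact_mod_cast (Nat.mem_primesBelow.1 hp).2.ne_zero
  push_cast at h4
  rw [Real.log_mul (by positivity) (by positivity), Real.log_mul (by positivity) hne,
    Real.log_pow, Real.log_pow, Real.log_prod (fun p hp => pow_ne_zero _ (by
      exact_mod_cast (Nat.mem_primesBelow.1 hp).2.ne_zero))] at h4
  simp only [Real.log_pow, mul_sub, Finset.sum_sub_distrib, ← Finset.sum_mul] at h1 h2 h4
  push_cast at h4
  linarith

variable {α : Type*} [Fintype α] [DecidableEq α]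

omit [Fintype α] [DecidableEq α] in
theorem perm_apply_inv_self (g : Perm α) (x : α) : g (g⁻¹ x) = x := g.apply_symm_apply x

theorem support_commutator_subset (g h : Perm α) :
    (g * h * g⁻¹ * h⁻¹).support ⊆ (g.support ∩ h.support) ∪
      ((g.support ∩ h.support).image g ∪ (g.support ∩ h.support).image h) := by
  intro x hx
  by_contra hcon
  simp only [Finset.mem_union, Finset.mem_image, Finset.mem_inter, Perm.mem_support,
    not_or, not_exists, not_and] at hcon hx
  obtain ⟨h0, h1, h2⟩ := hcon
  have h1' : ¬ (g (g⁻¹ x) ≠ g⁻¹ x ∧ h (g⁻¹ x) ≠ g⁻¹ x) := fun hh => h1 _ hh (by simp)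
  have h2' : ¬ (g (h⁻¹ x) ≠ h⁻¹ x ∧ h (h⁻¹ x) ≠ h⁻¹ x) := fun hh => h2 _ hh (by simp)
  rw [perm_apply_inv_self] at h1' h2'
  apply hx
  simp only [Perm.mul_apply]
  by_cases hh : h⁻¹ x = x
  · rw [hh]
    by_cases hg : g⁻¹ x = x
    · rw [hg, ← hh, perm_apply_inv_self, hh]
      rw [← hg, perm_apply_inv_self, hg]
    · have : h (g⁻¹ x) = g⁻¹ x := by
        by_contra h3
        exact h1' ⟨fun h4 => hg h4.symm, h3⟩
      rw [this, perm_apply_inv_self]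
  · have h3 : g (h⁻¹ x) = h⁻¹ x := by
      by_contra h3
      exact h2' ⟨h3, fun h4 => hh h4.symm⟩
    rw [Perm.inv_eq_iff_eq.2 h3.symm, perm_apply_inv_self]
    by_contra h4
    exact h0 h4 fun h5 => hh (Perm.inv_eq_iff_eq.2 h5.symm)

theorem card_support_commutator_le (g h : Perm α) :
    (g * h * g⁻¹ * h⁻¹).support.card ≤ 3 * (g.support ∩ h.support).card := by
  refine (Finset.card_le_card (support_commutator_subset g h)).trans ?_
  refine (Finset.card_union_le _ _).trans ?_
  have h1 := Finset.card_union_le ((g.support ∩ h.support).image g)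
    ((g.support ∩ h.support).image h)
  have h2 := Finset.card_image_le (s := g.support ∩ h.support) (f := g)
  have h3 := Finset.card_image_le (s := g.support ∩ h.support) (f := h)
  lia

/-- A primitive group containing a nontrivial element of support at most `3` is giant. -/
theorem alternatingGroup_le_of_card_support_le_three {G : Subgroup (Perm α)}
    (hG : IsPreprimitive G α) {g : Perm α} (hg : g ∈ G) (hg1 : g ≠ 1)
    (hs : g.support.card ≤ 3) : alternatingGroup α ≤ G := by
  have h2 := Perm.two_le_card_support_of_ne_one hg1
  interval_cases h : g.support.card
  · rw [Perm.subgroup_eq_top_of_isPreprimitive_of_isSwap_mem hG g (Perm.card_support_eq_two.1 h) hg]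
    exact le_top
  · exact Perm.alternatingGroup_le_of_isPreprimitive_of_isThreeCycle_mem hG
      (card_support_eq_three_iff.1 h) hg

/-- Bochert's bound. -/
theorem card_mul_factorial_le_of_isPreprimitive {G : Subgroup (Perm α)}
    (hG : IsPreprimitive G α) (hA : ¬ alternatingGroup α ≤ G) :
    Nat.card G * (Fintype.card α - Fintype.card α / 2).factorial ≤
      (Fintype.card α).factorial := by
  classical
  let base : Finset α → Prop := fun S => ∀ g ∈ G, (∀ x ∈ S, g x = x) → g = 1
  obtain ⟨Δ, hΔ, hmin⟩ := Finset.exists_min_image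
    ((Finset.univ : Finset (Finset α)).filter base) Finset.card
    ⟨Finset.univ, by
      simp only [Finset.mem_filter, Finset.mem_univ, true_and, base]
      intro g _ hx
      ext x
      simpa using hx x⟩
  simp only [Finset.mem_filter, Finset.mem_univ, true_and] at hΔ hmin
  have hb : Δ.card ≤ Fintype.card α / 2 := by
    by_contra! hlt
    have hc : Δᶜ.card < Δ.card := by
      rw [Finset.card_compl]
      lia
    have h1 : ¬ base Δᶜ := fun h => absurd (hmin _ h) (by lia)
    simp only [base, not_forall] at h1
    obtain ⟨g, hgG, hgf, hg1⟩ := h1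
    obtain ⟨δ, hδ⟩ : ∃ δ, g δ ≠ δ := by
      by_contra! h
      exact hg1 (by ext x; simp [h x])
    have hδΔ : δ ∈ Δ := by
      by_contra h
      exact hδ (hgf δ (by simpa using h))
    have h2 : ¬ base (Δ.erase δ) := fun h => by
      have := hmin _ h
      have := Finset.card_erase_lt_of_mem hδΔ
      lia
    simp only [base, not_forall] at h2
    obtain ⟨h, hhG, hhf, hh1⟩ := h2
    have hhδ : h δ ≠ δ := by
      intro hh
      refine hh1 (hΔ h hhG fun x hx => ?_)
      by_cases hxδ : x = δ
      · rw [hxδ, hh]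
      · exact hhf x (Finset.mem_erase.2 ⟨hxδ, hx⟩)
    have hI : g.support ∩ h.support ⊆ {δ} := by
      intro x hx
      simp only [Finset.mem_inter, Perm.mem_support] at hx
      rw [Finset.mem_singleton]
      by_contra hxδ
      have hxΔ : x ∈ Δ := by
        by_contra h'
        exact hx.1 (hgf x (by simpa using h'))
      exact hx.2 (hhf x (Finset.mem_erase.2 ⟨hxδ, hxΔ⟩))
    have hI' (x : α) (h1 : g x ≠ x) (h2 : h x ≠ x) : x = δ :=
      Finset.mem_singleton.1 (hI (by simp [h1, h2]))
    refine hA (alternatingGroup_le_of_card_support_le_three hG (g := g * h * g⁻¹ * h⁻¹)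
      (G.mul_mem (G.mul_mem (G.mul_mem hgG hhG) (G.inv_mem hgG)) (G.inv_mem hhG)) ?_ ?_)
    · intro hcomm
      have hcomm' : g * h = h * g := by
        rw [mul_assoc _ g⁻¹, ← mul_inv_rev] at hcomm
        exact mul_inv_eq_one.1 hcomm
      have e : g (h δ) = h (g δ) := congrArg (fun σ : Perm α => σ δ) hcomm'
      have e1 : g (h δ) = h δ := by
        by_contra hne
        exact hhδ (hI' _ hne (fun h' => hhδ (h.injective h')))
      have e2 : h (g δ) = g δ := by
        by_contra hne
        exact hδ (hI' _ (fun h' => hδ (g.injective h')) hne)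
      rw [e1, e2] at e
      refine hδ (hI' (g δ) (fun h' => hδ (g.injective h')) ?_)
      rw [← e]
      exact fun h' => hhδ (h.injective h')
    · refine (card_support_commutator_le g h).trans ?_
      have := Finset.card_le_card hI
      rw [Finset.card_singleton] at this
      lia
  have hcard : Nat.card G ≤ (Fintype.card α).descFactorial Δ.card := by
    have e := Fintype.card_embedding_eq (α := Δ) (β := α)
    rw [Fintype.card_coe] at e
    rw [← e, ← Nat.card_eq_fintype_card]
    refine Nat.card_le_card_of_injective
      (fun g : G => (Function.Embedding.subtype (· ∈ Δ)).trans (g : Perm α).toEmbedding) ?_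
    intro g h hgh
    have : (h : Perm α)⁻¹ * g = 1 := by
      refine hΔ _ (G.mul_mem (G.inv_mem h.2) g.2) fun x hx => ?_
      have := congrArg (fun f : Δ ↪ α => f ⟨x, hx⟩) hgh
      rw [Perm.mul_apply, Perm.inv_eq_iff_eq]
      exact this
    exact Subtype.ext (inv_mul_eq_one.1 this).symm
  have hle : Δ.card ≤ Fintype.card α := Finset.card_le_univ _
  calc _ ≤ (Fintype.card α).descFactorial Δ.card * (Fintype.card α - Δ.card).factorial :=
        Nat.mul_le_mul hcard (Nat.factorial_le (by lia))
    _ = _ := by rw [mul_comm, Nat.factorial_mul_descFactorial hle]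

/-- A permutation group all of whose nontrivial elements move at least `m + 1` points is
semiregular on injective tuples of the complementary length. -/
theorem card_mul_factorial_dvd_of_lt_card_support {G : Subgroup (Perm α)} {m : ℕ}
    (hm : m ≤ Fintype.card α) (h : ∀ g ∈ G, g ≠ 1 → m < g.support.card) :
    Nat.card G * m.factorial ∣ (Fintype.card α).factorial := by
  classical
  have hst (f : Fin (Fintype.card α - m) ↪ α) : stabilizer G f = ⊥ := by
    rw [Subgroup.eq_bot_iff_forall]
    rintro g hg
    by_contra hg1
    have h1 := h g g.2 (fun h' => hg1 (Subtype.ext h'))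
    have h2 : (g : Perm α).support ⊆ (Finset.univ.map f)ᶜ := by
      intro x hx
      rw [Finset.mem_compl, Finset.mem_map]
      rintro ⟨i, -, rfl⟩
      exact Perm.mem_support.1 hx (congrArg (fun e : Fin (Fintype.card α - m) ↪ α => e i) hg)
    have h3 := Finset.card_le_card h2
    rw [Finset.card_compl, Finset.card_map, Finset.card_univ, Fintype.card_fin] at h3
    lia
  have e := Nat.card_congr (selfEquivOrbitsQuotientProd hst)
  rw [Nat.card_prod, Nat.card_eq_fintype_card, Fintype.card_embedding_eq, Fintype.card_fin] at e
  have h1 : Nat.card G ∣ (Fintype.card α).descFactorial (Fintype.card α - m) := ⟨_, e.trans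
    (mul_comm _ _)⟩
  have h2 := Nat.factorial_mul_descFactorial (Nat.sub_le (Fintype.card α) m)
  rw [Nat.sub_sub_self hm] at h2
  rw [← h2, mul_comm]
  exact Nat.mul_dvd_mul_left _ h1

end Order

section Numerics

set_option maxRecDepth 100000

/-- The primes below `101`. -/
def smallPrimes : List ℕ :=
  [2, 3, 5, 7, 11, 13, 17, 19, 23, 29, 31, 37, 41, 43, 47, 53, 59, 61, 67, 71, 73, 79, 83, 89, 97]

theorem primesBelow_eleven : Nat.primesBelow 11 = {2, 3, 5, 7} := by decide +kernel

theorem primesBelow_hundred_one : Nat.primesBelow 101 = smallPrimes.toFinset := by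
  decide +kernel

/-- Legendre's formula for the exponent of `p` in `n !`, with `k` terms. -/
def legendreSum (p : ℕ) : ℕ → ℕ → ℕ
  | 0, _ => 0
  | k + 1, n => n / p + legendreSum p k (n / p)

theorem legendreSum_eq (p k n : ℕ) :
    legendreSum p k n = ∑ i ∈ Finset.Ico 1 (k + 1), n / p ^ i := by
  induction k generalizing n with
  | zero => rfl
  | succ k ih =>
    rw [legendreSum, ih, Finset.sum_Ico_eq_sum_range, Finset.sum_Ico_eq_sum_range,
      Nat.add_sub_cancel, Nat.add_sub_cancel, Finset.sum_range_succ', add_comm]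
    congr 1
    · refine Finset.sum_congr rfl fun i _ => ?_
      rw [Nat.div_div_eq_div_mul, add_comm i 1, add_comm 1 (1 + i), pow_succ']
    · simp

theorem factorization_factorial_eq_legendreSum {p n k : ℕ} (hp : p.Prime) (h : n < 2 ^ (k + 1)) :
    n.factorial.factorization p = legendreSum p k n := by
  rw [legendreSum_eq]
  apply Nat.factorization_factorial hp
  have h1 : n < p ^ (k + 1) := h.trans_le (Nat.pow_le_pow_left hp.two_le _)
  exact Nat.log_lt_of_lt_pow' (by lia) h1

/-- The product `(a + 1) ⋯ (a + l)`, evaluated by `k` rounds of binary splitting. -/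
def splitAscFactorial : ℕ → ℕ → ℕ → ℕ
  | 0, a, l => (a + 1).ascFactorial l
  | k + 1, a, l => splitAscFactorial k a (l / 2) * splitAscFactorial k (a + l / 2) (l - l / 2)

theorem splitAscFactorial_eq (k a l : ℕ) : splitAscFactorial k a l = (a + 1).ascFactorial l := by
  induction k generalizing a l with
  | zero => rfl
  | succ k ih =>
    rw [splitAscFactorial, ih, ih, show a + l / 2 + 1 = a + 1 + l / 2 by omega,
      Nat.ascFactorial_mul_ascFactorial, Nat.add_sub_cancel' (Nat.div_le_self l 2)]

/-- The arithmetic condition forcing `m` to be less than the minimal degree of a nongiant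
doubly transitive group of degree `n`. -/
def belowDegree (n m : ℕ) : Bool :=
  decide (8 * n ^ 2 < 3 * m * (n - 3 * m) ^ 2 ∧ n ≤ 9 * m ∧ 3 * m < n)

theorem belowDegree_mono {n n' m : ℕ} (h : belowDegree n m) (hn : n ≤ n') (hm : n' ≤ 9 * m) :
    belowDegree n' m := by
  simp only [belowDegree, decide_eq_true_eq] at h ⊢
  obtain ⟨h1, -, h3⟩ := h
  refine ⟨?_, hm, by omega⟩
  obtain ⟨d, rfl⟩ := Nat.exists_eq_add_of_lt h3
  obtain ⟨e, rfl⟩ := Nat.exists_eq_add_of_le hn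
  rw [show 3 * m + d + 1 - 3 * m = d + 1 by omega] at h1
  rw [show 3 * m + d + 1 + e - 3 * m = d + 1 + e by omega]
  have h4 : (3 * m + d + 1) * (d + 1 + e) ≥ (3 * m + d + 1 + e) * (d + 1) := by nlinarith
  have h5 := Nat.pow_le_pow_left h4 2
  have h6 : 0 < (3 * m + d + 1) ^ 2 := by positivity
  refine lt_of_mul_lt_mul_left ?_ h6.le
  have h7 : 0 < (3 * m + d + 1 + e) ^ 2 := by positivity
  have h8 := Nat.mul_lt_mul_of_pos_right h1 h7
  calc (3 * m + d + 1) ^ 2 * (8 * (3 * m + d + 1 + e) ^ 2)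
      = 8 * (3 * m + d + 1) ^ 2 * (3 * m + d + 1 + e) ^ 2 := by ring
    _ < 3 * m * (d + 1) ^ 2 * (3 * m + d + 1 + e) ^ 2 := h8
    _ = 3 * m * ((3 * m + d + 1 + e) * (d + 1)) ^ 2 := by ring
    _ ≤ 3 * m * ((3 * m + d + 1) * (d + 1 + e)) ^ 2 := Nat.mul_le_mul_left _ h5
    _ = _ := by ring

/-- The comparison bounding the number of prime factors of the order of a group of degree between
`n` and `n'`, given the primes `l` below `P`. -/
def orderCheck (l : List ℕ) (P n n' m : ℕ) : Bool :=
  let c := fun p => legendreSum p 12 n' - legendreSum p 12 m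
  decide (splitAscFactorial 6 (n' - n' / 2) (n' / 2) * P ^ (l.map c).sum <
    P ^ (2 * n - 4) * (l.map fun p => p ^ c p).prod)

theorem cardFactors_le_of_orderCheck {l : List ℕ} {P n₁ n₂ m n N : ℕ} (hP : 0 < P)
    (hl : Nat.primesBelow P = l.toFinset) (hl' : l.Nodup) (h : orderCheck l P n₁ n₂ m)
    (hn₁ : n₁ ≤ n) (hn₂ : n ≤ n₂) (hm : m ≤ n₂) (hn₂' : n₂ < 2 ^ 13) (hN : N ≠ 0)
    (h1 : N * m.factorial ∣ n.factorial)
    (h2 : N * (n - n / 2).factorial ≤ n.factorial) :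
    ArithmeticFunction.cardFactors N ≤ 2 * n - 5 := by
  simp only [orderCheck, decide_eq_true_eq, splitAscFactorial_eq] at h
  have hasc : (n₂ - n₂ / 2).factorial * (n₂ - n₂ / 2 + 1).ascFactorial (n₂ / 2) =
      n₂.factorial := by
    rw [Nat.factorial_mul_ascFactorial, Nat.sub_add_cancel (Nat.div_le_self _ _)]
  have hasc' : (n - n / 2).factorial * (n - n / 2 + 1).ascFactorial (n / 2) =
      n.factorial := by
    rw [Nat.factorial_mul_ascFactorial, Nat.sub_add_cancel (Nat.div_le_self _ _)]
  have hNle : N ≤ (n₂ - n₂ / 2 + 1).ascFactorial (n₂ / 2) := by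
    have h3 : N ≤ (n - n / 2 + 1).ascFactorial (n / 2) := by
      rw [← hasc', mul_comm] at h2
      exact Nat.le_of_mul_le_mul_left h2 (Nat.factorial_pos _)
    refine h3.trans ?_
    obtain ⟨d, hd⟩ := Nat.exists_eq_add_of_le (show n / 2 ≤ n₂ / 2 by omega)
    calc (n - n / 2 + 1).ascFactorial (n / 2)
        ≤ (n₂ - n₂ / 2 + 1).ascFactorial (n / 2) := Nat.ascFactorial_le _ (by omega)
      _ ≤ (n₂ - n₂ / 2 + 1).ascFactorial (n / 2) *
          (n₂ - n₂ / 2 + 1 + n / 2).ascFactorial d :=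
        Nat.le_mul_of_pos_right _ (by rw [add_right_comm]; exact Nat.ascFactorial_pos _ _)
      _ = (n₂ - n₂ / 2 + 1).ascFactorial (n₂ / 2) := by
        rw [Nat.ascFactorial_mul_ascFactorial, hd]
  have hlt := cardFactors_lt_of_factorization_le (N := N) (P := P) (M := 2 * n₁ - 4)
    (fun p => legendreSum p 12 n₂ - legendreSum p 12 m) hN hP ?_ ?_
  · omega
  · intro p hp
    have hp' := Nat.prime_of_mem_primesBelow hp
    have h3 := (Nat.factorization_le_iff_dvd (mul_ne_zero hN (Nat.factorial_ne_zero m))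
      (Nat.factorial_ne_zero n₂)).2 (h1.trans (Nat.factorial_dvd_factorial hn₂)) p
    rw [Nat.factorization_mul hN (Nat.factorial_ne_zero m), Finsupp.add_apply,
      factorization_factorial_eq_legendreSum hp' hn₂',
      factorization_factorial_eq_legendreSum hp' (hm.trans_lt hn₂')] at h3
    exact Nat.le_sub_of_add_le h3
  · rw [hl, List.sum_toFinset _ hl', List.prod_toFinset _ hl']
    exact (Nat.mul_le_mul_right _ hNle).trans_lt h

theorem cardFactors_le_of_le_ninety_one {n N : ℕ} (hn : 27 ≤ n) (hn' : n ≤ 91) (hN : N ≠ 0)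
    (h1 : N ∣ n.factorial) (h2 : N * (n - n / 2).factorial ≤ n.factorial) :
    ArithmeticFunction.cardFactors N ≤ 2 * n - 5 := by
  have key : ∀ n ∈ Finset.Icc 27 91, orderCheck [2, 3, 5, 7] 11 n n 0 = true := by decide +kernel
  exact cardFactors_le_of_orderCheck (by norm_num) (primesBelow_eleven.trans (by decide))
    (by decide) (key n (Finset.mem_Icc.2 ⟨hn, hn'⟩)) le_rfl le_rfl (Nat.zero_le _)
    (by omega) hN (by simpa using h1) h2

/-- Increase `m` at most `k` times as long as `belowDegree n` holds. -/
def raiseDegree (n : ℕ) : ℕ → ℕ → ℕ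
  | 0, m => m
  | k + 1, m => bif belowDegree n (m + 1) then raiseDegree n k (m + 1) else m

/-- Run both checks for `k` consecutive blocks of `s` degrees, starting at `n`. -/
def blockCheck (s : ℕ) : ℕ → ℕ → ℕ → Bool
  | 0, _, _ => true
  | k + 1, n, m =>
    let m' := raiseDegree n 3 m
    (belowDegree n m' && decide (n + s ≤ 9 * m' + 1)) &&
      (orderCheck smallPrimes 101 n (n + s - 1) m' && blockCheck s k (n + s) m')

theorem exists_belowDegree_of_blockCheck {s : ℕ} (k : ℕ) {n₀ m₀ n : ℕ}
    (h : blockCheck s k n₀ m₀) (hn : n₀ ≤ n) (hn' : n < n₀ + k * s)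
    (hlt : n₀ + k * s ≤ 2 ^ 13) :
    ∃ m, belowDegree n m ∧ ∀ N ≠ 0, N * m.factorial ∣ n.factorial →
      N * (n - n / 2).factorial ≤ n.factorial → ArithmeticFunction.cardFactors N ≤ 2 * n - 5 := by
  induction k generalizing n₀ m₀ with
  | zero => omega
  | succ k ih =>
    simp only [blockCheck, Bool.and_eq_true, decide_eq_true_eq] at h
    obtain ⟨⟨h1, h2⟩, h3, h4⟩ := h
    rw [Nat.succ_mul] at hn' hlt
    by_cases hns : n < n₀ + s
    · refine ⟨_, belowDegree_mono h1 hn (by omega), fun N hN hd hle => ?_⟩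
      simp only [belowDegree, decide_eq_true_eq] at h1
      exact cardFactors_le_of_orderCheck (by norm_num) primesBelow_hundred_one (by decide)
        h3 hn (by omega) (by omega) (by omega) hN hd hle
    · exact ih h4 (by omega) (by omega) (by omega)

theorem exists_belowDegree {n : ℕ} (hn : 92 ≤ n) (hn' : n < 3400) :
    ∃ m, belowDegree n m ∧ ∀ N ≠ 0, N * m.factorial ∣ n.factorial →
      N * (n - n / 2).factorial ≤ n.factorial → ArithmeticFunction.cardFactors N ≤ 2 * n - 5 := by
  have key₁ : blockCheck 8 375 92 18 = true := by decide +kernel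
  have key₂ : blockCheck 4 77 3092 972 = true := by decide +kernel
  by_cases h : n < 3092
  · exact exists_belowDegree_of_blockCheck 375 key₁ hn h (by norm_num)
  · exact exists_belowDegree_of_blockCheck 77 key₂ (by omega) hn' (by norm_num)

end Numerics

section DoublyTransitive

theorem mul_sub_lt_mul_sub_sq {n u m : ℝ} (hn : 77 ≤ n) (hu : 4 ≤ u) (hum : u ≤ m)
    (hm : 3 * m < n) (h : 8 * n ^ 2 < 3 * m * (n - 3 * m) ^ 2) :
    3 * n * (n - u) < u * (n - 3 * u) ^ 2 := by
  rcases le_total (9 * u) n with h9 | h9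
  · have h1 : 0 ≤ (u - 4) * (n ^ 2 - 6 * n * (u + 4) + 9 * (u ^ 2 + 4 * u + 16)) :=
      mul_nonneg (by linarith) (by nlinarith)
    nlinarith
  · have h1 : n ^ 2 - 6 * n * (u + m) + 9 * (u ^ 2 + u * m + m ^ 2) ≤ 0 := by
      nlinarith [mul_nonneg (sub_nonneg.2 hum) (sub_nonneg.2 h9),
        mul_nonneg (sub_nonneg.2 hm.le) (sub_nonneg.2 h9),
        mul_nonneg (sub_nonneg.2 hm.le) (sub_nonneg.2 hum)]
    nlinarith [mul_nonneg (sub_nonneg.2 hum) (neg_nonneg.2 h1)]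

variable {α : Type*} [Fintype α] {G : Subgroup (Perm α)}

/-- Averaging over a doubly transitive group, for a function of the images of two points. -/
theorem sum_apply_pair_of_doubly_transitive [Fintype G]
    (h2 : ∀ a b c d : α, a ≠ b → c ≠ d → ∃ g ∈ G, g a = c ∧ g b = d)
    (F : α → α → ℝ) {a b : α} (hab : a ≠ b) :
    (Fintype.card α : ℝ) * (Fintype.card α - 1) * ∑ x : G, F (x.1 a) (x.1 b) =
      Fintype.card G * ∑ p ∈ (Finset.univ : Finset α).offDiag, F p.1 p.2 := by
  have hconst : ∀ p ∈ (Finset.univ : Finset α).offDiag,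
      ∑ x : G, F (x.1 p.1) (x.1 p.2) = ∑ x : G, F (x.1 a) (x.1 b) := by
    intro p hp
    obtain ⟨g, hg, h3, h4⟩ := h2 a b p.1 p.2 hab (Finset.mem_offDiag.1 hp).2.2
    rw [← h3, ← h4]
    exact Fintype.sum_equiv (Equiv.mulRight (⟨g, hg⟩ : G)) _ _ fun x => by simp
  have hsum : ∀ x : G, ∑ p ∈ (Finset.univ : Finset α).offDiag, F (x.1 p.1) (x.1 p.2) =
      ∑ p ∈ (Finset.univ : Finset α).offDiag, F p.1 p.2 := by
    intro x
    refine Finset.sum_equiv (Equiv.prodCongr x.1 x.1) (fun p => ?_) fun p _ => by simp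
    simp [Finset.mem_offDiag]
  have hcard : (((Finset.univ : Finset α).offDiag.card : ℕ) : ℝ) =
      (Fintype.card α : ℝ) * (Fintype.card α - 1) := by
    rw [Finset.offDiag_card, Finset.card_univ, Nat.cast_sub (Nat.le_mul_self _)]
    push_cast
    ring
  rw [← hcard, ← nsmul_eq_mul, ← Finset.sum_const, ← Finset.sum_congr rfl hconst,
    Finset.sum_comm, Finset.sum_congr rfl fun x _ => hsum x, Finset.sum_const, nsmul_eq_mul,
    Finset.card_univ]

/-- Averaging over a transitive group. -/
theorem sum_apply_of_transitive [Fintype G]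
    (h1 : ∀ a b : α, ∃ g ∈ G, g a = b) (F : α → ℝ) (a : α) :
    (Fintype.card α : ℝ) * ∑ x : G, F (x.1 a) = Fintype.card G * ∑ p, F p := by
  have hconst : ∀ p ∈ (Finset.univ : Finset α), ∑ x : G, F (x.1 p) = ∑ x : G, F (x.1 a) := by
    intro p _
    obtain ⟨g, hg, h3⟩ := h1 a p
    rw [← h3]
    exact Fintype.sum_equiv (Equiv.mulRight (⟨g, hg⟩ : G)) _ _ fun x => by simp
  have hsum : ∀ x : G, ∑ p, F (x.1 p) = ∑ p, F p := fun x => Equiv.sum_comp x.1 F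
  rw [← Finset.card_univ, ← nsmul_eq_mul, ← Finset.sum_const, ← Finset.sum_congr rfl hconst,
    Finset.sum_comm, Finset.sum_congr rfl fun x _ => hsum x, Finset.sum_const, nsmul_eq_mul,
    Finset.card_univ]

variable [DecidableEq α]

theorem card_support_bound_of_doubly_transitive
    (h2 : ∀ a b c d : α, a ≠ b → c ≠ d → ∃ g ∈ G, g a = c ∧ g b = d)
    {g : Perm α} (hg : g ∈ G) (hg1 : g ≠ 1)
    (hmin : ∀ h ∈ G, h ≠ 1 → g.support.card ≤ h.support.card)
    (h3u : 3 * g.support.card < Fintype.card α) :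
    (g.support.card : ℝ) * ((Fintype.card α : ℝ) - 3 * g.support.card) ^ 2 ≤
      3 * Fintype.card α * ((Fintype.card α : ℝ) - g.support.card) := by
  classical
  have : Fintype G := Fintype.ofFinite G
  set U := g.support with hU
  set n : ℝ := (Fintype.card α : ℝ) with hn
  set u : ℝ := (U.card : ℝ) with hu
  have hupos : 0 < U.card := by
    rw [Finset.card_pos, hU, Finset.nonempty_iff_ne_empty, Ne, Perm.support_eq_empty_iff]
    exact hg1
  have hu0 : 0 < u := by rw [hu]; exact_mod_cast hupos
  have h3u' : 3 * u < n := by rw [hu, hn]; exact_mod_cast h3u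
  have hu2 : 1 < u := by
    have := Perm.two_le_card_support_of_ne_one hg1
    rw [hu]
    exact_mod_cast this
  let c : α → ℝ := fun a => if a ∈ U then 1 else 0
  have hc : ∑ a, c a = u := by simp [c, hu]
  have hcU : ∀ a ∈ U, c a = 1 := fun a ha => if_pos ha
  have hcc : ∀ a, c a * c a = c a := fun a => by simp [c]
  let I : G → ℝ := fun x => ∑ a ∈ U, c (x.1 a)
  let W : G → ℝ := fun x => ∑ a ∈ U, (1 - c (x.1 a)) * c (x.1 (g a))
  have h1 : ∀ a b : α, ∃ g ∈ G, g a = b := by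
    intro a b
    have hlt : 1 < Fintype.card α := by omega
    have : Nontrivial α := Fintype.one_lt_card_iff_nontrivial.1 hlt
    obtain ⟨a', ha⟩ := exists_ne a
    obtain ⟨b', hb⟩ := exists_ne b
    obtain ⟨x, hx, h, -⟩ := h2 a a' b b' ha.symm hb.symm
    exact ⟨x, hx, h⟩
  set N : ℝ := (Fintype.card G : ℝ) with hN
  have hN0 : 0 < N := by
    rw [hN]; exact_mod_cast Fintype.card_pos
  have hoff : ∀ F : α → α → ℝ, ∑ p ∈ (Finset.univ : Finset α).offDiag, F p.1 p.2 =
      ∑ a, ∑ b, F a b - ∑ a, F a a := by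
    intro F
    rw [eq_sub_iff_add_eq, ← Finset.sum_product', ← Finset.univ.diag_union_offDiag,
      Finset.sum_union (Finset.disjoint_diag_offDiag _), Finset.sum_diag, add_comm]
  have hI1 : n * ∑ x, I x = N * u ^ 2 := by
    simp only [I]
    rw [Finset.sum_comm, Finset.mul_sum,
      Finset.sum_congr rfl fun a _ => sum_apply_of_transitive h1 c a, hc, Finset.sum_const,
      nsmul_eq_mul]
    ring
  have hsame : ∀ a, n * ∑ x : G, c (x.1 a) * c (x.1 a) = N * u := by
    intro a
    simp only [hcc]
    rw [sum_apply_of_transitive h1 c a, hc]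
  have hdiff : ∀ a b, a ≠ b → n * (n - 1) * ∑ x : G, c (x.1 a) * c (x.1 b) =
      N * (u * u - u) := by
    intro a b hab
    rw [sum_apply_pair_of_doubly_transitive h2 (fun a b => c a * c b) hab,
      hoff fun a b => c a * c b]
    simp only [hcc, hc, ← Finset.mul_sum, ← Finset.sum_mul, hN]
  have hI2 : n * (n - 1) * ∑ x, I x ^ 2 = N * u ^ 2 * (n - 1 + (u - 1) ^ 2) := by
    have : ∀ x, I x ^ 2 = ∑ a ∈ U, ∑ b ∈ U, c (x.1 a) * c (x.1 b) := by
      intro x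
      rw [sq, Finset.sum_mul_sum]
    simp only [this]
    rw [Finset.sum_comm, Finset.mul_sum]
    have h : ∀ a ∈ U, n * (n - 1) * ∑ x : G, ∑ b ∈ U, c (x.1 a) * c (x.1 b) =
        (n - 1) * (N * u) + (u - 1) * (N * (u * u - u)) := by
      intro a ha
      rw [Finset.sum_comm, Finset.mul_sum, ← Finset.add_sum_erase _ _ ha,
        Finset.sum_congr rfl fun b hb => hdiff a b (Finset.ne_of_mem_erase hb).symm,
        Finset.sum_const, Finset.card_erase_of_mem ha, nsmul_eq_mul,
        Nat.cast_sub (by omega), Nat.cast_one, ← hu, mul_right_comm, hsame a]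
      ring
    rw [Finset.sum_congr rfl h, Finset.sum_const, nsmul_eq_mul, ← hu]
    ring
  have hW1 : n * (n - 1) * ∑ x, W x = N * u ^ 2 * (n - u) := by
    simp only [W]
    rw [Finset.sum_comm, Finset.mul_sum]
    have h : ∀ a ∈ U, n * (n - 1) * ∑ x : G, (1 - c (x.1 a)) * c (x.1 (g a)) =
        N * ((n - u) * u) := by
      intro a ha
      rw [sum_apply_pair_of_doubly_transitive h2 (fun a b => (1 - c a) * c b)
        (Ne.symm (Perm.mem_support.1 ha)), hoff fun a b => (1 - c a) * c b]
      simp only [← Finset.mul_sum, ← Finset.sum_mul, hc, Finset.sum_sub_distrib, sub_mul, hcc,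
        one_mul, sub_self, Finset.sum_const_zero, sub_zero, Finset.sum_const, nsmul_eq_mul,
        Finset.card_univ]
      rw [← sub_mul]
    rw [Finset.sum_congr rfl h, Finset.sum_const, nsmul_eq_mul, ← hu]
    ring
  have hIeq : ∀ x, I x = ((U.filter fun a => x.1 a ∈ U).card : ℝ) := by
    intro x
    simp [I, c]
  have hWI : ∀ x, W x ≤ I x := by
    intro x
    have h : I x = ∑ a ∈ U, c (x.1 (g a)) := by
      refine Finset.sum_equiv g.symm (fun a => ?_) fun a _ => by simp
      rw [hU, ← Perm.apply_mem_support (x := g.symm a), Equiv.apply_symm_apply]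
    rw [h]
    refine Finset.sum_le_sum fun a _ => ?_
    simp only [c]
    split_ifs <;> norm_num
  have hWcase : ∀ x, W x ≤ 0 ∨ u ≤ 3 * I x := by
    intro x
    by_contra! hcon
    obtain ⟨hpos, hlt⟩ := hcon
    obtain ⟨a, ha, hane⟩ := Finset.exists_ne_zero_of_sum_ne_zero hpos.ne'
    have ha1 : x.1 a ∉ U := by
      intro h
      simp [c, h] at hane
    have ha2 : x.1 (g a) ∈ U := by
      by_contra h
      simp [c, h] at hane
    set h : Perm α := x.1⁻¹ * g * x.1 with hh
    have hhG : h ∈ G := mul_mem (mul_mem (inv_mem x.2) hg) x.2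
    have hsupp : ∀ b, b ∈ h.support ↔ x.1 b ∈ U := by
      intro b
      rw [Perm.mem_support, hU, Perm.mem_support, hh, Perm.mul_apply, Perm.mul_apply, Ne,
        Perm.inv_eq_iff_eq]
    have hne : g * h * g⁻¹ * h⁻¹ ≠ 1 := by
      intro h'
      have h4 : g * h = h * g := by
        have := congrArg (fun k => k * h * g) h'
        simpa [mul_assoc] using this
      have h5 := congrArg (fun k : Perm α => k a) h4
      simp only [Perm.mul_apply] at h5
      rw [Perm.notMem_support.1 (mt (hsupp a).1 ha1)] at h5
      exact Perm.mem_support.1 ((hsupp _).2 ha2) h5.symm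
    have hle := (hmin _ (mul_mem (mul_mem (mul_mem hg hhG) (inv_mem hg)) (inv_mem hhG)) hne).trans
      (card_support_commutator_le g h)
    have hinter : g.support ∩ h.support = U.filter fun a => x.1 a ∈ U := by
      ext b
      rw [Finset.mem_inter, hsupp, Finset.mem_filter]
    rw [hinter] at hle
    rw [hIeq] at hlt
    refine absurd hlt (not_lt.2 ?_)
    rw [hu]
    exact_mod_cast hle
  have hn0 : 0 < n := by linarith
  have hkey : ∀ x, W x * (u * (n - 3 * u) ^ 2) ≤ 3 * (n * I x - u ^ 2) ^ 2 := by
    intro x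
    rcases hWcase x with h | h
    · nlinarith [sq_nonneg (n * I x - u ^ 2), mul_nonneg hu0.le (sq_nonneg (n - 3 * u))]
    · have h4 : 0 ≤ u * (n - 3 * u) ^ 2 := by positivity
      refine (mul_le_mul_of_nonneg_right (hWI x) h4).trans ?_
      have h5 : 0 ≤ (3 * I x - u) * (n ^ 2 * I x - 3 * u ^ 3) := by
        apply mul_nonneg (by linarith)
        have h6 : n ^ 2 * u ≤ n ^ 2 * (3 * I x) := mul_le_mul_of_nonneg_left h (by positivity)
        have h7 : (3 * u) ^ 2 ≤ n ^ 2 := pow_le_pow_left₀ (by positivity) h3u'.le 2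
        nlinarith
      nlinarith
  have hsum : (∑ x, W x) * (u * (n - 3 * u) ^ 2) ≤
      3 * (n ^ 2 * ∑ x, I x ^ 2 - 2 * n * u ^ 2 * ∑ x, I x + N * u ^ 4) := by
    have h4 := Finset.sum_le_sum fun x (_ : x ∈ Finset.univ) => hkey x
    rw [← Finset.sum_mul] at h4
    refine h4.trans_eq ?_
    rw [← Finset.mul_sum]
    congr 1
    rw [Finset.mul_sum, Finset.mul_sum, ← Finset.sum_sub_distrib, hN, ← Finset.card_univ,
      ← nsmul_eq_mul, ← Finset.sum_const, ← Finset.sum_add_distrib]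
    refine Finset.sum_congr rfl fun x _ => by ring
  have hvar : n * (n - 1) * (n ^ 2 * ∑ x, I x ^ 2 - 2 * n * u ^ 2 * ∑ x, I x + N * u ^ 4) =
      N * u ^ 2 * n * (n - u) ^ 2 := by
    calc _ = n ^ 2 * (n * (n - 1) * ∑ x, I x ^ 2) -
          2 * n * u ^ 2 * (n - 1) * (n * ∑ x, I x) + n * (n - 1) * N * u ^ 4 := by ring
      _ = _ := by rw [hI1, hI2]; ring
  have hn1 : 0 < n * (n - 1) := mul_pos hn0 (by linarith)
  have h4 := mul_le_mul_of_nonneg_left hsum hn1.le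
  rw [← mul_assoc, hW1, mul_left_comm _ 3, hvar] at h4
  have h5 : 0 < N * u ^ 2 * (n - u) := mul_pos (by positivity) (by linarith)
  refine le_of_mul_le_mul_left ?_ h5
  linarith

theorem lt_card_support_of_belowDegree
    (h2 : ∀ a b c d : α, a ≠ b → c ≠ d → ∃ g ∈ G, g a = c ∧ g b = d)
    (hG : IsPreprimitive G α) (hA : ¬ alternatingGroup α ≤ G) {m : ℕ}
    (hn : 77 ≤ Fintype.card α) (hm : belowDegree (Fintype.card α) m)
    {g : Perm α} (hg : g ∈ G) (hg1 : g ≠ 1) : m < g.support.card := by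
  obtain ⟨g₀, ⟨hg₀, hg₀1⟩, hmin⟩ := (measure fun h : Perm α => h.support.card).wf.has_min
    {h | h ∈ G ∧ h ≠ 1} ⟨g, hg, hg1⟩
  have hmin' : ∀ h ∈ G, h ≠ 1 → g₀.support.card ≤ h.support.card := fun h hh hh1 =>
    not_lt.1 (hmin h ⟨hh, hh1⟩)
  refine lt_of_lt_of_le ?_ (hmin' g hg hg1)
  by_contra! hle
  have h4 : 3 < g₀.support.card := by
    by_contra! h
    exact hA (alternatingGroup_le_of_card_support_le_three hG hg₀ hg₀1 h)
  simp only [belowDegree, decide_eq_true_eq] at hm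
  obtain ⟨hm1, hm2, hm3⟩ := hm
  have hbound := card_support_bound_of_doubly_transitive h2 hg₀ hg₀1 hmin' (by omega)
  have hm3' : (3 * m : ℝ) < Fintype.card α := by exact_mod_cast hm3
  have hm1' : (8 * (Fintype.card α : ℝ) ^ 2) < 3 * m * ((Fintype.card α : ℝ) - 3 * m) ^ 2 := by
    have h5 : ((Fintype.card α - 3 * m : ℕ) : ℝ) = (Fintype.card α : ℝ) - 3 * m := by
      rw [Nat.cast_sub hm3.le]
      push_cast
      rfl
    rw [← h5]
    exact_mod_cast hm1
  exact absurd hbound (not_le.2 (mul_sub_lt_mul_sub_sq (by exact_mod_cast hn) (by exact_mod_cast h4)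
    (by exact_mod_cast hle) hm3' hm1'))

end DoublyTransitive

section Separation

variable {α : Type*}

/-- The pointwise stabilizer in `H` of a finite set of points. -/
def pointwiseStabilizer (H : Subgroup (Perm α)) (S : Finset α) : Subgroup (Perm α) where
  carrier := {h | h ∈ H ∧ ∀ s ∈ S, h s = s}
  mul_mem' := fun ha hb =>
    ⟨H.mul_mem ha.1 hb.1, fun s hs => by rw [Perm.mul_apply, hb.2 s hs, ha.2 s hs]⟩
  one_mem' := ⟨H.one_mem, fun _ _ => rfl⟩
  inv_mem' := fun ha => ⟨H.inv_mem ha.1, fun s hs => by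
    rw [Perm.inv_eq_iff_eq, ha.2 s hs]⟩

theorem mem_pointwiseStabilizer {H : Subgroup (Perm α)} {S : Finset α} {h : Perm α} :
    h ∈ pointwiseStabilizer H S ↔ h ∈ H ∧ ∀ s ∈ S, h s = s := Iff.rfl

theorem pointwiseStabilizer_le (H : Subgroup (Perm α)) (S : Finset α) :
    pointwiseStabilizer H S ≤ H := fun _ h => h.1

variable [Fintype α]

open Classical in
/-- The orbit of a point as a finite set. -/
noncomputable def orbitFinset (H : Subgroup (Perm α)) (x : α) : Finset α :=
  Finset.univ.filter fun y => ∃ h ∈ H, h x = y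

theorem mem_orbitFinset {H : Subgroup (Perm α)} {x y : α} :
    y ∈ orbitFinset H x ↔ ∃ h ∈ H, h x = y := by
  classical simp [orbitFinset]

theorem self_mem_orbitFinset (H : Subgroup (Perm α)) (x : α) : x ∈ orbitFinset H x :=
  mem_orbitFinset.2 ⟨1, H.one_mem, rfl⟩

theorem orbitFinset_mono {H K : Subgroup (Perm α)} (h : H ≤ K) (x : α) :
    orbitFinset H x ⊆ orbitFinset K x := fun _ hy =>
  let ⟨g, hg, hgx⟩ := mem_orbitFinset.1 hy
  mem_orbitFinset.2 ⟨g, h hg, hgx⟩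

theorem orbitFinset_eq_of_mem {H : Subgroup (Perm α)} {x y : α} (h : y ∈ orbitFinset H x) :
    orbitFinset H y = orbitFinset H x := by
  obtain ⟨g, hg, rfl⟩ := mem_orbitFinset.1 h
  ext z
  simp only [mem_orbitFinset]
  constructor
  · rintro ⟨k, hk, rfl⟩
    exact ⟨k * g, H.mul_mem hk hg, rfl⟩
  · rintro ⟨k, hk, rfl⟩
    exact ⟨k * g⁻¹, H.mul_mem hk (H.inv_mem hg), by simp⟩

theorem mem_orbitFinset_symm {H : Subgroup (Perm α)} {x y : α} (h : y ∈ orbitFinset H x) :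
    x ∈ orbitFinset H y := by
  rw [orbitFinset_eq_of_mem h]
  exact self_mem_orbitFinset H x

theorem card_le_card_pointwiseStabilizer_mul (H : Subgroup (Perm α)) (S : Finset α) :
    Nat.card H ≤ Nat.card (pointwiseStabilizer H S) * ∏ s ∈ S, (orbitFinset H s).card := by
  classical
  let f : Perm α → S → α := fun h s => h s
  have hcard : ∀ K : Subgroup (Perm α), Nat.card K = (Finset.univ.filter (· ∈ K)).card :=
    fun K => by rw [Nat.card_eq_fintype_card, Fintype.card_subtype]
  rw [hcard, hcard]
  refine (Finset.card_le_mul_card_image (f := f) _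
    (Finset.univ.filter (· ∈ pointwiseStabilizer H S)).card ?_).trans
      (Nat.mul_le_mul_left _ ?_)
  · intro a ha
    obtain ⟨h₀, hh₀, rfl⟩ := Finset.mem_image.1 ha
    refine Finset.card_le_card_of_injOn (fun h => h₀⁻¹ * h) (fun h hh => ?_)
      fun _ _ _ _ h => mul_left_cancel h
    simp only [Finset.coe_filter, Finset.mem_filter, Finset.mem_univ, true_and,
      Set.mem_ofPred_eq] at hh hh₀ ⊢
    refine ⟨H.mul_mem (H.inv_mem hh₀) hh.1, fun s hs => ?_⟩
    rw [Perm.mul_apply, Perm.inv_eq_iff_eq]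
    exact congrFun hh.2 ⟨s, hs⟩
  · have : (Finset.univ.filter (· ∈ H)).image f ⊆
        Fintype.piFinset fun s : S => orbitFinset H s := by
      intro a ha
      obtain ⟨h, hh, rfl⟩ := Finset.mem_image.1 ha
      exact Fintype.mem_piFinset.2 fun s =>
        mem_orbitFinset.2 ⟨h, (Finset.mem_filter.1 hh).2, rfl⟩
    refine (Finset.card_le_card this).trans_eq ?_
    rw [Fintype.card_piFinset, Finset.prod_coe_sort S fun s => (orbitFinset H s).card]

open Classical in
/-- The number of ordered pairs of distinct points in a common orbit. -/
noncomputable def orbitPairs (H : Subgroup (Perm α)) : ℕ :=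
  ∑ x, ((orbitFinset H x).erase x).card

theorem sum_card_orbitFinset (H : Subgroup (Perm α)) :
    ∑ x, (orbitFinset H x).card = Fintype.card α + orbitPairs H := by
  classical
  rw [orbitPairs, ← Finset.card_univ, Finset.card_eq_sum_ones, ← Finset.sum_add_distrib]
  refine Finset.sum_congr rfl fun x _ => ?_
  rw [add_comm]
  convert (Finset.card_erase_add_one (self_mem_orbitFinset H x)).symm

theorem orbitPairs_le (H : Subgroup (Perm α)) :
    orbitPairs H ≤ Fintype.card α * (Fintype.card α - 1) := by
  classical
  rw [orbitPairs, ← Finset.card_univ, ← smul_eq_mul, ← Finset.sum_const]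
  refine Finset.sum_le_sum fun x _ => ?_
  rw [Finset.card_erase_of_mem (self_mem_orbitFinset H x)]
  exact Nat.sub_le_sub_right (Finset.card_le_univ _) 1

theorem eq_bot_of_orbitPairs_eq_zero {H : Subgroup (Perm α)} (h : orbitPairs H = 0) : H = ⊥ := by
  classical
  rw [Subgroup.eq_bot_iff_forall]
  intro g hg
  ext x
  have h1 := Finset.sum_eq_zero_iff.1 h x (Finset.mem_univ x)
  by_contra hne
  have : g x ∈ (orbitFinset H x).erase x :=
    Finset.mem_erase.2 ⟨hne, mem_orbitFinset.2 ⟨g, hg, rfl⟩⟩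
  exact (Finset.card_pos.2 ⟨_, this⟩).ne' h1

/-- Jensen's inequality for the logarithm, with equal weights. -/
theorem sum_log_le_card_mul_log {ι : Type*} (s : Finset ι) (hs : s.Nonempty) (y : ι → ℝ)
    (hy : ∀ i ∈ s, 0 < y i) :
    ∑ i ∈ s, Real.log (y i) ≤ s.card * Real.log ((∑ i ∈ s, y i) / s.card) := by
  have hc : (0 : ℝ) < s.card := by exact_mod_cast hs.card_pos
  have h := strictConcaveOn_log_Ioi.concaveOn.le_map_sum (t := s) (w := fun _ => (s.card : ℝ)⁻¹)
    (p := y) (fun _ _ => by positivity) (by simp [hc.ne']) hy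
  simp only [smul_eq_mul, ← Finset.mul_sum] at h
  rw [inv_mul_le_iff₀ hc] at h
  rwa [div_eq_inv_mul]

open Classical in
theorem log_card_le_of_separated {ι : Type*} [Fintype ι] [Nonempty ι] [Nonempty α]
    {G : Subgroup (Perm α)} (S : ι → Finset α) {k : ℕ} {θ : ℝ} (hθ : θ ≤ 1)
    (hS : ∀ s, Fintype.card α * (Finset.univ.filter fun i => s ∈ S i).card ≤ k * Fintype.card ι)
    (hsep : ∀ x y, x ≠ y → θ * Fintype.card ι ≤
      (Finset.univ.filter fun i => y ∉ orbitFinset (pointwiseStabilizer G (S i)) x).card)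
    (J : ℕ) (H : Subgroup (Perm α)) (hH : H ≤ G) :
    Real.log (Nat.card H) ≤
      k * ∑ j ∈ Finset.range J, Real.log (1 + (1 - θ) ^ j * (orbitPairs H / Fintype.card α)) +
        Real.log (Nat.card G) * ((1 - θ) ^ J * orbitPairs H) := by
  have hq : 0 ≤ 1 - θ := by linarith
  have hn : (0 : ℝ) < Fintype.card α := by exact_mod_cast Fintype.card_pos
  have hι : (0 : ℝ) < Fintype.card ι := by exact_mod_cast Fintype.card_pos
  have hlogG : 0 ≤ Real.log (Nat.card G) := Real.log_natCast_nonneg _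
  induction J generalizing H with
  | zero =>
    simp only [Finset.range_zero, Finset.sum_empty, mul_zero, pow_zero, one_mul, zero_add]
    rcases Nat.eq_zero_or_pos (orbitPairs H) with h | h
    · rw [eq_bot_of_orbitPairs_eq_zero h]
      simp only [Subgroup.card_bot, Nat.cast_one, Real.log_one]
      positivity
    · have h1 : Real.log (Nat.card H) ≤ Real.log (Nat.card G) := by
        apply Real.log_le_log (by exact_mod_cast Nat.card_pos)
        exact_mod_cast Subgroup.card_le_of_le hH
      refine h1.trans (le_mul_of_one_le_right hlogG ?_)
      exact_mod_cast h
  | succ J ih =>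
    let K : ι → Subgroup (Perm α) := fun i => pointwiseStabilizer H (S i)
    have hpairs : ∑ i, (orbitPairs (K i) : ℝ) ≤
        Fintype.card ι * ((1 - θ) * orbitPairs H) := by
      have h1 : ∀ x, ∑ i, ((((orbitFinset (K i) x).erase x).card : ℕ) : ℝ) ≤
          ((1 - θ) * Fintype.card ι) * ((orbitFinset H x).erase x).card := by
        intro x
        have h2 : ∀ i, (orbitFinset (K i) x).erase x =
            ((orbitFinset H x).erase x).filter fun y => y ∈ orbitFinset (K i) x := by
          intro i
          ext y
          simp only [Finset.mem_erase, Finset.mem_filter]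
          exact ⟨fun h => ⟨⟨h.1, orbitFinset_mono (pointwiseStabilizer_le _ _) _ h.2⟩, h.2⟩,
            fun h => ⟨h.1.1, h.2⟩⟩
        simp only [h2, Finset.card_filter]
        push_cast
        rw [Finset.sum_comm, mul_comm, ← nsmul_eq_mul, ← Finset.sum_const]
        refine Finset.sum_le_sum fun y hy => ?_
        have h3 := hsep x y (Finset.ne_of_mem_erase hy).symm
        have h4 : (Finset.univ.filter fun i => y ∉ orbitFinset (pointwiseStabilizer G (S i)) x) ⊆
            Finset.univ.filter fun i => y ∉ orbitFinset (K i) x := by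
          refine Finset.monotone_filter_right _ fun i _ h => mt (fun h' => ?_) h
          refine orbitFinset_mono (H := K i) (fun g hg => ?_) x h'
          exact ⟨hH (pointwiseStabilizer_le _ _ hg), hg.2⟩
        have h5 := h3.trans (Nat.cast_le.2 (Finset.card_le_card h4))
        have h6 := Finset.card_filter_add_card_filter_not (s := (Finset.univ : Finset ι))
          (fun i => y ∈ orbitFinset (K i) x)
        rw [Finset.sum_boole]
        rw [Finset.card_univ] at h6
        have h7 : (((Finset.univ.filter fun i => y ∈ orbitFinset (K i) x).card : ℕ) : ℝ) +
          ((Finset.univ.filter fun i => y ∉ orbitFinset (K i) x).card : ℕ) = Fintype.card ι := by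
          exact_mod_cast h6
        linarith
      simp only [orbitPairs, Nat.cast_sum]
      rw [Finset.sum_comm, mul_left_comm, ← mul_assoc, Finset.mul_sum]
      exact Finset.sum_le_sum fun x _ => h1 x
    have hlog : ∀ i, Real.log (Nat.card H) ≤ Real.log (Nat.card (K i)) +
        ∑ s ∈ S i, Real.log (orbitFinset H s).card := by
      intro i
      have hpos : ∀ s, (0 : ℝ) < (orbitFinset H s).card := fun s => by
        exact_mod_cast Finset.card_pos.2 ⟨s, self_mem_orbitFinset H s⟩
      rw [← Real.log_prod fun s _ => (hpos s).ne', ← Real.log_mul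
        (by exact_mod_cast Nat.card_pos.ne') (Finset.prod_pos fun s _ => hpos s).ne']
      apply Real.log_le_log (by exact_mod_cast Nat.card_pos)
      exact_mod_cast card_le_card_pointwiseStabilizer_mul H (S i)
    have horb : ∑ i, ∑ s ∈ S i, Real.log (orbitFinset H s).card ≤
        Fintype.card ι * (k * Real.log (1 + orbitPairs H / Fintype.card α)) := by
      have h1 : ∑ i, ∑ s ∈ S i, Real.log (orbitFinset H s).card =
          ∑ s, ((Finset.univ.filter fun i => s ∈ S i).card : ℝ) *
            Real.log (orbitFinset H s).card := by
        simp only [Finset.card_filter, Nat.cast_sum, Finset.sum_mul]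
        rw [Finset.sum_comm]
        refine Finset.sum_congr rfl fun i _ => ?_
        simp
      have h2 : ∀ s, ((Finset.univ.filter fun i => s ∈ S i).card : ℝ) *
          Real.log (orbitFinset H s).card ≤
            (k * Fintype.card ι / Fintype.card α) * Real.log (orbitFinset H s).card := by
        intro s
        refine mul_le_mul_of_nonneg_right ?_ (Real.log_natCast_nonneg _)
        rw [le_div_iff₀ hn, mul_comm]
        exact_mod_cast hS s
      have h3 := sum_log_le_card_mul_log (Finset.univ : Finset α) Finset.univ_nonempty
        (fun s => ((orbitFinset H s).card : ℝ)) fun s _ => by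
          exact_mod_cast Finset.card_pos.2 ⟨s, self_mem_orbitFinset H s⟩
      rw [← Nat.cast_sum, sum_card_orbitFinset, Finset.card_univ, Nat.cast_add, add_div,
        div_self hn.ne'] at h3
      rw [h1]
      refine (Finset.sum_le_sum fun s _ => h2 s).trans ?_
      rw [← Finset.mul_sum]
      refine (mul_le_mul_of_nonneg_left h3 (by positivity)).trans_eq ?_
      field_simp
    have hjen : ∀ j, ∑ i, Real.log (1 + (1 - θ) ^ j * (orbitPairs (K i) / Fintype.card α)) ≤
        Fintype.card ι * Real.log (1 + (1 - θ) ^ (j + 1) * (orbitPairs H / Fintype.card α)) := by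
      intro j
      refine (sum_log_le_card_mul_log Finset.univ Finset.univ_nonempty _
        fun i _ => by positivity).trans ?_
      rw [Finset.card_univ]
      refine mul_le_mul_of_nonneg_left (Real.log_le_log (by positivity) ?_) hι.le
      rw [Finset.sum_add_distrib, Finset.sum_const, Finset.card_univ, nsmul_one,
        ← Finset.mul_sum, ← Finset.sum_div, add_div, div_self hι.ne', add_le_add_iff_left,
        div_le_iff₀ hι, pow_succ, mul_assoc, mul_assoc]
      refine mul_le_mul_of_nonneg_left ?_ (by positivity)
      rw [div_le_iff₀ hn]
      refine hpairs.trans_eq ?_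
      field_simp
    have hsum : Fintype.card ι * Real.log (Nat.card H) ≤
        Fintype.card ι * (k * Real.log (1 + orbitPairs H / Fintype.card α) +
          (k * ∑ j ∈ Finset.range J,
            Real.log (1 + (1 - θ) ^ (j + 1) * (orbitPairs H / Fintype.card α)) +
          Real.log (Nat.card G) * ((1 - θ) ^ (J + 1) * orbitPairs H))) := by
      calc Fintype.card ι * Real.log (Nat.card H) = ∑ i : ι, Real.log (Nat.card H) := by
            rw [Finset.sum_const, Finset.card_univ, nsmul_eq_mul]
        _ ≤ ∑ i, ((∑ s ∈ S i, Real.log (orbitFinset H s).card) +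
            (k * ∑ j ∈ Finset.range J,
              Real.log (1 + (1 - θ) ^ j * (orbitPairs (K i) / Fintype.card α)) +
            Real.log (Nat.card G) * ((1 - θ) ^ J * orbitPairs (K i)))) := by
            refine Finset.sum_le_sum fun i _ => (hlog i).trans ?_
            rw [add_comm]
            exact add_le_add_right (ih (K i) ((pointwiseStabilizer_le _ _).trans hH)) _
        _ ≤ _ := by
            rw [Finset.sum_add_distrib, Finset.sum_add_distrib, mul_add, mul_add]
            refine add_le_add horb (add_le_add ?_ ?_)
            · rw [← Finset.mul_sum, Finset.sum_comm, mul_left_comm, Finset.mul_sum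
                (a := (Fintype.card ι : ℝ))]
              exact mul_le_mul_of_nonneg_left (Finset.sum_le_sum fun j _ => hjen j) (by positivity)
            · rw [← Finset.mul_sum, ← Finset.mul_sum, mul_left_comm (Fintype.card ι : ℝ), pow_succ,
                mul_assoc ((1 - θ) ^ J), mul_left_comm (Fintype.card ι : ℝ)]
              refine mul_le_mul_of_nonneg_left (mul_le_mul_of_nonneg_left ?_ ?_) hlogG
              · exact hpairs
              · positivity
    refine (le_of_mul_le_mul_left hsum hι).trans_eq ?_
    rw [Finset.sum_range_succ']
    simp only [pow_zero, one_mul]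
    ring

end Separation

section InvariantGraph

variable {α : Type*} {G : Subgroup (Perm α)} {Γ : SimpleGraph α}

theorem SimpleGraph.Connected.exists_geodesic (hΓ : Γ.Connected) (x z : α) :
    ∃ f : ℕ → α, f 0 = x ∧ f (Γ.dist x z) = z ∧
      ∀ i j, i ≤ j → j ≤ Γ.dist x z → Γ.dist (f i) (f j) = j - i := by
  obtain ⟨p, hp⟩ := hΓ.exists_walk_length_eq_dist x z
  have hle : ∀ i j, i ≤ j → j ≤ p.length → Γ.dist (p.getVert i) (p.getVert j) ≤ j - i := by
    intro i j hij
    induction j, hij using Nat.le_induction with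
    | base => simp
    | succ j hij ih =>
      intro hj
      have h1 := hΓ.dist_triangle (u := p.getVert i) (v := p.getVert j) (w := p.getVert (j + 1))
      have h2 := SimpleGraph.dist_eq_one_iff_adj.2 (p.adj_getVert_succ (i := j) hj)
      have h3 := ih (by omega)
      omega
  refine ⟨p.getVert, p.getVert_zero, by rw [← hp, p.getVert_length], fun i j hij hj => ?_⟩
  rw [← hp] at hj
  refine le_antisymm (hle i j hij hj) ?_
  have h1 := hΓ.dist_triangle (u := x) (v := p.getVert i) (w := z)
  have h2 := hΓ.dist_triangle (u := p.getVert i) (v := p.getVert j) (w := z)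
  have h3 := hle 0 i (by omega) (by omega)
  have h4 := hle j p.length hj le_rfl
  rw [p.getVert_zero] at h3
  rw [p.getVert_length] at h4
  omega

variable (hinv : ∀ g ∈ G, ∀ x y, Γ.Adj x y → Γ.Adj (g x) (g y))

include hinv

theorem exists_walk_image {g : Perm α} (hg : g ∈ G) {x y : α} (p : Γ.Walk x y) :
    ∃ q : Γ.Walk (g x) (g y), q.length = p.length :=
  ⟨p.map ⟨g, fun {a b} h => hinv g hg a b h⟩, SimpleGraph.Walk.length_map _ _⟩

theorem dist_image_eq (hΓ : Γ.Connected) {g : Perm α} (hg : g ∈ G) (x y : α) :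
    Γ.dist (g x) (g y) = Γ.dist x y := by
  have key : ∀ g ∈ G, ∀ x y, Γ.dist (g x) (g y) ≤ Γ.dist x y := by
    intro g hg x y
    obtain ⟨p, hp⟩ := hΓ.exists_walk_length_eq_dist x y
    obtain ⟨q, hq⟩ := exists_walk_image hinv hg p
    rw [← hp, ← hq]
    exact SimpleGraph.dist_le q
  refine le_antisymm (key g hg x y) ?_
  simpa using key g⁻¹ (G.inv_mem hg) (g x) (g y)

theorem connected_of_isPreprimitive (hG : IsPreprimitive G α) {a b : α} (hab : Γ.Adj a b) :
    Γ.Connected := by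
  have hreach : ∀ g ∈ G, ∀ x y, Γ.Reachable x y → Γ.Reachable (g x) (g y) := by
    rintro g hg x y ⟨p⟩
    exact ⟨(exists_walk_image hinv hg p).choose⟩
  have hmem : ∀ (g : G) (z : α), z ∈ g • {y | Γ.Reachable a y} ↔ Γ.Reachable (g.1 a) z := by
    intro g z
    rw [Set.mem_smul_set_iff_inv_smul_mem]
    constructor
    · intro h
      have := hreach g.1 g.2 _ _ h
      rwa [show g.1 (g⁻¹ • z) = z from perm_apply_inv_self g.1 z] at this
    · intro h
      have := hreach _ (G.inv_mem g.2) _ _ h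
      rwa [show g.1⁻¹ (g.1 a) = a from g.1.symm_apply_apply a] at this
  have hB : IsBlock G {y | Γ.Reachable a y} := by
    intro g₁ g₂ hne
    rw [Set.disjoint_left]
    intro z h1 h2
    rw [hmem] at h1 h2
    refine hne (Set.ext fun w => ?_)
    rw [hmem, hmem]
    exact ⟨fun h => (h2.trans h1.symm).trans h, fun h => (h1.trans h2.symm).trans h⟩
  have hne : Nonempty α := ⟨a⟩
  rcases hG.isTrivialBlock_of_isBlock hB with h | h
  · exact absurd (h (show Γ.Reachable a a from .refl a) (show Γ.Reachable a b from hab.reachable))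
      hab.ne
  · have hall : ∀ y, Γ.Reachable a y := fun y => by
      have : y ∈ {y | Γ.Reachable a y} := h ▸ Set.mem_univ y
      exact this
    exact ⟨fun x y => (hall x).symm.trans (hall y)⟩

end InvariantGraph

section Uniprimitive

variable {α : Type*} [Fintype α] {G : Subgroup (Perm α)}

theorem mem_orbitFinset_singleton {γ x y : α} :
    y ∈ orbitFinset (pointwiseStabilizer G {γ}) x ↔ ∃ g ∈ G, g γ = γ ∧ g x = y := by
  simp [mem_orbitFinset, mem_pointwiseStabilizer, and_assoc]

open Classical in
/-- The points whose stabilizer has `x` and `y` in distinct orbits. -/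
noncomputable def separators (G : Subgroup (Perm α)) (x y : α) : Finset α :=
  Finset.univ.filter fun γ => y ∉ orbitFinset (pointwiseStabilizer G {γ}) x

theorem mem_separators {x y γ : α} :
    γ ∈ separators G x y ↔ y ∉ orbitFinset (pointwiseStabilizer G {γ}) x := by
  classical simp [separators]

theorem separators_self (x : α) : separators G x x = ∅ := by
  ext γ
  simp [mem_separators, self_mem_orbitFinset]

theorem separators_comm (x y : α) : separators G x y = separators G y x := by
  ext γ
  rw [mem_separators, mem_separators]
  exact not_congr ⟨mem_orbitFinset_symm, mem_orbitFinset_symm⟩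

theorem card_separators_triangle (x y z : α) :
    (separators G x z).card ≤ (separators G x y).card + (separators G y z).card := by
  classical
  refine (Finset.card_le_card fun γ h => ?_).trans (Finset.card_union_le _ _)
  rw [Finset.mem_union, mem_separators, mem_separators]
  rw [mem_separators] at h
  by_contra! hcon
  exact h (orbitFinset_eq_of_mem hcon.1 ▸ hcon.2)

theorem map_mem_orbitFinset_iff {g : Perm α} (hg : g ∈ G) (S : Finset α) (x y : α) :
    g y ∈ orbitFinset (pointwiseStabilizer G (S.map g.toEmbedding)) (g x) ↔
      y ∈ orbitFinset (pointwiseStabilizer G S) x := by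
  simp only [mem_orbitFinset, mem_pointwiseStabilizer, Finset.forall_mem_map,
    Equiv.coe_toEmbedding]
  constructor
  · rintro ⟨h, ⟨hh, h1⟩, h2⟩
    exact ⟨g⁻¹ * h * g, ⟨G.mul_mem (G.mul_mem (G.inv_mem hg) hh) hg,
      fun s hs => by simp [Perm.mul_apply, h1 s hs]⟩, by simp [Perm.mul_apply, h2]⟩
  · rintro ⟨h, ⟨hh, h1⟩, h2⟩
    exact ⟨g * h * g⁻¹, ⟨G.mul_mem (G.mul_mem hg hh) (G.inv_mem hg),
      fun s hs => by simp [Perm.mul_apply, h1 s hs]⟩, by simp [Perm.mul_apply, h2]⟩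

theorem image_mem_orbitFinset_iff {g : Perm α} (hg : g ∈ G) (γ x y : α) :
    g y ∈ orbitFinset (pointwiseStabilizer G {g γ}) (g x) ↔
      y ∈ orbitFinset (pointwiseStabilizer G {γ}) x := by
  simpa using map_mem_orbitFinset_iff hg {γ} x y

theorem card_separators_image {g : Perm α} (hg : g ∈ G) (x y : α) :
    (separators G (g x) (g y)).card = (separators G x y).card := by
  refine (Finset.card_equiv g fun γ => ?_).symm
  rw [mem_separators, mem_separators, image_mem_orbitFinset_iff hg]

variable {Γ : SimpleGraph α} {d : ℕ}

theorem dist_lt_of_card_separators (hΓ : Γ.Connected)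
    (hinv : ∀ g ∈ G, ∀ x y, Γ.Adj x y → Γ.Adj (g x) (g y))
    (hadj : ∀ x y, Γ.Adj x y → (separators G x y).card = d) {x z : α} (hxz : x ≠ z) :
    Γ.dist x z < d := by
  classical
  obtain ⟨f, -, hfz, hf⟩ := hΓ.exists_geodesic x z
  have ht := hΓ.pos_dist_of_ne hxz
  set t := Γ.dist x z with htdef
  have hlast : Γ.Adj (f (t - 1)) (f t) := by
    rw [← SimpleGraph.dist_eq_one_iff_adj, hf _ _ (by omega) le_rfl]
    omega
  rw [← hadj _ _ hlast, Nat.lt_iff_add_one_le, ← Finset.card_range (t + 1)]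
  refine Finset.card_le_card_of_injOn f (fun i hi => ?_) fun i hi j hj hij => ?_
  · have hi' : i ≤ t := by
      simp only [Finset.coe_range, Set.mem_Iio] at hi
      omega
    rw [Finset.mem_coe, mem_separators, mem_orbitFinset_singleton]
    rintro ⟨g, hg, h1, h2⟩
    have h3 := dist_image_eq hinv hΓ hg (f i) (f (t - 1))
    rw [h1, h2, hf i t hi' le_rfl] at h3
    rcases Nat.lt_or_ge i t with h | h
    · rw [hf i (t - 1) (by omega) (by omega)] at h3
      omega
    · obtain rfl : i = t := by omega
      rw [SimpleGraph.dist_comm, hf _ _ (by omega) le_rfl] at h3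
      omega
  · simp only [Finset.coe_range, Set.mem_Iio] at hi hj
    wlog h : i ≤ j generalizing i j
    · exact (this j i hij.symm hj hi (by omega)).symm
    have := hf i j h (by omega)
    rw [hij, SimpleGraph.dist_self] at this
    omega

theorem card_separators_le_mul_dist (hΓ : Γ.Connected)
    (hadj : ∀ x y, Γ.Adj x y → (separators G x y).card = d) (x z : α) :
    (separators G x z).card ≤ d * Γ.dist x z := by
  obtain ⟨f, hfx, hfz, hf⟩ := hΓ.exists_geodesic x z
  have key : ∀ i ≤ Γ.dist x z, (separators G (f 0) (f i)).card ≤ d * i := by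
    intro i
    induction i with
    | zero => simp [separators_self]
    | succ i ih =>
      intro hi
      have h1 := hadj (f i) (f (i + 1)) (by
        rw [← SimpleGraph.dist_eq_one_iff_adj, hf _ _ (by omega) hi]
        omega)
      have h2 := card_separators_triangle (G := G) (f 0) (f i) (f (i + 1))
      have h3 := ih (by omega)
      rw [Nat.mul_succ]
      omega
  have := key _ le_rfl
  rwa [hfx, hfz] at this

theorem sum_card_separators :
    ∑ x, ∑ y, (separators G x y).card =
      ∑ γ, ∑ x, (Fintype.card α - (orbitFinset (pointwiseStabilizer G {γ}) x).card) := by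
  classical
  simp only [separators, Finset.card_filter]
  have h : ∀ γ x : α, Fintype.card α - (orbitFinset (pointwiseStabilizer G {γ}) x).card =
      ∑ y, if y ∉ orbitFinset (pointwiseStabilizer G {γ}) x then 1 else 0 := by
    intro γ x
    rw [← Finset.card_compl, ← Finset.card_filter]
    congr 1
    ext y
    simp
  simp only [h]
  calc _ = ∑ x, ∑ γ, ∑ y, if y ∉ orbitFinset (pointwiseStabilizer G {γ}) x then 1 else 0 :=
        Finset.sum_congr rfl fun x _ => Finset.sum_comm
    _ = _ := Finset.sum_comm

/-- The closed neighbourhoods of every third vertex of a geodesic fit in a ball. -/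
theorem mul_le_card_ball [DecidableRel Γ.Adj] (hΓ : Γ.Connected) {ν : ℕ}
    (hν : ∀ x, Γ.degree x = ν) (x z : α) (B : Finset α)
    (hB : ∀ y, Γ.dist x y < Γ.dist x z → y ∈ B) :
    (Γ.dist x z + 1) / 3 * (ν + 1) ≤ B.card := by
  classical
  obtain ⟨f, hfx, -, hf⟩ := hΓ.exists_geodesic x z
  set t := Γ.dist x z with ht
  let N : ℕ → Finset α := fun j => insert (f (3 * j)) (Γ.neighborFinset (f (3 * j)))
  have hN : ∀ j y, y ∈ N j → Γ.dist (f (3 * j)) y ≤ 1 := by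
    intro j y hy
    rcases Finset.mem_insert.1 hy with rfl | h
    · simp
    · rw [SimpleGraph.mem_neighborFinset] at h
      exact (SimpleGraph.dist_eq_one_iff_adj.2 h).le
  have hcard : ∀ j, (N j).card = ν + 1 := by
    intro j
    rw [Finset.card_insert_of_notMem (by simp), SimpleGraph.card_neighborFinset_eq_degree, hν]
  have hdisj : ((Finset.range ((t + 1) / 3) : Finset ℕ) : Set ℕ).PairwiseDisjoint N := by
    intro i hi j hj hij
    simp only [Finset.coe_range, Set.mem_Iio] at hi hj
    wlog h : i < j generalizing i j
    · exact (this hij.symm hj hi (by omega)).symm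
    rw [Function.onFun, Finset.disjoint_left]
    intro y hy1 hy2
    have h1 := hN _ _ hy1
    have h2 := hN _ _ hy2
    have h3 := hf (3 * i) (3 * j) (by omega) (by omega)
    have h4 := hΓ.dist_triangle (u := f (3 * i)) (v := y) (w := f (3 * j))
    rw [SimpleGraph.dist_comm (u := y)] at h4
    omega
  have hsub : (Finset.range ((t + 1) / 3)).biUnion N ⊆ B := by
    intro y hy
    obtain ⟨j, hj, hy⟩ := Finset.mem_biUnion.1 hy
    rw [Finset.mem_range] at hj
    refine hB y ?_
    have h1 := hN _ _ hy
    have h3 := hf 0 (3 * j) (by omega) (by omega)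
    have h4 := hΓ.dist_triangle (u := f 0) (v := f (3 * j)) (w := y)
    rw [hfx] at h4 h3
    omega
  refine le_trans (Eq.le ?_) (Finset.card_le_card hsub)
  rw [Finset.card_biUnion hdisj, Finset.sum_congr rfl fun j _ => hcard j, Finset.sum_const,
    Finset.card_range, smul_eq_mul]

end Uniprimitive

section LargeOrbit

variable {α : Type*} [Fintype α] {G H : Subgroup (Perm α)}

open Classical in
/-- The points whose orbit contains more than half of all points. -/
noncomputable def largeOrbit (H : Subgroup (Perm α)) : Finset α :=
  Finset.univ.filter fun y => Fintype.card α < 2 * (orbitFinset H y).card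

theorem mem_largeOrbit {y : α} :
    y ∈ largeOrbit H ↔ Fintype.card α < 2 * (orbitFinset H y).card := by
  classical simp [largeOrbit]

theorem largeOrbit_eq {y : α} (hy : y ∈ largeOrbit H) : largeOrbit H = orbitFinset H y := by
  classical
  ext z
  constructor
  · intro hz
    rw [mem_largeOrbit] at hy hz
    obtain ⟨w, hw⟩ : (orbitFinset H y ∩ orbitFinset H z).Nonempty := by
      rw [← Finset.card_pos]
      have h1 := Finset.card_union_add_card_inter (orbitFinset H y) (orbitFinset H z)
      have h2 := Finset.card_le_univ (orbitFinset H y ∪ orbitFinset H z)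
      omega
    rw [Finset.mem_inter] at hw
    rw [← orbitFinset_eq_of_mem hw.1, orbitFinset_eq_of_mem hw.2]
    exact self_mem_orbitFinset H z
  · intro hz
    rw [mem_largeOrbit] at hy ⊢
    rwa [orbitFinset_eq_of_mem hz]

theorem mem_largeOrbit_iff_of_mem {y z : α} (h : z ∈ orbitFinset H y) :
    z ∈ largeOrbit H ↔ y ∈ largeOrbit H := by
  rw [mem_largeOrbit, mem_largeOrbit, orbitFinset_eq_of_mem h]

theorem card_largeOrbit_lt {y : α} (hy : y ∈ largeOrbit H) :
    Fintype.card α < 2 * (largeOrbit H).card := by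
  rw [largeOrbit_eq hy]
  exact mem_largeOrbit.1 hy

theorem largeOrbit_mono {K : Subgroup (Perm α)} (h : H ≤ K) : largeOrbit H ⊆ largeOrbit K :=
  fun y hy => by
    rw [mem_largeOrbit] at hy ⊢
    have := Finset.card_le_card (orbitFinset_mono h y)
    omega

theorem map_mem_largeOrbit_iff {g : Perm α} (hg : g ∈ G) (S : Finset α) (y : α) :
    g y ∈ largeOrbit (pointwiseStabilizer G (S.map g.toEmbedding)) ↔
      y ∈ largeOrbit (pointwiseStabilizer G S) := by
  rw [mem_largeOrbit, mem_largeOrbit]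
  refine iff_of_eq ?_
  congr 2
  refine (Finset.card_equiv g fun z => ?_).symm
  rw [map_mem_orbitFinset_iff hg]

local notation "Λ" x => largeOrbit (pointwiseStabilizer G {x})

theorem image_mem_largeOrbit_iff {g : Perm α} (hg : g ∈ G) (x y : α) :
    (g y ∈ Λ (g x)) ↔ y ∈ Λ x := by
  simpa using map_mem_largeOrbit_iff hg {x} y

theorem card_largeOrbit_image {g : Perm α} (hg : g ∈ G) (x : α) :
    (Λ (g x)).card = (Λ x).card := by
  refine (Finset.card_equiv g fun y => ?_).symm
  rw [image_mem_largeOrbit_iff hg]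

theorem mem_largeOrbit_symm {x y : α} (hx : x ∈ largeOrbit G) (h : y ∈ Λ x) : x ∈ Λ y := by
  classical
  have hlt := card_largeOrbit_lt h
  set Δ := largeOrbit G with hΔ
  have htrans : ∀ a ∈ Δ, ∃ g ∈ G, g x = a := fun a ha => by
    rwa [hΔ, largeOrbit_eq hx, mem_orbitFinset] at ha
  have hcard : ∀ a ∈ Δ, (Λ a).card = (Λ x).card := by
    intro a ha
    obtain ⟨g, hg, rfl⟩ := htrans a ha
    exact card_largeOrbit_image hg x
  have hsum : ∑ b ∈ Δ, (Λ x).card ≤ ∑ b ∈ Δ, (Δ.filter fun a => b ∈ Λ a).card := by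
    have h1 : ∑ a ∈ Δ, (Λ a).card = ∑ b ∈ Δ, (Δ.filter fun a => b ∈ Λ a).card := by
      have h2 : ∀ a : α, (Λ a).card = ∑ b ∈ Δ, if b ∈ Λ a then 1 else 0 := fun a => by
        rw [← Finset.card_filter, Finset.filter_mem_eq_inter, Finset.inter_eq_right.2]
        exact largeOrbit_mono (pointwiseStabilizer_le _ _)
      simp only [h2, Finset.card_filter]
      exact Finset.sum_comm
    rw [← h1]
    exact (Finset.sum_congr rfl fun b hb => (hcard b hb).symm).le
  obtain ⟨b, hbΔ, hb⟩ := Finset.exists_le_of_sum_le ⟨x, hx⟩ hsum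
  obtain ⟨c, hc⟩ : ((Λ b) ∩ Δ.filter fun a => b ∈ Λ a).Nonempty := by
    rw [← Finset.card_pos]
    have h1 := Finset.card_union_add_card_inter (Λ b) (Δ.filter fun a => b ∈ Λ a)
    have h2 := Finset.card_le_univ ((Λ b) ∪ Δ.filter fun a => b ∈ Λ a)
    have h3 := hcard b hbΔ
    omega
  rw [Finset.mem_inter, Finset.mem_filter] at hc
  obtain ⟨g, hg, rfl⟩ := htrans b hbΔ
  have h4 := (image_mem_largeOrbit_iff (G := G) hg x y).2 h
  have h5 := hc.1
  rw [largeOrbit_eq h4, mem_orbitFinset_singleton] at h5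
  obtain ⟨k, hk, h6, rfl⟩ := h5
  have h7 := hc.2.2
  rw [← h6, image_mem_largeOrbit_iff hk, image_mem_largeOrbit_iff hg] at h7
  exact h7

end LargeOrbit

section Uniprimitive

variable {α : Type*} [Fintype α] {G : Subgroup (Perm α)}

local notation "Λ" x => largeOrbit (pointwiseStabilizer G {x})

theorem not_self_mem_largeOrbit (hn : 2 ≤ Fintype.card α) (x : α) : x ∉ Λ x := by
  have : orbitFinset (pointwiseStabilizer G {x}) x = {x} := by
    ext y
    rw [mem_orbitFinset_singleton, Finset.mem_singleton]
    constructor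
    · rintro ⟨g, -, h1, h2⟩
      rw [← h2, h1]
    · rintro rfl
      exact ⟨1, G.one_mem, rfl, rfl⟩
  rw [mem_largeOrbit, this, Finset.card_singleton]
  omega

variable (hT : ∀ x y : α, ∃ g ∈ G, g x = y)
include hT

theorem exists_image_pair_of_mem_largeOrbit {x y x' y' : α} (h : y ∈ Λ x) (h' : y' ∈ Λ x') :
    ∃ g ∈ G, g x = x' ∧ g y = y' := by
  obtain ⟨g, hg, rfl⟩ := hT x x'
  have h1 := (image_mem_largeOrbit_iff hg x y).2 h
  rw [largeOrbit_eq h1, mem_orbitFinset_singleton] at h'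
  obtain ⟨k, hk, h2, h3⟩ := h'
  exact ⟨k * g, G.mul_mem hk hg, by simpa using h2, by simpa using h3⟩

theorem card_largeOrbit_eq (x y : α) : (Λ x).card = (Λ y).card := by
  obtain ⟨g, hg, rfl⟩ := hT x y
  rw [card_largeOrbit_image hg]

theorem mem_largeOrbit_of_transitive (x : α) : x ∈ largeOrbit G := by
  have h : orbitFinset G x = Finset.univ := by
    ext y
    simpa [mem_orbitFinset] using hT x y
  rw [mem_largeOrbit, h, Finset.card_univ]
  have := Fintype.card_pos_iff.2 ⟨x⟩
  omega

theorem card_separators_eq_of_mem_largeOrbit {x y x' y' : α} (h : y ∈ Λ x) (h' : y' ∈ Λ x') :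
    (separators G x y).card = (separators G x' y').card := by
  obtain ⟨g, hg, rfl, rfl⟩ := exists_image_pair_of_mem_largeOrbit hT h h'
  rw [card_separators_image hg]

theorem card_separators_le_two_mul {a b x y : α} (h : b ∈ Λ a) :
    (separators G x y).card ≤ 2 * (separators G a b).card := by
  classical
  have hlt := card_largeOrbit_lt h
  obtain ⟨z, hz⟩ : ((Λ x) ∩ Λ y).Nonempty := by
    rw [← Finset.card_pos]
    have h1 := Finset.card_union_add_card_inter (Λ x) (Λ y)
    have h2 := Finset.card_le_univ ((Λ x) ∪ Λ y)
    have h3 := card_largeOrbit_eq hT x a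
    have h4 := card_largeOrbit_eq hT y a
    omega
  rw [Finset.mem_inter] at hz
  have h1 := card_separators_triangle (G := G) x z y
  rw [card_separators_eq_of_mem_largeOrbit hT hz.1 h,
    card_separators_eq_of_mem_largeOrbit hT (mem_largeOrbit_symm (mem_largeOrbit_of_transitive hT y) hz.2) h] at h1
  omega

theorem mul_card_le_card_separators_mul {a b : α} (hn : 2 ≤ Fintype.card α) (h : b ∈ Λ a) :
    2 * (Λ a).card * (Fintype.card α - (Λ a).card) ≤
      (separators G a b).card * ((Λ a).card + 2 * (Fintype.card α - 1 - (Λ a).card)) := by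
  classical
  set M := (Λ a).card with hM
  set D := (separators G a b).card with hD
  set n := Fintype.card α with hn'
  have hMn : M ≤ n := Finset.card_le_univ _
  have hcompl : ∀ x, ((Λ x)ᶜ).card = n - M := fun x => by
    rw [Finset.card_compl, card_largeOrbit_eq hT x a]
  have hlow : ∀ γ, 2 * M * (n - M) ≤
      ∑ x, (n - (orbitFinset (pointwiseStabilizer G {γ}) x).card) := by
    intro γ
    rw [← Finset.sum_add_sum_compl (Λ γ)]
    have h1 : (Λ γ).card • (n - M) ≤
        ∑ x ∈ Λ γ, (n - (orbitFinset (pointwiseStabilizer G {γ}) x).card) := by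
      refine Finset.card_nsmul_le_sum _ _ _ fun x hx => ?_
      rw [← largeOrbit_eq hx, card_largeOrbit_eq hT γ a]
    have h2 : ((Λ γ)ᶜ).card • M ≤
        ∑ x ∈ (Λ γ)ᶜ, (n - (orbitFinset (pointwiseStabilizer G {γ}) x).card) := by
      refine Finset.card_nsmul_le_sum _ _ _ fun x hx => ?_
      have h3 : orbitFinset (pointwiseStabilizer G {γ}) x ⊆ (Λ γ)ᶜ := by
        intro z hz
        rw [Finset.mem_compl] at hx ⊢
        rwa [mem_largeOrbit_iff_of_mem hz]
      have h4 := Finset.card_le_card h3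
      rw [hcompl] at h4
      omega
    rw [card_largeOrbit_eq hT γ a, ← hM, smul_eq_mul] at h1
    rw [hcompl, smul_eq_mul] at h2
    nlinarith
  have hup : ∀ x, ∑ y, (separators G x y).card ≤ M * D + (n - 1 - M) * (2 * D) := by
    intro x
    rw [← Finset.sum_add_sum_compl (Λ x)]
    refine Nat.add_le_add ?_ ?_
    · rw [Finset.sum_congr rfl fun y hy => card_separators_eq_of_mem_largeOrbit hT hy h,
        Finset.sum_const, card_largeOrbit_eq hT x a, smul_eq_mul]
    · rw [← Finset.insert_erase (Finset.mem_compl.2 (not_self_mem_largeOrbit hn x)),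
        Finset.sum_insert (Finset.notMem_erase _ _), separators_self, Finset.card_empty, zero_add]
      refine (Finset.sum_le_card_nsmul _ _ (2 * D) fun y _ =>
        card_separators_le_two_mul hT h).trans ?_
      rw [Finset.card_erase_of_mem (Finset.mem_compl.2 (not_self_mem_largeOrbit hn x)), hcompl,
        smul_eq_mul, Nat.sub_right_comm]
  have h1 := Finset.card_nsmul_le_sum (Finset.univ : Finset α) _ _ fun γ _ => hlow γ
  have h2 := Finset.sum_le_card_nsmul (Finset.univ : Finset α) _ _ fun x _ => hup x
  rw [sum_card_separators] at h2
  have h3 := h1.trans h2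
  rw [Finset.card_univ, smul_eq_mul, smul_eq_mul] at h3
  have h4 := Nat.le_of_mul_le_mul_left h3 (by omega)
  refine h4.trans (Eq.le ?_)
  ring

omit hT in
theorem exists_le_two_mul_card_separators (hn : 2 ≤ Fintype.card α)
    (h : ∀ x, (Λ x) = ∅) :
    ∃ x z, x ≠ z ∧ Fintype.card α ≤ 2 * (separators G x z).card := by
  classical
  set n := Fintype.card α with hn'
  by_contra! hcon
  have hup : ∀ x, ∑ y, 2 * (separators G x y).card ≤ (n - 1) * (n - 1) := by
    intro x
    rw [← Finset.insert_erase (Finset.mem_univ x), Finset.sum_insert (Finset.notMem_erase _ _),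
      separators_self, Finset.card_empty, mul_zero, zero_add]
    refine (Finset.sum_le_card_nsmul _ _ (n - 1) fun y hy => ?_).trans (Eq.le ?_)
    · have := hcon x y (Finset.ne_of_mem_erase hy).symm
      omega
    · rw [Finset.card_erase_of_mem (Finset.mem_univ x), Finset.card_univ, smul_eq_mul]
  have hlow : ∀ γ, n * n ≤
      ∑ x, 2 * (n - (orbitFinset (pointwiseStabilizer G {γ}) x).card) := by
    intro γ
    have h1 := Finset.card_nsmul_le_sum (Finset.univ : Finset α)
      (fun x => 2 * (n - (orbitFinset (pointwiseStabilizer G {γ}) x).card)) n fun x _ => by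
        have h2 : x ∉ Λ γ := by simp [h]
        rw [mem_largeOrbit] at h2
        omega
    rwa [Finset.card_univ, smul_eq_mul] at h1
  have h1 := Finset.card_nsmul_le_sum (Finset.univ : Finset α) _ _ fun γ _ => hlow γ
  have h2 := Finset.sum_le_card_nsmul (Finset.univ : Finset α) _ _ fun x _ => hup x
  simp only [← Finset.mul_sum] at h1 h2
  rw [sum_card_separators] at h2
  have h3 := h1.trans h2
  rw [Finset.card_univ, smul_eq_mul, smul_eq_mul] at h3
  have h4 := Nat.le_of_mul_le_mul_left h3 (by omega)
  obtain ⟨k, hk⟩ : ∃ k, n = k + 1 := ⟨n - 1, by omega⟩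
  rw [hk, Nat.add_sub_cancel] at h4
  nlinarith

end Uniprimitive

section Uniprimitive

variable {α : Type*} [Fintype α] {G : Subgroup (Perm α)}

local notation "Λ" x => largeOrbit (pointwiseStabilizer G {x})

variable (hT : ∀ x y : α, ∃ g ∈ G, g x = y) (hG : IsPreprimitive G α)
  (hn : 2 ≤ Fintype.card α)
  (h2 : ¬ ∀ a b c d : α, a ≠ b → c ≠ d → ∃ g ∈ G, g a = c ∧ g b = d)
include hT hG hn h2

omit hG in
theorem card_largeOrbit_lt_card_sub_one (a : α) :
    (Λ a).card < Fintype.card α - 1 := by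
  classical
  by_contra! hcon
  refine h2 fun x y x' y' hxy hxy' => ?_
  have hmem : ∀ x y : α, x ≠ y → y ∈ Λ x := by
    intro x y hxy
    have h1 : (Λ x) = Finset.univ.erase x := by
      refine Finset.eq_of_subset_of_card_le (fun z hz => ?_) ?_
      · refine Finset.mem_erase.2 ⟨?_, Finset.mem_univ z⟩
        rintro rfl
        exact not_self_mem_largeOrbit hn z hz
      · rw [Finset.card_erase_of_mem (Finset.mem_univ x), Finset.card_univ,
          card_largeOrbit_eq hT x a]
        exact hcon
    rw [h1]
    exact Finset.mem_erase.2 ⟨hxy.symm, Finset.mem_univ y⟩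
  exact exists_image_pair_of_mem_largeOrbit hT (hmem x y hxy) (hmem x' y' hxy')

theorem card_le_sq_add_one {a b : α} (h : b ∈ Λ a) :
    (Λ a).card ≤ (Fintype.card α - 1 - (Λ a).card) * (Fintype.card α - 1 - (Λ a).card - 1) := by
  classical
  set k := Fintype.card α - 1 - (Λ a).card with hk
  have hlt := card_largeOrbit_lt_card_sub_one hT hn h2 a
  let Γ : SimpleGraph α :=
    { Adj := fun x y => x ≠ y ∧ y ∉ Λ x
      symm := ⟨fun x y hxy => ⟨hxy.1.symm, fun hh => hxy.2 (mem_largeOrbit_symm (mem_largeOrbit_of_transitive hT _) hh)⟩⟩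
      loopless := ⟨fun x hx => hx.1 rfl⟩ }
  have hinv : ∀ g ∈ G, ∀ x y, Γ.Adj x y → Γ.Adj (g x) (g y) := fun g hg x y hxy =>
    ⟨g.injective.ne hxy.1, fun hh => hxy.2 ((image_mem_largeOrbit_iff hg x y).1 hh)⟩
  have hnb : ∀ x, (Finset.univ.filter (Γ.Adj x)).card = k := by
    intro x
    have h1 : Finset.univ.filter (Γ.Adj x) = ((Λ x)ᶜ).erase x := by
      ext y
      simp [Γ, eq_comm]
    rw [h1, Finset.card_erase_of_mem (Finset.mem_compl.2 (not_self_mem_largeOrbit hn x)),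
      Finset.card_compl, card_largeOrbit_eq hT x a]
    omega
  obtain ⟨c, hc⟩ : (Finset.univ.filter (Γ.Adj a)).Nonempty := by
    rw [← Finset.card_pos, hnb]
    omega
  have hΓ := connected_of_isPreprimitive hinv hG (Finset.mem_filter.1 hc).2
  have hab : a ≠ b := by
    rintro rfl
    exact not_self_mem_largeOrbit hn _ h
  have hdist : 2 ≤ Γ.dist a b := by
    have h3 := hΓ.pos_dist_of_ne hab
    have h4 : Γ.dist a b ≠ 1 := fun h5 => (SimpleGraph.dist_eq_one_iff_adj.1 h5).2 h
    omega
  obtain ⟨f, -, -, hf⟩ := hΓ.exists_geodesic a b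
  have h01 : Γ.Adj (f 0) (f 1) := by
    rw [← SimpleGraph.dist_eq_one_iff_adj, hf _ _ (by omega) (by omega)]
  have h12 : Γ.Adj (f 1) (f 2) := by
    rw [← SimpleGraph.dist_eq_one_iff_adj, hf _ _ (by omega) (by omega)]
  have h02 : f 2 ∈ Λ (f 0) := by
    have h3 := hf 0 2 (by omega) hdist
    by_contra hcon
    have h4 : Γ.Adj (f 0) (f 2) := by
      refine ⟨fun h5 => ?_, hcon⟩
      rw [h5, SimpleGraph.dist_self] at h3
      omega
    rw [← SimpleGraph.dist_eq_one_iff_adj] at h4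
    omega
  have hsub : (Λ a) ⊆ (Finset.univ.filter (Γ.Adj a)).biUnion
      fun w => (Finset.univ.filter (Γ.Adj w)).erase a := by
    intro z hz
    obtain ⟨g, hg, h3, h4⟩ := exists_image_pair_of_mem_largeOrbit hT h02 hz
    have h5 := hinv g hg _ _ h01
    have h6 := hinv g hg _ _ h12
    rw [h3] at h5
    rw [h4] at h6
    refine Finset.mem_biUnion.2 ⟨g (f 1), by simpa using h5, Finset.mem_erase.2 ⟨?_, by simpa using h6⟩⟩
    rintro rfl
    exact not_self_mem_largeOrbit hn _ hz
  refine (Finset.card_le_card hsub).trans (Finset.card_biUnion_le.trans ?_)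
  refine (Finset.sum_le_card_nsmul _ _ (k - 1) fun w hw => ?_).trans ?_
  · rw [Finset.card_erase_of_mem, hnb]
    simpa using (Finset.mem_filter.1 hw).2.symm
  · rw [hnb, smul_eq_mul]

omit hG h2 in
theorem two_mul_card_largeOrbit_le {Γ : SimpleGraph α} [DecidableRel Γ.Adj] (hΓ : Γ.Connected)
    (hinv : ∀ g ∈ G, ∀ x y, Γ.Adj x y → Γ.Adj (g x) (g y)) {d ν : ℕ}
    (hν : ∀ x, Γ.degree x = ν) (hadj : ∀ x y, Γ.Adj x y → (separators G x y).card = d)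
    {a b : α} (h : b ∈ Λ a) (ht : 2 ≤ Γ.dist a b) : 2 * (Λ a).card ≤ ν * (d - 2) := by
  classical
  have hdist : ∀ x y, y ∈ (Λ x) → Γ.dist x y = Γ.dist a b := by
    intro x y hxy
    obtain ⟨g, hg, rfl, rfl⟩ := exists_image_pair_of_mem_largeOrbit hT h hxy
    exact dist_image_eq hinv hΓ hg a b
  have hsub : (Λ a) ⊆ (Γ.neighborFinset a).biUnion fun w => (Λ a) \ (Λ w) := by
    intro z hz
    have hz' := hdist a z hz
    obtain ⟨f, hf0, hft, hf⟩ := hΓ.exists_geodesic a z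
    have h1 := hf 0 1 (by omega) (by omega)
    have h3 := hf 1 _ (by omega) le_rfl
    rw [hf0] at h1
    rw [hft] at h3
    refine Finset.mem_biUnion.2 ⟨f 1, ?_, Finset.mem_sdiff.2 ⟨hz, fun h4 => ?_⟩⟩
    · rw [SimpleGraph.mem_neighborFinset, ← SimpleGraph.dist_eq_one_iff_adj, h1]
    · have := hdist _ _ h4
      omega
  have hw : ∀ w ∈ Γ.neighborFinset a, 2 * ((Λ a) \ (Λ w)).card ≤ d - 2 := by
    intro w hw
    rw [SimpleGraph.mem_neighborFinset] at hw
    have hdw := SimpleGraph.dist_eq_one_iff_adj.2 hw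
    have hself : ∀ x y : α, x ≠ y → y ∉ orbitFinset (pointwiseStabilizer G {x}) x := by
      intro x y hxy hmem
      obtain ⟨g, -, h3, h4⟩ := mem_orbitFinset_singleton.1 hmem
      exact hxy (h3.symm.trans h4)
    have hsep : ∀ x y z : α, z ∈ (Λ x) → z ∉ (Λ y) → z ∈ separators G x y := by
      intro x y z hx hy
      rw [mem_separators]
      intro hmem
      have h3 := (mem_largeOrbit_iff_of_mem hmem).2 (mem_largeOrbit_symm (mem_largeOrbit_of_transitive hT _) hx)
      exact hy (mem_largeOrbit_symm (mem_largeOrbit_of_transitive hT _) h3)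
    have hsub2 : ({a, w} : Finset α) ∪ (((Λ a) \ (Λ w)) ∪ ((Λ w) \ (Λ a))) ⊆ separators G a w := by
      intro z hz
      simp only [Finset.mem_union, Finset.mem_insert, Finset.mem_singleton,
        Finset.mem_sdiff] at hz
      rcases hz with (rfl | rfl) | ⟨h3, h4⟩ | ⟨h3, h4⟩
      · exact mem_separators.2 (hself _ _ hw.ne)
      · rw [separators_comm]
        exact mem_separators.2 (hself _ _ hw.ne')
      · exact hsep _ _ _ h3 h4
      · rw [separators_comm]
        exact hsep _ _ _ h3 h4
    have h3 := Finset.card_le_card hsub2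
    rw [Finset.card_union_of_disjoint, Finset.card_union_of_disjoint, Finset.card_pair hw.ne,
      hadj _ _ hw] at h3
    · have h4 := Finset.card_sdiff_add_card_inter (Λ a) (Λ w)
      have h5 := Finset.card_sdiff_add_card_inter (Λ w) (Λ a)
      have h6 := card_largeOrbit_eq hT a w
      rw [Finset.inter_comm] at h5
      omega
    · exact disjoint_sdiff_sdiff
    · rw [Finset.disjoint_left]
      intro z hz hz'
      simp only [Finset.mem_union, Finset.mem_insert, Finset.mem_singleton,
        Finset.mem_sdiff] at hz hz'
      rcases hz with rfl | rfl
      · rcases hz' with h4 | h4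
        · exact not_self_mem_largeOrbit hn _ h4.1
        · have := hdist _ _ (mem_largeOrbit_symm (mem_largeOrbit_of_transitive hT _) h4.1)
          omega
      · rcases hz' with h4 | h4
        · have := hdist _ _ h4.1
          omega
        · exact not_self_mem_largeOrbit hn _ h4.1
  calc 2 * (Λ a).card ≤ 2 * ∑ w ∈ Γ.neighborFinset a, ((Λ a) \ (Λ w)).card :=
        Nat.mul_le_mul_left _ ((Finset.card_le_card hsub).trans Finset.card_biUnion_le)
    _ = ∑ w ∈ Γ.neighborFinset a, 2 * ((Λ a) \ (Λ w)).card := Finset.mul_sum _ _ _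
    _ ≤ (Γ.neighborFinset a).card • (d - 2) := Finset.sum_le_card_nsmul _ _ _ hw
    _ = ν * (d - 2) := by rw [SimpleGraph.card_neighborFinset_eq_degree, hν, smul_eq_mul]

omit [Fintype α] hT hG hn h2 in
theorem le_three_mul_of_bounds {n d M k t D ν : ℕ} (hn : n = M + (k + 1)) (hM : n < 2 * M)
    (ht : 2 ≤ t) (htd : t < d) (hD : D ≤ d * t) (h3 : 2 * M * (k + 1) ≤ D * (M + 2 * k))
    (h4 : 2 * M ≤ ν * (d - 2)) (h5 : (t + 1) / 3 * (ν + 1) ≤ k + 1) :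
    n ≤ 3 * (d * (d - 1)) := by
  obtain ⟨e, rfl⟩ : ∃ e, d = e + 2 := ⟨d - 2, by omega⟩
  rw [Nat.add_sub_cancel] at h4
  have h6 : t * (ν + 1) ≤ 4 * (k + 1) := by
    have : t ≤ 4 * ((t + 1) / 3) := by omega
    nlinarith
  have h7 : 2 * M * (k + 1) ≤ (e + 2) * t * (M + 2 * k) := h3.trans (Nat.mul_le_mul_right _ hD)
  have h8 : 2 * M * (k + 1) ≤ (e + 2) * (e + 1) * (M + 2 * k) :=
    h7.trans (Nat.mul_le_mul_right _ (Nat.mul_le_mul_left _ (by omega)))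
  have h9 : M * M ≤ (e + 2) * e * (M + 2 * k) := by
    have h10 : t * (M * (ν + 1)) ≤ t * (2 * (e + 2) * (M + 2 * k)) := by
      calc t * (M * (ν + 1)) = M * (t * (ν + 1)) := by ring
        _ ≤ M * (4 * (k + 1)) := Nat.mul_le_mul_left _ h6
        _ = 2 * (2 * M * (k + 1)) := by ring
        _ ≤ 2 * ((e + 2) * t * (M + 2 * k)) := Nat.mul_le_mul_left _ h7
        _ = _ := by ring
    have h11 := Nat.le_of_mul_le_mul_left h10 (by omega)
    have h12 : 2 * (M * M) ≤ 2 * ((e + 2) * e * (M + 2 * k)) := by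
      calc 2 * (M * M) = M * (2 * M) := by ring
        _ ≤ M * (ν * e) := Nat.mul_le_mul_left _ h4
        _ ≤ (M * (ν + 1)) * e := by nlinarith [Nat.zero_le (M * e)]
        _ ≤ (2 * (e + 2) * (M + 2 * k)) * e := Nat.mul_le_mul_right _ h11
        _ = _ := by ring
    omega
  have hpos : 0 < M + 2 * k := by omega
  refine Nat.le_of_mul_le_mul_right ?_ hpos
  rw [show e + 2 - 1 = e + 1 from rfl, hn]
  rcases Nat.lt_or_ge M (2 * (k + 1)) with hlt | hge
  · have h13 : (M + (k + 1)) * (M + 2 * k) ≤ 3 * (2 * M * (k + 1)) := by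
      obtain ⟨u, hu⟩ : ∃ u, M = (k + 1) + u := ⟨M - (k + 1), by omega⟩
      obtain ⟨v, hv⟩ : ∃ v, 2 * (k + 1) = M + v := ⟨2 * (k + 1) - M, by omega⟩
      have huv : k + 1 = u + v := by omega
      have hk : 2 * k ≤ 2 * (u + v) := by omega
      rw [huv] at hu ⊢
      subst hu
      nlinarith [Nat.zero_le (u * v), Nat.zero_le u, Nat.zero_le v]
    nlinarith
  · have h13 : (M + (k + 1)) * (M + 2 * k) ≤ 3 * (M * M) := by
      calc (M + (k + 1)) * (M + 2 * k) ≤ (M + (k + 1)) * (2 * M) :=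
            Nat.mul_le_mul_left _ (by omega)
        _ = (2 * (M + (k + 1))) * M := by ring
        _ ≤ (3 * M) * M := Nat.mul_le_mul_right _ (by omega)
        _ = _ := by ring
    nlinarith [Nat.zero_le ((e + 2) * (M + 2 * k))]

omit [Fintype α] hT hG hn h2 in
theorem le_three_mul_of_sq_bound {n d M k D : ℕ} (hn : n = M + (k + 1)) (hM : n < 2 * M)
    (hD : D ≤ d) (h3 : 2 * M * (k + 1) ≤ D * (M + 2 * k)) (h4 : M ≤ k * (k - 1)) :
    n ≤ 3 * (d * (d - 1)) := by
  have hk : 2 ≤ k := by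
    by_contra! hlt
    interval_cases k <;> omega
  have h5 : 2 * (k + 1) ≤ 3 * d := by
    have : 2 * M * (k + 1) ≤ d * (3 * M) :=
      h3.trans (Nat.mul_le_mul hD (by omega))
    have h6 : M * (2 * (k + 1)) ≤ M * (3 * d) := by linarith
    exact Nat.le_of_mul_le_mul_left h6 (by omega)
  obtain ⟨j, rfl⟩ : ∃ j, k = j + 2 := ⟨k - 2, by omega⟩
  obtain ⟨e, rfl⟩ : ∃ e, d = e + 2 := ⟨d - 2, by omega⟩
  rw [show j + 2 - 1 = j + 1 from rfl] at h4
  rw [show e + 2 - 1 = e + 1 from rfl, hn]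
  have h6 : 2 * j ≤ 3 * e := by omega
  have h7 : (2 * j) * (2 * j) ≤ (3 * e) * (3 * e) := Nat.mul_self_le_mul_self h6
  nlinarith

theorem exists_card_separators_bound :
    ∃ d, (∀ x y, x ≠ y → d ≤ (separators G x y).card) ∧ Fintype.card α ≤ 3 * (d * (d - 1)) := by
  classical
  have hne : ((Finset.univ : Finset α).offDiag).Nonempty := by
    obtain ⟨x, y, hxy⟩ := Fintype.exists_pair_of_one_lt_card (Nat.lt_of_succ_le hn)
    exact ⟨(x, y), Finset.mem_offDiag.2 ⟨Finset.mem_univ _, Finset.mem_univ _, hxy⟩⟩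
  obtain ⟨⟨a₀, b₀⟩, hab₀, hmin⟩ := Finset.exists_min_image _
    (fun p : α × α => (separators G p.1 p.2).card) hne
  set d := (separators G a₀ b₀).card with hd
  have hmin' : ∀ x y, x ≠ y → d ≤ (separators G x y).card := fun x y hxy =>
    hmin (x, y) (Finset.mem_offDiag.2 ⟨Finset.mem_univ _, Finset.mem_univ _, hxy⟩)
  refine ⟨d, hmin', ?_⟩
  let Γ : SimpleGraph α :=
    { Adj := fun x y => x ≠ y ∧ (separators G x y).card = d
      symm := ⟨fun x y hxy => ⟨hxy.1.symm, by rw [separators_comm, hxy.2]⟩⟩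
      loopless := ⟨fun x hx => hx.1 rfl⟩ }
  have hinv : ∀ g ∈ G, ∀ x y, Γ.Adj x y → Γ.Adj (g x) (g y) := fun g hg x y hxy =>
    ⟨g.injective.ne hxy.1, by rw [card_separators_image hg, hxy.2]⟩
  have hadj : ∀ x y, Γ.Adj x y → (separators G x y).card = d := fun x y hxy => hxy.2
  have hΓ : Γ.Connected := connected_of_isPreprimitive hinv hG (a := a₀) (b := b₀)
    ⟨(Finset.mem_offDiag.1 hab₀).2.2, rfl⟩
  by_cases hlarge : ∀ x, (Λ x) = ∅
  · obtain ⟨x, z, hxz, h3⟩ := exists_le_two_mul_card_separators hn hlarge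
    have h4 := card_separators_le_mul_dist hΓ hadj x z
    have h5 := dist_lt_of_card_separators hΓ hinv hadj hxz
    have h6 : d * Γ.dist x z ≤ d * (d - 1) := Nat.mul_le_mul_left _ (by omega)
    omega
  push Not at hlarge
  obtain ⟨a, b, h⟩ := hlarge
  have hab : a ≠ b := by
    rintro rfl
    exact not_self_mem_largeOrbit hn _ h
  have hM := card_largeOrbit_lt h
  have hk := card_largeOrbit_lt_card_sub_one hT hn h2 a
  have h3 := mul_card_le_card_separators_mul hT hn h
  have htd := dist_lt_of_card_separators hΓ hinv hadj hab
  have hDt := card_separators_le_mul_dist hΓ hadj a b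
  have ht0 := hΓ.pos_dist_of_ne hab
  obtain ⟨k, hnk⟩ : ∃ k, Fintype.card α = (Λ a).card + (k + 1) :=
    ⟨Fintype.card α - 1 - (Λ a).card, by omega⟩
  rw [show Fintype.card α - (Λ a).card = k + 1 by omega,
    show Fintype.card α - 1 - (Λ a).card = k by omega] at h3
  rcases Nat.lt_or_ge (Γ.dist a b) 2 with ht | ht
  · have h4 := card_le_sq_add_one hT hG hn h2 h
    rw [show Fintype.card α - 1 - (Λ a).card = k by omega] at h4
    rw [show Γ.dist a b = 1 by omega, mul_one] at hDt
    exact le_three_mul_of_sq_bound hnk hM hDt h3 h4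
  · have hν : ∀ x, Γ.degree x = Γ.degree a := by
      intro x
      obtain ⟨g, hg, rfl⟩ := hT a x
      rw [← SimpleGraph.card_neighborFinset_eq_degree, ← SimpleGraph.card_neighborFinset_eq_degree]
      refine (Finset.card_equiv g fun y => ?_).symm
      rw [SimpleGraph.mem_neighborFinset, SimpleGraph.mem_neighborFinset]
      refine ⟨hinv g hg _ _, fun hh => ?_⟩
      simpa using hinv g⁻¹ (G.inv_mem hg) _ _ hh
    have h4 := two_mul_card_largeOrbit_le hT hn hΓ hinv hν hadj h ht
    have h5 := mul_le_card_ball hΓ hν a b (Λ a)ᶜ fun y hy => by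
      rw [Finset.mem_compl]
      intro hmem
      obtain ⟨g, hg, h6, rfl⟩ := exists_image_pair_of_mem_largeOrbit hT h hmem
      have h7 := dist_image_eq hinv hΓ hg a b
      rw [h6] at h7
      omega
    rw [Finset.card_compl, show Fintype.card α - (Λ a).card = k + 1 by omega] at h5
    exact le_three_mul_of_bounds hnk hM ht htd hDt h3 h4 h5

end Uniprimitive

section LogSums

theorem sum_range_pow_le {q : ℝ} (hq0 : 0 ≤ q) (hq1 : q < 1) (J : ℕ) :
    ∑ j ∈ Finset.range J, q ^ j ≤ 1 / (1 - q) := by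
  rw [geom_sum_eq hq1.ne, ← neg_div_neg_eq, neg_sub, neg_sub]
  have : 0 < 1 - q := by linarith
  gcongr
  linarith [pow_nonneg hq0 J]

theorem sum_log_one_add_le {N c : ℝ} (hN : 1 ≤ N) (hc : 0 < c) (J : ℕ) :
    ∑ j ∈ Finset.range J, Real.log (1 + Real.exp (-c) ^ j * N) ≤
      (Real.log N + c / 2) ^ 2 / (2 * c) + 2 / (1 - Real.exp (-c)) := by
  set q := Real.exp (-c) with hq
  have hq0 : 0 < q := Real.exp_pos _
  have hq1 : q < 1 := by rw [hq]; simpa using hc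
  have hN0 : 0 < N := by linarith
  have hL : 0 ≤ Real.log N := Real.log_nonneg hN
  set L := Real.log N with hLdef
  set m := ⌈L / c⌉₊ with hm
  have hm1 : L ≤ c * m := by
    have := Nat.le_ceil (L / c)
    rw [div_le_iff₀ hc] at this
    linarith
  have hm2 : c * m < L + c := by
    have := Nat.ceil_lt_add_one (div_nonneg hL hc.le)
    rw [div_add_one hc.ne', lt_div_iff₀ hc] at this
    linarith
  have hterm : ∀ j : ℕ, q ^ j * N = Real.exp (L - c * j) := by
    intro j
    rw [hq, ← Real.exp_nat_mul, Real.exp_sub, hLdef, Real.exp_log hN0, div_eq_mul_inv,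
      ← Real.exp_neg]
    ring_nf
  have hpow : ∀ j : ℕ, q ^ j = Real.exp (-(c * j)) := by
    intro j
    rw [hq, ← Real.exp_nat_mul]
    ring_nf
  have hnonneg : ∀ j : ℕ, 0 ≤ Real.log (1 + q ^ j * N) := fun j => by
    refine Real.log_nonneg ?_
    have : 0 ≤ q ^ j * N := by positivity
    linarith
  have h1 : ∀ j ∈ Finset.range m,
      Real.log (1 + q ^ j * N) ≤ (L - c * j) + q ^ (m - 1 - j) := by
    intro j hj
    rw [Finset.mem_range] at hj
    have h2 : 1 + Real.exp (L - c * j) =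
        Real.exp (L - c * j) * (1 + Real.exp (-(L - c * j))) := by
      rw [mul_add, ← Real.exp_add, add_neg_cancel, Real.exp_zero]
      ring
    rw [hterm, h2, Real.log_mul (Real.exp_pos _).ne' (by positivity), Real.log_exp]
    have h3 := Real.log_le_sub_one_of_pos
      (show 0 < 1 + Real.exp (-(L - c * j)) by positivity)
    have h4 : Real.exp (-(L - c * j)) ≤ q ^ (m - 1 - j) := by
      rw [hpow]
      refine Real.exp_le_exp.2 ?_
      rw [Nat.sub_sub, Nat.cast_sub (by omega)]
      push_cast
      nlinarith
    linarith
  have h2 : ∀ i ∈ Finset.range J, Real.log (1 + q ^ (m + i) * N) ≤ q ^ i := by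
    intro i _
    have h3 := Real.log_le_sub_one_of_pos
      (show 0 < 1 + q ^ (m + i) * N by positivity)
    have h4 : q ^ (m + i) * N ≤ q ^ i := by
      rw [hterm, hpow]
      refine Real.exp_le_exp.2 ?_
      push_cast
      nlinarith
    linarith
  have h3 : ∑ j ∈ Finset.range m, (L - c * j) ≤ (L + c / 2) ^ 2 / (2 * c) := by
    have h4 : ∑ j ∈ Finset.range m, (L - c * j) = m * L - c * (m * (m - 1) / 2) := by
      clear_value m
      clear h1 h2 hm hm1 hm2
      induction m with
      | zero => simp
      | succ m ih =>
        rw [Finset.sum_range_succ, ih]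
        push_cast
        ring
    rw [h4, le_div_iff₀ (by positivity)]
    nlinarith [sq_nonneg (L + c / 2 - c * m)]
  have h4 : ∑ j ∈ Finset.range m, q ^ (m - 1 - j) ≤ 1 / (1 - q) := by
    rw [Finset.sum_range_reflect (fun j => q ^ j)]
    exact sum_range_pow_le hq0.le hq1 m
  have h5 := sum_range_pow_le hq0.le hq1 J
  calc ∑ j ∈ Finset.range J, Real.log (1 + q ^ j * N)
      ≤ ∑ j ∈ Finset.range (m + J), Real.log (1 + q ^ j * N) :=
        Finset.sum_le_sum_of_subset_of_nonneg (Finset.range_mono (by omega))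
          fun j _ _ => hnonneg j
    _ = ∑ j ∈ Finset.range m, Real.log (1 + q ^ j * N) +
        ∑ i ∈ Finset.range J, Real.log (1 + q ^ (m + i) * N) := Finset.sum_range_add _ _ _
    _ ≤ (∑ j ∈ Finset.range m, ((L - c * j) + q ^ (m - 1 - j))) +
        ∑ i ∈ Finset.range J, q ^ i :=
        add_le_add (Finset.sum_le_sum h1) (Finset.sum_le_sum h2)
    _ ≤ (L + c / 2) ^ 2 / (2 * c) + 2 / (1 - q) := by
      rw [Finset.sum_add_distrib]
      have : 2 / (1 - q) = 1 / (1 - q) + 1 / (1 - q) := by ring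
      linarith

open Classical in
theorem log_card_le_mul_of_separated {α ι : Type*} [Fintype α] [Nonempty α] [Fintype ι]
    [Nonempty ι] {G : Subgroup (Perm α)} (S : ι → Finset α) {k : ℕ} {c : ℝ} (hc : 0 < c)
    (hS : ∀ s, Fintype.card α * (Finset.univ.filter fun i => s ∈ S i).card ≤ k * Fintype.card ι)
    (hsep : ∀ x y, x ≠ y → (1 - Real.exp (-c)) * Fintype.card ι ≤
      (Finset.univ.filter fun i => y ∉ orbitFinset (pointwiseStabilizer G (S i)) x).card) :
    Real.log (Nat.card G) ≤ k * ((Real.log (Fintype.card α) + c / 2) ^ 2 / (2 * c) +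
      2 / (1 - Real.exp (-c))) := by
  have hn : (1 : ℝ) ≤ Fintype.card α := by exact_mod_cast Fintype.card_pos
  have hq0 : 0 < Real.exp (-c) := Real.exp_pos _
  have hq1 : Real.exp (-c) < 1 := by simpa using hc
  set B := (Real.log (Fintype.card α) + c / 2) ^ 2 / (2 * c) + 2 / (1 - Real.exp (-c)) with hB
  have hpairs : (orbitPairs G / Fintype.card α : ℝ) ≤ Fintype.card α := by
    rw [div_le_iff₀ (by linarith)]
    exact_mod_cast (orbitPairs_le G).trans (Nat.mul_le_mul_left _ (Nat.sub_le _ _))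
  have key : ∀ J : ℕ, Real.log (Nat.card G) ≤
      k * B + Real.log (Nat.card G) * (Real.exp (-c) ^ J * orbitPairs G) := by
    intro J
    have h1 := log_card_le_of_separated S (θ := 1 - Real.exp (-c)) (by linarith) hS hsep J G le_rfl
    rw [sub_sub_cancel] at h1
    refine h1.trans (add_le_add_left (mul_le_mul_of_nonneg_left ?_ (Nat.cast_nonneg k)) _)
    refine le_trans (Finset.sum_le_sum fun j _ => ?_) (sum_log_one_add_le hn hc J)
    refine Real.log_le_log (by positivity) ?_
    gcongr
  have hlim : Filter.Tendsto
      (fun J : ℕ => k * B + Real.log (Nat.card G) * (Real.exp (-c) ^ J * orbitPairs G))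
      Filter.atTop (nhds (k * B + Real.log (Nat.card G) * (0 * orbitPairs G))) :=
    (((tendsto_pow_atTop_nhds_zero_of_lt_one hq0.le hq1).mul_const _).const_mul _).const_add _
  have := ge_of_tendsto' hlim key
  simpa using this

end LogSums

section UniprimitiveOrder

theorem log_le_of_le {x y : ℝ} (hx : 0 < x) (hy : 0 < y) : Real.log x ≤ Real.log y + (x / y - 1) := by
  have h := Real.log_le_sub_one_of_pos (div_pos hx hy)
  rw [Real.log_div hx.ne' hy.ne'] at h
  linarith

theorem factorization_mul_sub_one_le {N n p : ℕ} (hp : p.Prime) (hn : 0 < n)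
    (h : N ∣ n.factorial) : (N.factorization p : ℝ) * (p - 1) ≤ n - 1 := by
  have h1 : N.factorization p ≤ n.factorial.factorization p :=
    (Nat.factorization_le_iff_dvd (ne_zero_of_dvd_ne_zero n.factorial_ne_zero h)
      n.factorial_ne_zero).2 h p
  have := Fact.mk hp
  have h2 := sub_one_mul_padicValNat_factorial_lt_of_ne_zero p hn.ne'
  rw [← Nat.factorization_def _ hp] at h2
  have h3 : (p - 1) * N.factorization p + 1 ≤ n :=
    (Nat.succ_le_succ (Nat.mul_le_mul_left _ h1)).trans h2
  obtain ⟨q, rfl⟩ : ∃ q, p = q + 1 := ⟨p - 1, by have := hp.pos; omega⟩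
  rw [Nat.add_sub_cancel] at h3
  have h4 : (q * N.factorization (q + 1) + 1 : ℝ) ≤ n := by exact_mod_cast h3
  push_cast
  linarith

theorem log_seven_gt : 1.935 < Real.log 7 := by
  have h1 : Real.log 48 ≤ Real.log (7 ^ 2) := Real.log_le_log (by norm_num) (by norm_num)
  rw [show (48 : ℝ) = 2 ^ 4 * 3 by norm_num, Real.log_mul (by norm_num) (by norm_num),
    Real.log_pow, Real.log_pow] at h1
  have := Real.log_two_gt_d9
  have := Real.log_three_gt_d9
  push_cast at h1
  linarith

theorem log_eleven_gt : 2.302 < Real.log 11 := by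
  have h1 : Real.log 10 ≤ Real.log 11 := Real.log_le_log (by norm_num) (by norm_num)
  rw [Real.log_ten_eq] at h1
  have := Real.log_two_gt_d9
  have := Real.log_five_gt_d9
  linarith

theorem log_eleven_lt : Real.log 11 < 2.415 := by
  have h1 : Real.log (11 ^ 2) ≤ Real.log (5 ^ 3) := Real.log_le_log (by norm_num) (by norm_num)
  rw [Real.log_pow, Real.log_pow] at h1
  have := Real.log_five_lt_d9
  push_cast at h1
  linarith

theorem cardFactors_le_of_log_le {n N : ℕ} (hn : 92 ≤ n) (hd : N ∣ n.factorial)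
    (h : Real.log N ≤ 2.15 * n - 7) : ArithmeticFunction.cardFactors N ≤ 2 * n - 5 := by
  by_contra! hcon
  have hcon' : (2 * n - 4 : ℝ) ≤ ArithmeticFunction.cardFactors N := by
    have : 2 * n ≤ ArithmeticFunction.cardFactors N + 4 := by omega
    have : (2 * n : ℝ) ≤ ArithmeticFunction.cardFactors N + 4 := by exact_mod_cast this
    linarith
  have h1 := cardFactors_mul_log_le (N := N) (P := 11)
  have hn' : (92 : ℝ) ≤ n := by exact_mod_cast hn
  rw [show Nat.primesBelow 11 = {2, 3, 5, 7} by decide] at h1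
  have h2 := factorization_mul_sub_one_le Nat.prime_two (by omega) hd
  have h3 := factorization_mul_sub_one_le Nat.prime_three (by omega) hd
  have h5 := factorization_mul_sub_one_le Nat.prime_five (by omega) hd
  have h7 := factorization_mul_sub_one_le (p := 7) (by norm_num) (by omega) hd
  rw [Finset.sum_insert (by decide), Finset.sum_insert (by decide), Finset.sum_insert (by decide),
    Finset.sum_singleton] at h1
  push_cast at h1 h2 h3 h5 h7
  have l2 := Real.log_two_gt_d9
  have l3 := Real.log_three_gt_d9
  have l5 := Real.log_five_gt_d9
  have u2 := Real.log_two_lt_d9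
  have u3 := Real.log_three_lt_d9
  have u5 := Real.log_five_lt_d9
  have l7 := log_seven_gt
  have l11 := log_eleven_gt
  have u11 := log_eleven_lt
  have u7 : Real.log 7 ≤ Real.log 11 := Real.log_le_log (by norm_num) (by norm_num)
  have g2 : (N.factorization 2 : ℝ) * (Real.log 11 - Real.log 2) ≤
      (n - 1) * (Real.log 11 - Real.log 2) :=
    mul_le_mul_of_nonneg_right (by linarith) (by linarith)
  have g3 : (N.factorization 3 : ℝ) * (Real.log 11 - Real.log 3) ≤
      ((n - 1) / 2) * (Real.log 11 - Real.log 3) :=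
    mul_le_mul_of_nonneg_right (by linarith) (by linarith)
  have g5 : (N.factorization 5 : ℝ) * (Real.log 11 - Real.log 5) ≤
      ((n - 1) / 4) * (Real.log 11 - Real.log 5) :=
    mul_le_mul_of_nonneg_right (by linarith) (by linarith)
  have g7 : (N.factorization 7 : ℝ) * (Real.log 11 - Real.log 7) ≤
      ((n - 1) / 6) * (Real.log 11 - Real.log 7) :=
    mul_le_mul_of_nonneg_right (by linarith) (by linarith)
  have g11 : (2 * n - 4) * Real.log 11 ≤ ArithmeticFunction.cardFactors N * Real.log 11 :=
    mul_le_mul_of_nonneg_right hcon' (by linarith)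
  have key : (n - 1) * (2.159 : ℝ) ≤ (n - 1) * (Real.log 11 / 12 + Real.log 2 +
      Real.log 3 / 2 + Real.log 5 / 4 + Real.log 7 / 6) :=
    mul_le_mul_of_nonneg_left (by linarith) (by linarith)
  linarith

theorem log_sq_bound {n d : ℕ} (hd : 7 ≤ d) (hn : 92 ≤ n) (h : n ≤ 3 * (d * (d - 1))) :
    Real.log n ^ 2 / 2 + 2 ≤ 2 * d := by
  have hn0 : (0 : ℝ) < n := by exact_mod_cast (by omega : 0 < n)
  have hL : 0 ≤ Real.log n := Real.log_natCast_nonneg n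
  have u2 := Real.log_two_lt_d9
  have u3 := Real.log_three_lt_d9
  rcases hd.eq_or_lt with rfl | hd8
  · have h1 : Real.log n ≤ Real.log 126 := Real.log_le_log hn0 (by exact_mod_cast h)
    have h2 := log_le_of_le (x := 126) (y := 5 ^ 3) (by norm_num) (by norm_num)
    rw [Real.log_pow] at h2
    have u5 := Real.log_five_lt_d9
    push_cast at h2 ⊢
    have h3 : Real.log n ≤ 4.837 := by linarith
    nlinarith
  · have hd0 : (8 : ℝ) ≤ d := by exact_mod_cast hd8
    set s := Real.sqrt (d / 8) with hs
    have hs2 : s ^ 2 = d / 8 := Real.sq_sqrt (by positivity)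
    have hs1 : 1 ≤ s := Real.one_le_sqrt.2 (by linarith)
    have hle : (n : ℝ) ≤ 3 * (8 * s ^ 2) ^ 2 := by
      rw [hs2]
      have : n ≤ 3 * (d * d) := h.trans (by gcongr; omega)
      have : (n : ℝ) ≤ 3 * (d * d) := by exact_mod_cast this
      nlinarith
    have h1 : Real.log n ≤ Real.log 3 + 2 * (3 * Real.log 2 + 2 * (s - 1)) := by
      refine (Real.log_le_log hn0 hle).trans ?_
      rw [Real.log_mul (by norm_num) (by positivity), Real.log_pow,
        Real.log_mul (by norm_num) (by positivity), Real.log_pow,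
        show (8 : ℝ) = 2 ^ 3 by norm_num, Real.log_pow]
      have := Real.log_le_sub_one_of_pos (show 0 < s by linarith)
      push_cast
      linarith
    have h2 : Real.log n ≤ 1.258 + 4 * s := by linarith
    have h3 : Real.log n ^ 2 ≤ (1.258 + 4 * s) ^ 2 := pow_le_pow_left₀ hL h2 2
    have h4 : (d : ℝ) = 8 * s ^ 2 := by rw [hs2]; ring
    rw [h4]
    nlinarith

theorem cardFactors_le_of_not_doubly_transitive {α : Type*} [Fintype α] {G : Subgroup (Perm α)}
    (hT : ∀ x y : α, ∃ g ∈ G, g x = y) (hG : IsPreprimitive G α) (hn : 92 ≤ Fintype.card α)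
    (h2 : ¬ ∀ a b c d : α, a ≠ b → c ≠ d → ∃ g ∈ G, g a = c ∧ g b = d) :
    ArithmeticFunction.cardFactors (Nat.card G) ≤ 2 * Fintype.card α - 5 := by
  classical
  obtain ⟨d, hd, hnd⟩ := exists_card_separators_bound hT hG (by omega) h2
  have hne : Nonempty α := Fintype.card_pos_iff.1 (by omega)
  have hd7 : 7 ≤ d := by
    by_contra! hlt
    interval_cases d <;> omega
  have hdn : d ≤ Fintype.card α := by
    obtain ⟨x, y, hxy⟩ := Fintype.exists_pair_of_one_lt_card (α := α) (by omega)
    exact (hd x y hxy).trans (Finset.card_le_univ _)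
  refine cardFactors_le_of_log_le hn ?_ ?_
  · rw [← Fintype.card_perm, ← Nat.card_eq_fintype_card]
    exact G.card_subgroup_dvd_card
  have hn' : (92 : ℝ) ≤ Fintype.card α := by exact_mod_cast hn
  have hd' : (7 : ℝ) ≤ d := by exact_mod_cast hd7
  have hdn' : (d : ℝ) ≤ Fintype.card α := by exact_mod_cast hdn
  have hLsq := log_sq_bound hd7 hn hnd
  set n := Fintype.card α with hncard
  set c : ℝ := d / n with hc
  have hc0 : 0 < c := by positivity
  have hc1 : c ≤ 1 := by
    rw [hc, div_le_one (by linarith)]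
    exact hdn'
  have hcn : c * n = d := by
    exact div_mul_cancel₀ _ (by linarith)
  have hexp := Real.add_one_le_exp (-c)
  have h1 := log_card_le_mul_of_separated (G := G) (fun i : α => ({i} : Finset α)) (k := 1) hc0
    (fun s => by
      have : (Finset.univ.filter fun i : α => s ∈ ({i} : Finset α)) = {s} := by
        ext i
        simp [eq_comm]
      rw [this]
      simp)
    (fun x y hxy => by
      have h3 : (d : ℝ) ≤ (separators G x y).card := by exact_mod_cast hd x y hxy
      have h4 : (1 - Real.exp (-c)) * n ≤ c * n :=
        mul_le_mul_of_nonneg_right (by linarith) (by linarith)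
      rw [hcn] at h4
      refine (h4.trans h3).trans (Eq.le ?_)
      congr 2)
  rw [Nat.cast_one, one_mul] at h1
  have h3 : 2 / (1 - Real.exp (-c)) ≤ 2 / c + 2 := by
    have h4 : Real.exp (-c) * (1 + c) ≤ 1 := by
      have h5 := Real.add_one_le_exp c
      calc Real.exp (-c) * (1 + c) ≤ Real.exp (-c) * Real.exp c :=
            mul_le_mul_of_nonneg_left (by linarith) (Real.exp_pos _).le
        _ = 1 := by rw [← Real.exp_add]; simp
    have h5 : 0 < 1 - Real.exp (-c) := by
      have : Real.exp (-c) < 1 := by simpa using hc0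
      linarith
    rw [div_le_iff₀ h5, show 2 / c + 2 = 2 * (1 + c) / c by field_simp, div_mul_eq_mul_div,
      le_div_iff₀ hc0]
    nlinarith
  have hLn : Real.log n ≤ n / 20 := by
    have h4 := log_le_of_le (x := n) (y := 2 * 3 ^ 2 * 5) (by linarith) (by norm_num)
    rw [Real.log_mul (by norm_num) (by norm_num), Real.log_mul (by norm_num) (by norm_num),
      Real.log_pow] at h4
    have := Real.log_two_lt_d9
    have := Real.log_three_lt_d9
    have := Real.log_five_lt_d9
    push_cast at h4
    norm_num at h4
    linarith
  have h4 : (Real.log n + c / 2) ^ 2 / (2 * c) + 2 / c =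
      (Real.log n ^ 2 / 2 + 2) / c + Real.log n / 2 + c / 8 := by
    field_simp
    ring
  have h5 : (Real.log n ^ 2 / 2 + 2) / c ≤ 2 * n := by
    rw [div_le_iff₀ hc0]
    nlinarith
  linarith

end UniprimitiveOrder

section LargeOrbitChain

variable {α : Type*} [Fintype α] [DecidableEq α] {G : Subgroup (Perm α)}

/-- Each point of the list lies in the large orbit of the stabilizer of the points after it. -/
def IsLargeOrbitChain (G : Subgroup (Perm α)) : List α → Prop
  | [] => True
  | x :: l => x ∈ largeOrbit (pointwiseStabilizer G l.toFinset) ∧ IsLargeOrbitChain G l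

theorem IsLargeOrbitChain.exists_map_eq : ∀ {l l' : List α}, IsLargeOrbitChain G l →
    IsLargeOrbitChain G l' → l.length = l'.length → ∃ g ∈ G, l.map g = l'
  | [], [], _, _, _ => ⟨1, G.one_mem, rfl⟩
  | x :: l, x' :: l', h, h', hlen => by
    obtain ⟨g, hg, rfl⟩ := exists_map_eq h.2 h'.2 (by simpa using hlen)
    have h1 : (l.map g).toFinset = l.toFinset.map g.toEmbedding := by
      ext y
      simp only [List.mem_toFinset, List.mem_map, Finset.mem_map, Equiv.coe_toEmbedding]
    have h2 := h'.1
    rw [h1, largeOrbit_eq ((map_mem_largeOrbit_iff hg _ _).2 h.1), mem_orbitFinset] at h2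
    obtain ⟨k, hk, rfl⟩ := h2
    refine ⟨k * g, G.mul_mem hk.1 hg, ?_⟩
    rw [List.map_cons, Perm.mul_apply]
    refine congrArg _ (List.map_congr_left fun y hy => ?_)
    exact hk.2 _ (Finset.mem_map_of_mem _ (List.mem_toFinset.2 hy))

omit [Fintype α] in
theorem pointwiseStabilizer_insert (S : Finset α) (y : α) :
    pointwiseStabilizer (pointwiseStabilizer G S) {y} = pointwiseStabilizer G (insert y S) := by
  ext g
  simp only [mem_pointwiseStabilizer, Finset.mem_singleton, forall_eq, Finset.forall_mem_insert]
  tauto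

theorem IsLargeOrbitChain.swap {x y : α} {l : List α} (h : IsLargeOrbitChain G (x :: y :: l)) :
    IsLargeOrbitChain G (y :: x :: l) := by
  obtain ⟨hx, hy, hl⟩ := h
  rw [List.toFinset_cons, ← pointwiseStabilizer_insert] at hx
  refine ⟨?_, largeOrbit_mono (pointwiseStabilizer_le _ _) hx, hl⟩
  rw [List.toFinset_cons, ← pointwiseStabilizer_insert]
  exact mem_largeOrbit_symm hy hx

theorem IsLargeOrbitChain.perm {l l' : List α} (h : IsLargeOrbitChain G l) (hp : l.Perm l') :
    IsLargeOrbitChain G l' := by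
  induction hp with
  | nil => exact h
  | cons x hp ih =>
    refine ⟨?_, ih h.2⟩
    rw [← List.toFinset_eq_of_perm _ _ hp]
    exact h.1
  | swap x y l => exact h.swap
  | trans _ _ ih1 ih2 => exact ih2 (ih1 h)

theorem IsLargeOrbitChain.nodup (hn : 2 ≤ Fintype.card α) :
    ∀ {l : List α}, IsLargeOrbitChain G l → l.Nodup
  | [], _ => List.nodup_nil
  | x :: l, h => by
    refine List.nodup_cons.2 ⟨fun hx => ?_, nodup hn h.2⟩
    have h1 : orbitFinset (pointwiseStabilizer G l.toFinset) x ⊆ {x} := by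
      intro y hy
      obtain ⟨g, hg, rfl⟩ := mem_orbitFinset.1 hy
      rw [hg.2 x (List.mem_toFinset.2 hx)]
      exact Finset.mem_singleton_self x
    have h2 := Finset.card_le_card h1
    have h3 := mem_largeOrbit.1 h.1
    rw [Finset.card_singleton] at h2
    omega

theorem exists_isLargeOrbitChain {k : ℕ}
    (h : ∀ S : Finset α, S.card ≤ k → (largeOrbit (pointwiseStabilizer G S)).Nonempty) :
    ∃ l : List α, l.length = k ∧ IsLargeOrbitChain G l := by
  induction k with
  | zero => exact ⟨[], rfl, trivial⟩
  | succ k ih =>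
    obtain ⟨l, rfl, hl⟩ := ih fun S hS => h S (by omega)
    obtain ⟨x, hx⟩ := h l.toFinset (l.toFinset_card_le.trans (by omega))
    exact ⟨x :: l, rfl, hx, hl⟩

theorem exists_forall_perm_of_largeOrbit_nonempty {I : Type*} [Fintype I]
    (hn : 2 ≤ Fintype.card α)
    (h : ∀ S : Finset α, S.card ≤ Fintype.card I →
      (largeOrbit (pointwiseStabilizer G S)).Nonempty) :
    ∃ f : I → α, Function.Injective f ∧ ∀ τ : Perm I, ∃ g ∈ G, ∀ i, g (f i) = f (τ i) := by
  obtain ⟨l, hlen, hl⟩ := exists_isLargeOrbitChain h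
  let e : I ≃ Fin l.length := Fintype.equivFinOfCardEq hlen.symm
  refine ⟨fun i => l.get (e i), (List.nodup_iff_injective_get.1 (hl.nodup hn)).comp e.injective,
    fun τ => ?_⟩
  let σ : Perm (Fin l.length) := (e.symm.trans τ).trans e
  have h1 : (List.ofFn (l.get ∘ σ)).Perm l := by
    simpa only [List.ofFn_get] using Equiv.Perm.ofFn_comp_perm σ l.get
  obtain ⟨g, hg, hgl⟩ := hl.exists_map_eq (hl.perm h1.symm) h1.length_eq.symm
  refine ⟨g, hg, fun i => ?_⟩
  have h2 : l.map g = List.ofFn (fun j => g (l.get j)) := by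
    conv_lhs => rw [← List.ofFn_get l, List.map_ofFn]
    rfl
  rw [h2, List.ofFn_inj] at hgl
  have h3 := congrFun hgl (e i)
  simpa [σ] using h3

end LargeOrbitChain

section CycleLengths

variable {α : Type*} [Fintype α] [DecidableEq α]

theorem card_support_pow_le_card_filter_dvd_minimalPeriod {g : Perm α} {p : ℕ} (hp : p.Prime)
    {μ : ℕ} (hμ : ∀ j, g ^ j ≠ 1 → μ ≤ (g ^ j).support.card) (hpg : p ∣ orderOf g) :
    μ ≤ ((Finset.univ : Finset α).filter fun x => p ∣ Function.minimalPeriod g x).card := by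
  obtain ⟨e, m, hm, he⟩ := Nat.exists_eq_pow_mul_and_not_dvd (orderOf_pos g).ne' p hp.ne_one
  have hgm : g ^ m ≠ 1 := fun h => hm (hpg.trans (orderOf_dvd_of_pow_eq_one h))
  refine (hμ m hgm).trans (Finset.card_le_card fun x hx => ?_)
  rw [Finset.mem_filter]
  refine ⟨Finset.mem_univ _, ?_⟩
  by_contra hpx
  rw [Perm.mem_support] at hx
  apply hx
  have h1 : Function.minimalPeriod g x ∣ p ^ e * m := by
    rw [← he, ← Function.isPeriodicPt_iff_minimalPeriod_dvd, Function.IsPeriodicPt,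
      Function.IsFixedPt, ← Perm.coe_pow, pow_orderOf_eq_one, Perm.one_apply]
  have h2 : Function.minimalPeriod g x ∣ m :=
    (Nat.Coprime.pow_right e ((Nat.Prime.coprime_iff_not_dvd hp).2 hpx).symm).dvd_of_dvd_mul_left h1
  rw [← Function.isPeriodicPt_iff_minimalPeriod_dvd, Function.IsPeriodicPt,
      Function.IsFixedPt, ← Perm.coe_pow] at h2
  exact h2

theorem prod_pow_le_of_forall_dvd_orderOf {g : Perm α} {Q : Finset ℕ} (hQ : ∀ p ∈ Q, p.Prime)
    {μ : ℕ} (hμ : ∀ j, g ^ j ≠ 1 → μ ≤ (g ^ j).support.card) (hg : ∀ p ∈ Q, p ∣ orderOf g) :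
    (∏ p ∈ Q, p) ^ μ ≤ Fintype.card α ^ Fintype.card α := by
  have h1 : (∏ p ∈ Q, p) ^ μ ≤
      ∏ p ∈ Q, ∏ x : α, if p ∣ Function.minimalPeriod g x then p else 1 := by
    rw [← Finset.prod_pow]
    refine Finset.prod_le_prod' fun p hp => ?_
    rw [Finset.prod_ite, Finset.prod_const, Finset.prod_const_one, mul_one]
    exact Nat.pow_le_pow_right (hQ p hp).pos
      (card_support_pow_le_card_filter_dvd_minimalPeriod (hQ p hp) hμ (hg p hp))
  refine h1.trans ?_
  rw [Finset.prod_comm, ← Finset.card_univ, ← Finset.prod_const]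
  refine Finset.prod_le_prod' fun x _ => ?_
  rw [← Finset.prod_filter, Finset.card_univ]
  refine le_trans (Nat.le_of_dvd ?_ (Finset.prod_primes_dvd _ (fun p hp => ?_) fun p hp => ?_))
    (Function.minimalPeriod_le_card (f := g) (x := x))
  · exact Function.minimalPeriod_pos_of_mem_periodicPts
      (g.injective.mem_periodicPts x)
  · exact (hQ p (Finset.mem_filter.1 hp).1).prime
  · exact (Finset.mem_filter.1 hp).2

theorem exists_dvd_orderOf_of_largeOrbit_nonempty {G : Subgroup (Perm α)}
    (hn : 2 ≤ Fintype.card α) {Q : Finset ℕ} (hQ : ∀ p ∈ Q, p.Prime)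
    (h : ∀ S : Finset α, S.card ≤ ∑ p ∈ Q, p →
      (largeOrbit (pointwiseStabilizer G S)).Nonempty) :
    ∃ g ∈ G, ∀ p ∈ Q, p ∣ orderOf g := by
  have : ∀ p : Q, NeZero p.1 := fun p => ⟨(hQ p.1 p.2).ne_zero⟩
  have hI : Fintype.card (Σ p : Q, ZMod p.1) = ∑ p ∈ Q, p := by
    rw [Fintype.card_sigma]
    simp only [ZMod.card]
    exact Finset.sum_coe_sort Q fun p => p
  obtain ⟨f, hf, hG⟩ := exists_forall_perm_of_largeOrbit_nonempty (I := Σ p : Q, ZMod p.1) hn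
    (by rwa [hI])
  obtain ⟨g, hg, hgf⟩ := hG (Equiv.sigmaCongrRight fun _ => Equiv.addRight 1)
  refine ⟨g, hg, fun p hp => ?_⟩
  have h1 : ∀ (j : ℕ) , (g ^ j) (f ⟨⟨p, hp⟩, 0⟩) = f ⟨⟨p, hp⟩, (j : ZMod p)⟩ := by
    intro j
    induction j with
    | zero => simp
    | succ j ih =>
      rw [pow_succ', Perm.mul_apply, ih, hgf]
      simp
  have h2 := h1 (orderOf g)
  rw [pow_orderOf_eq_one, Perm.one_apply] at h2
  have h3 := hf h2
  rw [Sigma.mk.injEq] at h3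
  exact (ZMod.natCast_eq_zero_iff _ _).1 (eq_of_heq h3.2).symm

end CycleLengths

section DoublyTransitiveOrder

variable {α : Type*} [Fintype α] {G : Subgroup (Perm α)}

theorem log_card_le_of_largeOrbit_eq_empty
    (h2 : ∀ a b c d : α, a ≠ b → c ≠ d → ∃ g ∈ G, g a = c ∧ g b = d)
    (hn : 2 ≤ Fintype.card α) {S : Finset α} {k : ℕ} (hSk : S.card ≤ k)
    (hS : largeOrbit (pointwiseStabilizer G S) = ∅) :
    Real.log (Nat.card G) ≤
      k * ((Real.log (Fintype.card α) + Real.log 2 / 2) ^ 2 / (2 * Real.log 2) + 4) := by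
  classical
  have : Nonempty α := Fintype.card_pos_iff.1 (by omega)
  have : Nontrivial α := Fintype.one_lt_card_iff_nontrivial.1 (by omega)
  have h1 : ∀ x y : α, ∃ g ∈ G, g x = y := fun x y => by
    obtain ⟨x', hx'⟩ := exists_ne x
    obtain ⟨y', hy'⟩ := exists_ne y
    obtain ⟨g, hg, h, -⟩ := h2 x x' y y' hx'.symm hy'.symm
    exact ⟨g, hg, h⟩
  have hexp : Real.exp (-Real.log 2) = 1 / 2 := by
    rw [Real.exp_neg, Real.exp_log two_pos, one_div]
  have hmain := log_card_le_mul_of_separated (G := G)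
    (fun g : G => S.map (g⁻¹ : G).1.toEmbedding) (k := k) (c := Real.log 2)
    (Real.log_pos one_lt_two) ?_ ?_
  · rw [hexp] at hmain
    refine hmain.trans (Eq.le ?_)
    norm_num
  · intro s
    have h3 := sum_apply_of_transitive h1 (fun x => if x ∈ S then (1 : ℝ) else 0) s
    rw [Finset.sum_boole, Finset.sum_boole, Finset.filter_mem_eq_inter, Finset.univ_inter] at h3
    have h4 : ∀ g : G, s ∈ S.map (g⁻¹ : G).1.toEmbedding ↔ g.1 s ∈ S := fun g => by
      simp only [Finset.mem_map_equiv, InvMemClass.coe_inv]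
      exact Iff.rfl
    simp only [h4]
    have h5 : Fintype.card α * (Finset.univ.filter fun g : G => g.1 s ∈ S).card =
        Fintype.card G * S.card := by exact_mod_cast h3
    rw [h5, mul_comm]
    exact Nat.mul_le_mul_right _ hSk
  · intro x y hxy
    rw [hexp]
    have h3 := sum_apply_pair_of_doubly_transitive h2
      (fun x y => if y ∉ orbitFinset (pointwiseStabilizer G S) x then (1 : ℝ) else 0) hxy
    have h4 : ∀ g : G,
        y ∉ orbitFinset (pointwiseStabilizer G (S.map (g⁻¹ : G).1.toEmbedding)) x ↔
          g.1 y ∉ orbitFinset (pointwiseStabilizer G S) (g.1 x) := fun g => by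
      rw [not_iff_not, ← map_mem_orbitFinset_iff g⁻¹.2 S (g.1 x) (g.1 y)]
      simp
    simp only [h4]
    rw [Finset.sum_boole] at h3
    have h5 : ((Fintype.card α : ℝ) * Fintype.card α) ≤
        2 * ∑ p ∈ (Finset.univ : Finset α).offDiag,
          (if p.2 ∉ orbitFinset (pointwiseStabilizer G S) p.1 then (1 : ℝ) else 0) := by
      have h6 : ∑ p ∈ (Finset.univ : Finset α).offDiag,
          (if p.2 ∉ orbitFinset (pointwiseStabilizer G S) p.1 then (1 : ℝ) else 0) =
          ∑ x : α, ∑ y : α,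
            if y ∉ orbitFinset (pointwiseStabilizer G S) x then (1 : ℝ) else 0 := by
        rw [← Finset.sum_product', Finset.univ_product_univ]
        refine Finset.sum_subset (Finset.subset_univ _) fun p _ hp => ?_
        rw [Finset.mem_offDiag] at hp
        have : p.1 = p.2 := by simpa using hp
        rw [if_neg]
        rw [← this, not_not]
        exact self_mem_orbitFinset _ _
      rw [h6, Finset.mul_sum]
      have h7 : ∀ x : α, (Fintype.card α : ℝ) ≤
          2 * ∑ y : α, if y ∉ orbitFinset (pointwiseStabilizer G S) x then (1 : ℝ) else 0 := by
        intro x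
        have h8 : x ∉ largeOrbit (pointwiseStabilizer G S) := by simp [hS]
        rw [mem_largeOrbit] at h8
        have h9 : (Finset.univ.filter fun y =>
            y ∉ orbitFinset (pointwiseStabilizer G S) x).card =
            Fintype.card α - (orbitFinset (pointwiseStabilizer G S) x).card := by
          rw [← Finset.card_compl]
          congr 1
          ext y
          simp
        rw [Finset.sum_boole, h9]
        have : Fintype.card α ≤
            2 * (Fintype.card α - (orbitFinset (pointwiseStabilizer G S) x).card) := by omega
        exact_mod_cast this
      calc (Fintype.card α : ℝ) * Fintype.card α = ∑ _x : α, (Fintype.card α : ℝ) := by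
            rw [Finset.sum_const, Finset.card_univ, nsmul_eq_mul]
        _ ≤ _ := Finset.sum_le_sum fun x _ => h7 x
    have hn' : (2 : ℝ) ≤ Fintype.card α := by exact_mod_cast hn
    set n : ℝ := (Fintype.card α : ℝ)
    set N : ℝ := (Fintype.card G : ℝ)
    set s : ℝ := ((Finset.univ.filter fun g : G =>
      g.1 y ∉ orbitFinset (pointwiseStabilizer G S) (g.1 x)).card : ℝ)
    have hs : 0 ≤ s := Nat.cast_nonneg _
    have hN : 0 ≤ N := Nat.cast_nonneg _
    have h10 : N * (n * n) ≤ 2 * (n * (n - 1) * s) := by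
      rw [h3]
      nlinarith [mul_le_mul_of_nonneg_left h5 hN]
    have h11 : n * n * N ≤ n * n * (2 * s) := by nlinarith [mul_nonneg (by linarith : 0 ≤ n) hs]
    have h12 := le_of_mul_le_mul_left h11 (by positivity)
    linarith

theorem log_card_le_of_card_support [DecidableEq α]
    (h2 : ∀ a b c d : α, a ≠ b → c ≠ d → ∃ g ∈ G, g a = c ∧ g b = d)
    (hn : 2 ≤ Fintype.card α) {μ : ℕ} (hμ : ∀ g ∈ G, g ≠ 1 → μ ≤ g.support.card)
    {Q : Finset ℕ} (hQ : ∀ p ∈ Q, p.Prime)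
    (h : Fintype.card α ^ Fintype.card α < (∏ p ∈ Q, p) ^ μ) :
    Real.log (Nat.card G) ≤ (∑ p ∈ Q, p : ℕ) *
      ((Real.log (Fintype.card α) + Real.log 2 / 2) ^ 2 / (2 * Real.log 2) + 4) := by
  by_cases hS : ∃ S : Finset α, S.card ≤ ∑ p ∈ Q, p ∧
      largeOrbit (pointwiseStabilizer G S) = ∅
  · obtain ⟨S, hSk, hS⟩ := hS
    exact log_card_le_of_largeOrbit_eq_empty h2 hn hSk hS
  · push Not at hS
    obtain ⟨g, hg, hgQ⟩ := exists_dvd_orderOf_of_largeOrbit_nonempty hn hQ hS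
    exact absurd (prod_pow_le_of_forall_dvd_orderOf hQ
      (fun j => hμ _ (G.pow_mem hg j)) hgQ) h.not_ge

end DoublyTransitiveOrder

section LargeDegree

theorem belowDegree_of_le {n : ℕ} (hn : 3400 ≤ n) : belowDegree n (11 * n / 35) := by
  simp only [belowDegree, decide_eq_true_eq]
  have h1 : 35 * (11 * n / 35) ≤ 11 * n := Nat.mul_div_le _ _
  have h2 : 11 * n < 35 * (11 * n / 35) + 35 := by omega
  set m := 11 * n / 35
  refine ⟨?_, by omega, by omega⟩
  obtain ⟨d, hd⟩ : ∃ d, n = 3 * m + d := ⟨n - 3 * m, by omega⟩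
  rw [hd, Nat.add_sub_cancel_left, ← hd]
  have h3 : 2 * n ≤ 35 * d := by omega
  have h4 : (2 * n) ^ 2 ≤ (35 * d) ^ 2 := Nat.pow_le_pow_left h3 2
  nlinarith

theorem log_card_le_of_pow_le {α : Type*} [Fintype α] [DecidableEq α] {G : Subgroup (Perm α)}
    (h2 : ∀ a b c d : α, a ≠ b → c ≠ d → ∃ g ∈ G, g a = c ∧ g b = d)
    (hG : IsPreprimitive G α) (hA : ¬ alternatingGroup α ≤ G) (hn : 3400 ≤ Fintype.card α)
    {Q : Finset ℕ} (hQ : ∀ p ∈ Q, p.Prime) (h : Fintype.card α ^ 35 ≤ (∏ p ∈ Q, p) ^ 11) :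
    Real.log (Nat.card G) ≤ (∑ p ∈ Q, p : ℕ) *
      ((Real.log (Fintype.card α) + Real.log 2 / 2) ^ 2 / (2 * Real.log 2) + 4) := by
  refine log_card_le_of_card_support h2 (by omega) (μ := 11 * Fintype.card α / 35 + 1)
    (fun g hg hg1 => lt_card_support_of_belowDegree h2 hG hA (by omega) (belowDegree_of_le hn)
      hg hg1) hQ ?_
  set n := Fintype.card α
  set P := ∏ p ∈ Q, p
  have hP : 1 < P := by
    by_contra! hP
    have h3 := Nat.pow_le_pow_left hP 11
    have h4 := Nat.one_lt_pow (by norm_num : 35 ≠ 0) (by omega : 1 < n)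
    rw [one_pow] at h3
    omega
  refine lt_of_pow_lt_pow_left₀ 35 (Nat.zero_le _) ?_
  calc (n ^ n) ^ 35 = (n ^ 35) ^ n := pow_right_comm _ _ _
    _ ≤ (P ^ 11) ^ n := Nat.pow_le_pow_left h n
    _ = P ^ (11 * n) := (pow_mul _ _ _).symm
    _ < P ^ ((11 * n / 35 + 1) * 35) := Nat.pow_lt_pow_right hP (by omega)
    _ = (P ^ (11 * n / 35 + 1)) ^ 35 := pow_mul _ _ _

theorem log_add_sq_le {x x₀ b : ℝ} (hx₀ : 0 < x₀) (hx : x₀ ≤ x) (hb : 2 ≤ Real.log x₀ + b) :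
    (Real.log x + b) ^ 2 ≤ (Real.log x₀ + b) ^ 2 * (x / x₀) := by
  have hx' : 0 < x := hx₀.trans_le hx
  set a := Real.log x₀ + b with ha
  set s := Real.sqrt (x / x₀) with hs
  have hs2 : s ^ 2 = x / x₀ := Real.sq_sqrt (by positivity)
  have hs1 : 1 ≤ s := Real.one_le_sqrt.2 ((one_le_div hx₀).2 hx)
  have h1 : Real.log x = Real.log x₀ + 2 * Real.log s := by
    have h2 : 2 * Real.log s = Real.log (s ^ 2) := by
      rw [Real.log_pow]
      norm_num
    rw [h2, hs2, ← Real.log_mul hx₀.ne' (by positivity), mul_div_cancel₀ _ hx₀.ne']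
  have h2 := Real.log_le_sub_one_of_pos (show 0 < s by linarith)
  have h3 := Real.log_nonneg hs1
  have h4 : Real.log x + b ≤ a * s := by nlinarith
  rw [← hs2, ← mul_pow]
  exact pow_le_pow_left₀ (by linarith) h4 2

theorem log_quotient_le_mul {n n₀ L T : ℝ} (hn₀ : 6 ≤ n₀) (hn : n₀ ≤ n) (hL : Real.log n₀ ≤ L)
    (hT : (L + 0.34658) ^ 2 / 1.38629 + 4 ≤ T * n₀) :
    (Real.log n + Real.log 2 / 2) ^ 2 / (2 * Real.log 2) + 4 ≤ T * n := by
  have u2 := Real.log_two_lt_d9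
  have l2 := Real.log_two_gt_d9
  have h6 : Real.log 4 ≤ Real.log 6 := Real.log_le_log (by norm_num) (by norm_num)
  have h7 : Real.log 6 ≤ Real.log n₀ := Real.log_le_log (by norm_num) hn₀
  have h8 : Real.log 6 = Real.log 2 + Real.log 3 := by
    rw [← Real.log_mul (by norm_num) (by norm_num)]
    norm_num
  have := Real.log_three_gt_d9
  have h1 := log_add_sq_le (b := Real.log 2 / 2) (by linarith) hn (by linarith)
  have h2 : (Real.log n₀ + Real.log 2 / 2) ^ 2 ≤ (L + 0.34658) ^ 2 :=
    pow_le_pow_left₀ (by linarith) (by linarith) 2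
  have hr : 1 ≤ n / n₀ := (one_le_div (by linarith)).2 hn
  have h3 : (Real.log n + Real.log 2 / 2) ^ 2 ≤ (L + 0.34658) ^ 2 * (n / n₀) :=
    h1.trans (mul_le_mul_of_nonneg_right h2 (by linarith))
  have h4 : (Real.log n + Real.log 2 / 2) ^ 2 / (2 * Real.log 2) ≤
      (L + 0.34658) ^ 2 * (n / n₀) / 1.38629 :=
    div_le_div₀ (by positivity) h3 (by norm_num) (by linarith)
  have h5 : T * n = T * n₀ * (n / n₀) := by
    rw [mul_assoc, mul_div_cancel₀ _ (by linarith)]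
  rw [h5]
  have h9 := mul_le_mul_of_nonneg_right hT (show 0 ≤ n / n₀ by linarith)
  have h10 : (L + 0.34658) ^ 2 * (n / n₀) / 1.38629 =
      (L + 0.34658) ^ 2 / 1.38629 * (n / n₀) := by ring
  rw [h10] at h4
  linarith

theorem mul_log_le {x : ℝ} (hx : 0 < x) (j k : ℕ) :
    j * Real.log x ≤ k * Real.log 2 + (x ^ j / 2 ^ k - 1) := by
  have := log_le_of_le (pow_pos hx j) (pow_pos (zero_lt_two (α := ℝ)) k)
  rwa [Real.log_pow, Real.log_pow] at this

theorem exists_primes_prod_le (r : ℕ) : ∃ Q : Finset ℕ,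
    (∀ p ∈ Q, p.Prime ∧ p ≤ 2 ^ (r + 1)) ∧ 2 ^ (r * (r + 1)) ≤ (∏ p ∈ Q, p) ^ 2 ∧
      ∑ p ∈ Q, p ≤ 2 ^ (r + 2) := by
  induction r with
  | zero => exact ⟨∅, by simp⟩
  | succ r ih =>
    obtain ⟨Q, hQ, hprod, hsum⟩ := ih
    obtain ⟨p, hp, hlt, hle⟩ :=
      Nat.exists_prime_lt_and_le_two_mul (2 ^ (r + 1)) (by positivity)
    rw [← pow_succ'] at hle
    have hpQ : p ∉ Q := fun h => ((hQ p h).2.trans_lt hlt).false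
    refine ⟨insert p Q, ?_, ?_, ?_⟩
    · simp only [Finset.forall_mem_insert]
      exact ⟨⟨hp, hle⟩, fun q hq =>
        ⟨(hQ q hq).1, (hQ q hq).2.trans (Nat.pow_le_pow_right two_pos (by omega))⟩⟩
    · rw [Finset.prod_insert hpQ, mul_pow]
      calc 2 ^ ((r + 1) * (r + 1 + 1)) = (2 ^ (r + 1)) ^ 2 * 2 ^ (r * (r + 1)) := by ring
        _ ≤ p ^ 2 * (∏ p ∈ Q, p) ^ 2 := Nat.mul_le_mul (Nat.pow_le_pow_left hlt.le 2) hprod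
    · rw [Finset.sum_insert hpQ]
      calc p + ∑ p ∈ Q, p ≤ 2 ^ (r + 1 + 1) + 2 ^ (r + 2) := Nat.add_le_add hle hsum
        _ = 2 ^ (r + 1 + 2) := by ring

theorem factorization_mul_le_of_mul_factorial_dvd {n m N e p : ℕ} (hp : p.Prime)
    (hm : m < n) (h : N * m.factorial ∣ n.factorial) (he : n < p ^ (e + 1)) :
    (N.factorization p : ℝ) ≤ e + (n - m - 1) / (p - 1) := by
  have h1 : N ∣ n.choose m * (n - m).factorial := by
    rw [← Nat.choose_mul_factorial_mul_factorial hm.le, mul_right_comm] at h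
    exact Nat.dvd_of_mul_dvd_mul_right m.factorial_pos h
  have h2 := (Nat.factorization_le_iff_dvd (ne_zero_of_dvd_ne_zero
    (mul_ne_zero (Nat.choose_pos hm.le).ne' (Nat.factorial_ne_zero _)) h1)
    (mul_ne_zero (Nat.choose_pos hm.le).ne' (Nat.factorial_ne_zero _))).2 h1 p
  rw [Nat.factorization_mul (Nat.choose_pos hm.le).ne' (Nat.factorial_ne_zero _),
    Finsupp.add_apply] at h2
  have h3 : (n.choose m).factorization p ≤ e := Nat.factorization_choose_le_log.trans
    (Nat.lt_succ_iff.1 (Nat.log_lt_of_lt_pow (by omega) he))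
  have h4 := factorization_mul_sub_one_le hp (Nat.sub_pos_of_lt hm) dvd_rfl
  rw [Nat.cast_sub hm.le, ← le_div_iff₀ (sub_pos.2 (by exact_mod_cast hp.one_lt))] at h4
  have h5 : (N.factorization p : ℝ) ≤ (n.choose m).factorization p +
      (n - m).factorial.factorization p := by exact_mod_cast h2
  have h6 : ((n.choose m).factorization p : ℝ) ≤ e := by exact_mod_cast h3
  linarith

theorem cardFactors_le_of_log_le_of_lt {n N : ℕ} (hn : 3400 ≤ n) (hn' : n < 6000)
    (h : N * (11 * n / 35).factorial ∣ n.factorial) (hlog : Real.log N ≤ 3.25 * n) :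
    ArithmeticFunction.cardFactors N ≤ 2 * n - 5 := by
  by_contra! hcon
  have hcon' : (2 * n - 4 : ℝ) ≤ ArithmeticFunction.cardFactors N := by
    have : 2 * n ≤ ArithmeticFunction.cardFactors N + 4 := by omega
    have : (2 * n : ℝ) ≤ ArithmeticFunction.cardFactors N + 4 := by exact_mod_cast this
    linarith
  have hn₀ : (3400 : ℝ) ≤ n := by exact_mod_cast hn
  have hm : (n : ℝ) - (11 * n / 35 : ℕ) - 1 ≤ 24 * n / 35 := by
    have h1 : 11 * n ≤ 35 * (11 * n / 35) + 35 := by omega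
    have h2 : (11 * n : ℝ) ≤ 35 * (11 * n / 35 : ℕ) + 35 := by exact_mod_cast h1
    linarith
  have key : ∀ (p e : ℕ) (w : ℝ), p.Prime → n < p ^ (e + 1) → 24 / (p : ℝ) ≤ w → p ≤ 24 →
      (N.factorization p : ℝ) * (Real.log 24 - Real.log p) ≤
        (e + 24 * n / 35 / (p - 1)) * Real.log w := by
    intro p e w hp he hw hp24
    have hp1 : (0 : ℝ) < p - 1 := sub_pos.2 (by exact_mod_cast hp.one_lt)
    have hp0 : (0 : ℝ) < p := by linarith
    have h1 := factorization_mul_le_of_mul_factorial_dvd hp (by omega) h he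
    have h2 : (N.factorization p : ℝ) ≤ e + 24 * n / 35 / (p - 1) :=
      h1.trans (add_le_add_right (div_le_div_of_nonneg_right hm hp1.le) _)
    have hw1 : 1 ≤ 24 / (p : ℝ) := (one_le_div hp0).2 (by exact_mod_cast hp24)
    have h3 : Real.log 24 - Real.log p ≤ Real.log w := by
      rw [← Real.log_div (by norm_num) hp0.ne']
      exact Real.log_le_log (by linarith) hw
    calc (N.factorization p : ℝ) * (Real.log 24 - Real.log p) ≤
        N.factorization p * Real.log w := mul_le_mul_of_nonneg_left h3 (Nat.cast_nonneg _)
      _ ≤ _ := mul_le_mul_of_nonneg_right h2 (Real.log_nonneg (hw1.trans hw))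
  have h0 := cardFactors_mul_log_le (N := N) (P := 24)
  rw [show Nat.primesBelow 24 = {2, 3, 5, 7, 11, 13, 17, 19, 23} by decide,
    Finset.sum_insert (by decide), Finset.sum_insert (by decide), Finset.sum_insert (by decide),
    Finset.sum_insert (by decide), Finset.sum_insert (by decide), Finset.sum_insert (by decide),
    Finset.sum_insert (by decide), Finset.sum_insert (by decide), Finset.sum_singleton] at h0
  simp only [Nat.cast_ofNat] at h0
  have k2 := key 2 12 12 (by norm_num) (by omega) (by norm_num) (by norm_num)
  have k3 := key 3 7 8 (by norm_num) (by omega) (by norm_num) (by norm_num)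
  have k5 := key 5 5 5 (by norm_num) (by omega) (by norm_num) (by norm_num)
  have k7 := key 7 4 (2 ^ 2) (by norm_num) (by omega) (by norm_num) (by norm_num)
  have k11 := key 11 3 (12 / 5) (by norm_num) (by omega) (by norm_num) (by norm_num)
  have k13 := key 13 3 2 (by norm_num) (by omega) (by norm_num) (by norm_num)
  have k17 := key 17 3 (3 / 2) (by norm_num) (by omega) (by norm_num) (by norm_num)
  have k19 := key 19 2 (3 / 2) (by norm_num) (by omega) (by norm_num) (by norm_num)
  have k23 := key 23 2 (3 / 2) (by norm_num) (by omega) (by norm_num) (by norm_num)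
  have l2 := Real.log_two_gt_d9
  have l3 := Real.log_three_gt_d9
  have l5 := Real.log_five_gt_d9
  have u2 := Real.log_two_lt_d9
  have u3 := Real.log_three_lt_d9
  have u5 := Real.log_five_lt_d9
  have e12 : Real.log 12 = 2 * Real.log 2 + Real.log 3 := by
    rw [show (12 : ℝ) = 2 ^ 2 * 3 by norm_num, Real.log_mul (by norm_num) (by norm_num),
      Real.log_pow]
    norm_num
  have e24 : Real.log 24 = 3 * Real.log 2 + Real.log 3 := by
    rw [show (24 : ℝ) = 2 ^ 3 * 3 by norm_num, Real.log_mul (by norm_num) (by norm_num),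
      Real.log_pow]
    norm_num
  have e8 : Real.log 8 = 3 * Real.log 2 := by
    rw [show (8 : ℝ) = 2 ^ 3 by norm_num, Real.log_pow]
    norm_num
  simp only [Nat.cast_ofNat] at k2 k3 k5 k7 k11 k13 k17 k19 k23
  rw [Real.log_pow] at k7
  rw [Real.log_div (by norm_num) (by norm_num)] at k11 k17 k19 k23
  have g : (2 * n - 4) * Real.log 24 ≤
      ArithmeticFunction.cardFactors N * Real.log 24 :=
    mul_le_mul_of_nonneg_right hcon' (by linarith)
  have g' : ((2 * n - 4) * 3.178 : ℝ) ≤ (2 * n - 4) * Real.log 24 :=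
    mul_le_mul_of_nonneg_left (by linarith) (by linarith)
  have bound : ∀ {q d e w a : ℝ}, q ≤ (e + 24 * n / 35 / (d - 1)) * w → 0 ≤ e → 1 < d →
      w ≤ a → q ≤ (e + 24 * n / 35 / (d - 1)) * a := fun hq he hd hw =>
    hq.trans (mul_le_mul_of_nonneg_left hw
      (add_nonneg he (div_nonneg (by linarith) (by linarith))))
  have b2 := bound (a := 2.485) k2 (by norm_num) (by norm_num) (by linarith)
  have b3 := bound (a := 2.08) k3 (by norm_num) (by norm_num) (by linarith)
  have b5 := bound (a := 1.61) k5 (by norm_num) (by norm_num) (by linarith)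
  have b7 := bound (a := 1.387) k7 (by norm_num) (by norm_num) (by push_cast; linarith)
  have b11 := bound (a := 0.876) k11 (by norm_num) (by norm_num) (by linarith)
  have b13 := bound (a := 0.694) k13 (by norm_num) (by norm_num) (by linarith)
  have b17 := bound (a := 0.406) k17 (by norm_num) (by norm_num) (by linarith)
  have b19 := bound (a := 0.406) k19 (by norm_num) (by norm_num) (by linarith)
  have b23 := bound (a := 0.406) k23 (by norm_num) (by norm_num) (by linarith)
  clear k2 k3 k5 k7 k11 k13 k17 k19 k23 key
  linarith

theorem add_sq_le_two_pow (i : ℕ) : (2 * i + 40) ^ 2 ≤ 2 ^ (i + 17) := by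
  induction i with
  | zero => norm_num
  | succ i ih =>
    rw [show i + 1 + 17 = i + 17 + 1 by ring, pow_succ 2 (i + 17)]
    have h : (2 * (i + 1) + 40) ^ 2 + (4 * i ^ 2 + 152 * i + 1436) = (2 * i + 40) ^ 2 * 2 := by ring
    exact (Nat.le.intro h).trans (Nat.mul_le_mul_right 2 ih)

theorem exists_primes_of_large {n : ℕ} (hn : 2 * 10 ^ 11 ≤ n) : ∃ Q : Finset ℕ,
    (∀ p ∈ Q, p.Prime) ∧ n ^ 35 ≤ (∏ p ∈ Q, p) ^ 11 ∧
      (∑ p ∈ Q, p : ℕ) * ((Real.log n + Real.log 2 / 2) ^ 2 / (2 * Real.log 2) + 4) ≤ n := by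
  have l2 := Real.log_two_gt_d9
  have u2 := Real.log_two_lt_d9
  have hn0 : n ≠ 0 := by omega
  have hj1 : 4 ^ Nat.log 4 n ≤ n := Nat.pow_log_le_self 4 hn0
  have hj2 : n < 4 ^ (Nat.log 4 n + 1) := Nat.lt_pow_succ_log_self (by norm_num) n
  have hj : 18 ≤ Nat.log 4 n := (Nat.le_log_iff_pow_le (by norm_num) hn0).2 (by omega)
  obtain ⟨i, hi⟩ : ∃ i, Nat.log 4 n = i + 18 := ⟨_, (Nat.sub_add_cancel hj).symm⟩
  rw [hi] at hj1 hj2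
  obtain ⟨Q, hQ, hprod, hsum⟩ := exists_primes_prod_le (i + 17)
  have hpow : n ^ 35 ≤ (∏ p ∈ Q, p) ^ 11 := by
    refine le_of_pow_le_pow_left₀ two_ne_zero (Nat.zero_le _) ?_
    calc (n ^ 35) ^ 2 ≤ ((4 ^ (i + 18 + 1)) ^ 35) ^ 2 := by gcongr
      _ = 2 ^ (140 * (i + 19)) := by
        rw [show (4 : ℕ) = 2 ^ 2 by norm_num, ← pow_mul, ← pow_mul, ← pow_mul]
        congr 1
        ring
      _ ≤ 2 ^ ((i + 17) * (i + 17 + 1) * 11) := Nat.pow_le_pow_right two_pos (by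
        clear * -
        nlinarith)
      _ = (2 ^ ((i + 17) * (i + 17 + 1))) ^ 11 := pow_mul _ _ _
      _ ≤ ((∏ p ∈ Q, p) ^ 2) ^ 11 := Nat.pow_le_pow_left hprod 11
      _ = ((∏ p ∈ Q, p) ^ 11) ^ 2 := by ring
  have hlog : Real.log n ≤ (2 * i + 38) * Real.log 2 := by
    have h3 : (n : ℝ) ≤ 2 ^ (2 * i + 38) := by
      have : n ≤ 2 ^ (2 * i + 38) := by
        rw [show (4 : ℕ) = 2 ^ 2 by norm_num, ← pow_mul] at hj2
        exact hj2.le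
      exact_mod_cast this
    have h4 := Real.log_le_log (by exact_mod_cast hn0.bot_lt) h3
    rw [Real.log_pow] at h4
    exact_mod_cast h4
  have hT : (Real.log n + Real.log 2 / 2) ^ 2 / (2 * Real.log 2) + 4 ≤ (2 * i + 40) ^ 2 := by
    have hi0 : (0 : ℝ) ≤ i := Nat.cast_nonneg i
    have h3 : Real.log n + Real.log 2 / 2 ≤ (2 * i + 39) * Real.log 2 := by linarith
    have h4 : (Real.log n + Real.log 2 / 2) ^ 2 ≤ ((2 * i + 39) * Real.log 2) ^ 2 :=
      pow_le_pow_left₀ (add_nonneg (Real.log_natCast_nonneg n) (by linarith)) h3 2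
    have h5 : (Real.log n + Real.log 2 / 2) ^ 2 / (2 * Real.log 2) ≤
        (2 * i + 39) ^ 2 * (Real.log 2 / 2) := by
      rw [div_le_iff₀ (by linarith)]
      refine h4.trans (Eq.le ?_)
      ring
    have h6 : (2 * i + 39 : ℝ) ^ 2 * (Real.log 2 / 2) ≤ (2 * i + 39) ^ 2 * (1 / 2) :=
      mul_le_mul_of_nonneg_left (by linarith) (sq_nonneg _)
    nlinarith only [h5, h6, hi0]
  have h5 : (∑ p ∈ Q, p : ℕ) * (2 * i + 40) ^ 2 ≤ n := by
    refine (Nat.mul_le_mul hsum (add_sq_le_two_pow i)).trans (le_trans (Eq.le ?_) hj1)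
    rw [show (4 : ℕ) = 2 ^ 2 by norm_num, ← pow_mul, ← pow_add]
    congr 1
    ring
  have h6 : ((∑ p ∈ Q, p : ℕ) : ℝ) * (2 * i + 40) ^ 2 ≤ n := by exact_mod_cast h5
  have h7 := mul_le_mul_of_nonneg_left hT (Nat.cast_nonneg (α := ℝ) (∑ p ∈ Q, p))
  exact ⟨Q, fun p hp => (hQ p hp).1, hpow, h7.trans h6⟩

theorem cardFactors_le_of_doubly_transitive {α : Type*} [Fintype α] [DecidableEq α]
    {G : Subgroup (Perm α)}
    (h2 : ∀ a b c d : α, a ≠ b → c ≠ d → ∃ g ∈ G, g a = c ∧ g b = d)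
    (hG : IsPreprimitive G α) (hA : ¬ alternatingGroup α ≤ G) (hn : 3400 ≤ Fintype.card α) :
    ArithmeticFunction.cardFactors (Nat.card G) ≤ 2 * Fintype.card α - 5 := by
  have hd : Nat.card G ∣ (Fintype.card α).factorial := by
    rw [← Fintype.card_perm, ← Nat.card_eq_fintype_card]
    exact G.card_subgroup_dvd_card
  have hbound : ∀ Q : Finset ℕ, (∀ p ∈ Q, p.Prime) → Fintype.card α ^ 35 ≤ (∏ p ∈ Q, p) ^ 11 →
      ∀ (k : ℕ) (n₀ L T : ℝ), ∑ p ∈ Q, p ≤ k → 6 ≤ n₀ → n₀ ≤ Fintype.card α → Real.log n₀ ≤ L →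
      (L + 0.34658) ^ 2 / 1.38629 + 4 ≤ T * n₀ →
      Real.log (Nat.card G) ≤ k * (T * Fintype.card α) := by
    intro Q hQ hpow k n₀ L T hk hn₀ hn₁ hL hT
    have h1 := log_quotient_le_mul hn₀ hn₁ hL hT
    refine (log_card_le_of_pow_le h2 hG hA hn hQ hpow).trans ?_
    refine mul_le_mul (by exact_mod_cast hk) h1 ?_ (Nat.cast_nonneg _)
    have := Real.log_two_gt_d9
    positivity
  have hprimes : ∀ m, ∀ p ∈ Nat.primesBelow m, p.Prime := fun m p hp =>
    (Nat.mem_primesBelow.1 hp).2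
  have l2 := Real.log_two_gt_d9
  have u2 := Real.log_two_lt_d9
  have hn' : (3400 : ℝ) ≤ Fintype.card α := by exact_mod_cast hn
  set n := Fintype.card α with hncard
  by_cases c1 : n < 11000
  · have hs : ∑ p ∈ Nat.primesBelow 38, p = 197 := by decide +kernel
    have hp : ∏ p ∈ Nat.primesBelow 38, p = 7420738134810 := by decide +kernel
    have hpow : n ^ 35 ≤ (∏ p ∈ Nat.primesBelow 38, p) ^ 11 := by
      rw [hp]
      exact (Nat.pow_le_pow_left c1.le 35).trans (by norm_num)
    by_cases c0 : n < 6000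
    · refine cardFactors_le_of_log_le_of_lt hn c0
        (card_mul_factorial_dvd_of_lt_card_support (by omega) fun g hg hg1 =>
          lt_card_support_of_belowDegree h2 hG hA (by omega) (belowDegree_of_le hn) hg hg1) ?_
      have hL := mul_log_le (x := 3400) (by norm_num) 1 12
      have h1 := hbound _ (hprimes 38) hpow 197 3400 8.148 (3.25 / 197) hs.le (by norm_num) hn'
        (by push_cast at hL; linarith) (by norm_num)
      push_cast at h1
      linarith
    · have hL := mul_log_le (x := 6000) (by norm_num) 1 13
      have h1 := hbound _ (hprimes 38) hpow 197 6000 8.7434 (2.14 / 197) hs.le (by norm_num)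
        (by exact_mod_cast not_lt.1 c0) (by push_cast at hL; linarith) (by norm_num)
      refine cardFactors_le_of_log_le (by omega) hd ?_
      push_cast at h1
      linarith
  by_cases c2 : n < 50000
  · have hs : ∑ p ∈ Nat.primesBelow 48, p = 328 := by decide +kernel
    have hp : ∏ p ∈ Nat.primesBelow 48, p = 614889782588491410 := by decide +kernel
    have hL := mul_log_le (x := 11000) (by norm_num) 2 27
    have h1 := hbound _ (hprimes 48) (by
      rw [hp]
      exact (Nat.pow_le_pow_left c2.le 35).trans (by norm_num)) 328 11000 9.3083 (2.14 / 328)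
      hs.le (by norm_num) (by exact_mod_cast not_lt.1 c1) (by push_cast at hL; linarith)
      (by norm_num)
    refine cardFactors_le_of_log_le (by omega) hd ?_
    push_cast at h1
    linarith
  by_cases c3 : n < 2 * 10 ^ 11
  · have hs : ∑ p ∈ Nat.primesBelow 98, p = 1060 := by decide +kernel
    have hp : 2 * 10 ^ 36 ≤ ∏ p ∈ Nat.primesBelow 98, p := by decide +kernel
    have hL := mul_log_le (x := 50000) (by norm_num) 1 16
    have h1 := hbound _ (hprimes 98)
      (((Nat.pow_le_pow_left c3.le 35).trans (by norm_num)).trans (Nat.pow_le_pow_left hp 11))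
      1060 50000 10.8534 (2.14 / 1060) hs.le (by norm_num) (by exact_mod_cast not_lt.1 c2)
      (by push_cast at hL; linarith) (by norm_num)
    refine cardFactors_le_of_log_le (by omega) hd ?_
    push_cast at h1
    linarith
  obtain ⟨Q, hQ, hpow, hsum⟩ := exists_primes_of_large (not_lt.1 c3)
  have h1 := log_card_le_of_pow_le h2 hG hA hn hQ hpow
  refine cardFactors_le_of_log_le (by omega) hd ?_
  linarith

end LargeDegree

theorem cardFactors_card_le_of_isPreprimitive {α : Type*} [Fintype α] [DecidableEq α]
    (hn : 27 ≤ Fintype.card α) {G : Subgroup (Perm α)} (hG : IsPreprimitive G α)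
    (hA : ¬ alternatingGroup α ≤ G) :
    ArithmeticFunction.cardFactors (Nat.card G) ≤ 2 * Fintype.card α - 5 := by
  have hB := card_mul_factorial_le_of_isPreprimitive hG hA
  have hG0 : Nat.card G ≠ 0 := Nat.card_pos.ne'
  rcases Nat.lt_or_ge (Fintype.card α) 92 with h91 | h92
  · refine cardFactors_le_of_le_ninety_one hn (by omega) hG0 ?_ hB
    rw [← Fintype.card_perm, ← Nat.card_eq_fintype_card]
    exact G.card_subgroup_dvd_card
  by_cases h2 : ∀ a b c d : α, a ≠ b → c ≠ d → ∃ g ∈ G, g a = c ∧ g b = d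
  · rcases Nat.lt_or_ge (Fintype.card α) 3400 with h | h
    · obtain ⟨m, hm, hN⟩ := exists_belowDegree h92 h
      have hmn : 3 * m < Fintype.card α := by
        simp only [belowDegree, decide_eq_true_eq] at hm
        exact hm.2.2
      exact hN _ hG0 (card_mul_factorial_dvd_of_lt_card_support (by omega) fun g hg hg1 =>
        lt_card_support_of_belowDegree h2 hG hA (by omega) hm hg hg1) hB
    · exact cardFactors_le_of_doubly_transitive h2 hG hA h
  · refine cardFactors_le_of_not_doubly_transitive (fun x y => ?_) hG h92 h2
    obtain ⟨g, hg⟩ := hG.toIsPretransitive.exists_smul_eq x y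
    exact ⟨g, g.2, hg⟩

theorem stmt_7 (n : ℕ) (hn : 1 ≤ n) (A : Finset (Equiv.Perm (Fin n))) :
    ∃ A₀ : Finset (Equiv.Perm (Fin n)), A₀ ⊆ A ∪ A⁻¹ ∧
      Subgroup.closure (A₀ : Set (Equiv.Perm (Fin n)))
        = Subgroup.closure (A : Set (Equiv.Perm (Fin n))) ∧
      A₀.card ≤ 4 * n ∧ A₀ = A₀⁻¹ := by
  obtain ⟨B, hBA, hB, hcl⟩ := exists_subset_closure_eq A
  have hlen : subgroupLength (⊤ : Subgroup (Perm (Fin n))) ≤ 2 * n - 3 :=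
    subgroupLength_perm_le_of_primitive
      (fun m hm α _ _ hα G hG hA => by
        subst hα
        exact cardFactors_card_le_of_isPreprimitive hm hG hA) n (Fin n) (Fintype.card_fin n)
  refine ⟨B ∪ B⁻¹, Finset.union_subset_union hBA (Finset.inv_subset_inv hBA), ?_, ?_, ?_⟩
  · rw [Finset.coe_union, Finset.coe_inv, Subgroup.closure_union, Subgroup.closure_inv, sup_idem,
      hcl]
  · have h1 := Finset.card_union_le B B⁻¹
    rw [Finset.card_inv] at h1
    omega
  · ext g
    simp [or_comm]
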